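/- arXiv:0809.2172 — 4 statements merged into one kernel-verified Lean document; each statement's English description precedes it below -/
import Mathlib

section
/- Pizzetti's formula: for all positive integers n and m there exist positive constants c_0, c_1, …, c_{m−1}, depending only on n and the index i (with c_0 = 1), such that for every x_0 ∈ ℝ^n, every R > 0, and every function h that is C^{2m} on an open set containing the closed ball cl(B_R(x_0)) ⊂ ℝ^n and satisfies Δ^m h = 0 there, one has (1/|B_R(x_0)|) ∫_{B_R(x_0)} h(z) dz = Σ_{i=0}^{m−1} c_i R^{2i} (Δ^i h)(x_0). -/
open MeasureTheory Metric Filter Set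
open scoped ENNReal Topology

/-- The Euclidean Laplacian of `f : ℝ^n → ℝ` (trace of the Hessian, computed as the sum of
second directional derivatives along the standard orthonormal basis). -/
noncomputable def lap {n : ℕ} (f : EuclideanSpace ℝ (Fin n) → ℝ) :
    EuclideanSpace ℝ (Fin n) → ℝ :=
  fun x => ∑ i : Fin n,
    fderiv ℝ (fun y => fderiv ℝ f y (EuclideanSpace.single i 1)) x (EuclideanSpace.single i 1)


namespace Pizzetti

variable {n : ℕ}

lemma lap_contDiff {f : EuclideanSpace ℝ (Fin n) → ℝ} {m : ℕ}
    (hf : ContDiff ℝ ((m + 2 : ℕ) : WithTop ℕ∞) f) : ContDiff ℝ m (lap f) := by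
  unfold lap
  refine ContDiff.sum fun i _ => ?_
  have h1 : ContDiff ℝ ((m + 1 : ℕ) : WithTop ℕ∞)
      (fun y => fderiv ℝ f y (EuclideanSpace.single i 1)) :=
    (hf.fderiv_right (by norm_cast)).clm_apply contDiff_const
  exact (h1.fderiv_right (by norm_cast)).clm_apply contDiff_const

lemma lap_congr {f g : EuclideanSpace ℝ (Fin n) → ℝ} {V : Set (EuclideanSpace ℝ (Fin n))}
    (hV : IsOpen V) (h : EqOn f g V) : EqOn (lap f) (lap g) V := by
  intro x hx
  unfold lap
  refine Finset.sum_congr rfl fun i _ => ?_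
  congr 1
  refine Filter.EventuallyEq.fderiv_eq ?_
  filter_upwards [hV.mem_nhds hx] with y hy
  rw [(h.eventuallyEq_of_mem (hV.mem_nhds hy)).fderiv_eq]

lemma iterate_lap_congr {f g : EuclideanSpace ℝ (Fin n) → ℝ}
    {V : Set (EuclideanSpace ℝ (Fin n))} (hV : IsOpen V) (h : EqOn f g V) (i : ℕ) :
    EqOn (lap^[i] f) (lap^[i] g) V := by
  induction i with
  | zero => exact h
  | succ i ih =>
    rw [Function.iterate_succ_apply', Function.iterate_succ_apply']
    exact lap_congr hV ih

lemma lap_hasCompactSupport {f : EuclideanSpace ℝ (Fin n) → ℝ} (hf : HasCompactSupport f) :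
    HasCompactSupport (lap f) := by
  refine HasCompactSupport.intro hf.isCompact fun x hx => ?_
  have h : EqOn f (fun _ => 0) (tsupport f)ᶜ := fun y hy => image_eq_zero_of_notMem_tsupport hy
  rw [lap_congr (isClosed_tsupport f).isOpen_compl h hx]
  simp [lap]

/-- The weight `(1 - ‖z‖²)₊ ^ (k + 1)`, a compactly supported Lipschitz function. -/
noncomputable def weight (n k : ℕ) (z : EuclideanSpace ℝ (Fin n)) : ℝ :=
  (1 - (min 1 ‖z‖) ^ 2) ^ (k + 1)

lemma weight_of_mem {k : ℕ} {z : EuclideanSpace ℝ (Fin n)} (hz : z ∈ ball 0 1) :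
    weight n k z = (1 - ‖z‖ ^ 2) ^ (k + 1) := by
  rw [weight, min_eq_right (by simpa using (mem_ball_zero_iff.1 hz).le)]

lemma weight_of_notMem {k : ℕ} {z : EuclideanSpace ℝ (Fin n)} (hz : z ∉ ball 0 1) :
    weight n k z = 0 := by
  rw [weight, min_eq_left (by simpa using hz)]; simp

lemma weight_hasCompactSupport (k : ℕ) : HasCompactSupport (weight n k) :=
  HasCompactSupport.intro (isCompact_closedBall 0 1) fun _ hz =>
    weight_of_notMem fun h => hz (ball_subset_closedBall h)

lemma weight_lipschitz (k : ℕ) : ∃ D, LipschitzWith D (weight n k) := by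
  refine ⟨⟨2 * (k + 1), by positivity⟩, LipschitzWith.of_dist_le_mul fun x y => ?_⟩
  have key : ∀ s t : ℝ, 0 ≤ s → s ≤ 1 → 0 ≤ t → t ≤ 1 →
      |(1 - s ^ 2) ^ (k + 1) - (1 - t ^ 2) ^ (k + 1)| ≤ 2 * (k + 1) * |s - t| := by
    intro s t hs hs1 ht ht1
    have h1 := abs_pow_sub_pow_le (1 - s ^ 2) (1 - t ^ 2) (k + 1)
    have h2 : |1 - s ^ 2| ≤ 1 := by rw [abs_le]; constructor <;> nlinarith
    have h3 : |1 - t ^ 2| ≤ 1 := by rw [abs_le]; constructor <;> nlinarith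
    have h4 : max |1 - s ^ 2| |1 - t ^ 2| ^ (k + 1 - 1) ≤ 1 :=
      pow_le_one₀ (by positivity) (max_le h2 h3)
    have h5 : |(1 - s ^ 2) - (1 - t ^ 2)| ≤ 2 * |s - t| := by
      rw [show (1 - s ^ 2) - (1 - t ^ 2) = -(s + t) * (s - t) by ring, abs_mul, abs_neg,
        abs_of_nonneg (by positivity : 0 ≤ s + t)]
      exact mul_le_mul_of_nonneg_right (by linarith) (abs_nonneg _)
    calc _ ≤ _ := h1
      _ ≤ (2 * |s - t|) * ((k + 1 : ℕ) : ℝ) * 1 := by gcongr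
      _ = _ := by push_cast; ring
  have h6 : |min 1 ‖x‖ - min 1 ‖y‖| ≤ dist x y := by
    refine (abs_min_sub_min_le_max 1 ‖x‖ 1 ‖y‖).trans ?_
    rw [dist_eq_norm]
    simpa using abs_norm_sub_norm_le x y
  refine (key _ _ (by positivity) (min_le_left _ _) (by positivity) (min_le_left _ _)).trans ?_
  exact mul_le_mul_of_nonneg_left h6 (by positivity)

lemma lineDeriv_weight_of_mem {k : ℕ} {z : EuclideanSpace ℝ (Fin n)} (hz : z ∈ ball 0 1)
    (i : Fin n) : lineDeriv ℝ (weight n k) z (-EuclideanSpace.single i 1) =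
      2 * (k + 1) * (1 - ‖z‖ ^ 2) ^ k * z i := by
  have he : weight n k =ᶠ[𝓝 z] fun z => (1 - ‖z‖ ^ 2) ^ (k + 1) := by
    filter_upwards [isOpen_ball.mem_nhds hz] with y hy using weight_of_mem hy
  have hd := (((hasStrictFDerivAt_norm_sq z).hasFDerivAt.const_sub 1).pow (k + 1))
  have := (hd.congr_of_eventuallyEq he).hasLineDerivAt (-EuclideanSpace.single i 1)
  rw [this.lineDeriv]
  simp [EuclideanSpace.inner_single_right]
  ring

lemma lineDeriv_weight_of_notMem {k : ℕ} {z : EuclideanSpace ℝ (Fin n)}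
    (hz : z ∉ closedBall 0 1) (v : EuclideanSpace ℝ (Fin n)) :
    lineDeriv ℝ (weight n k) z v = 0 := by
  have he : weight n k =ᶠ[𝓝 z] fun _ => 0 := by
    filter_upwards [isClosed_closedBall.isOpen_compl.mem_nhds hz] with y hy using
      weight_of_notMem fun h => hy (ball_subset_closedBall h)
  rw [he.lineDeriv_eq]
  simp [lineDeriv]

/-- The integral of `f (x + r z)` over the unit ball against the weight `(1 - ‖z‖²) ^ k`. -/
noncomputable def wInt (k : ℕ) (f : EuclideanSpace ℝ (Fin n) → ℝ) (x : EuclideanSpace ℝ (Fin n))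
    (r : ℝ) : ℝ :=
  ∫ z in ball 0 1, (1 - ‖z‖ ^ 2) ^ k * f (x + r • z)

lemma integrableOn_ball_of_continuous {f : EuclideanSpace ℝ (Fin n) → ℝ} (hf : Continuous f) :
    IntegrableOn f (ball 0 1) :=
  (hf.continuousOn.integrableOn_compact (isCompact_closedBall 0 1)).mono_set ball_subset_closedBall

lemma integral_lineDeriv_weight_mul (k : ℕ) (i : Fin n) {F : EuclideanSpace ℝ (Fin n) → ℝ}
    {C : NNReal} (hF : LipschitzWith C F) :
    ∫ z in ball 0 1, lineDeriv ℝ F z (EuclideanSpace.single i 1) * (1 - ‖z‖ ^ 2) ^ (k + 1) =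
      ∫ z in ball 0 1, 2 * (k + 1) * (1 - ‖z‖ ^ 2) ^ k * z i * F z := by
  obtain ⟨D, hD⟩ := weight_lipschitz (n := n) k
  have h := hF.integral_lineDeriv_mul_eq (μ := volume) hD (weight_hasCompactSupport k)
    (EuclideanSpace.single i 1)
  rw [← integral_indicator measurableSet_ball, ← integral_indicator measurableSet_ball]
  convert h using 1
  · congr 1
    ext z
    by_cases hz : z ∈ ball (0 : EuclideanSpace ℝ (Fin n)) 1
    · rw [indicator_of_mem hz, weight_of_mem hz]
    · rw [indicator_of_notMem hz, weight_of_notMem hz, mul_zero]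
  · refine integral_congr_ae ?_
    have hs : (volume : Measure (EuclideanSpace ℝ (Fin n))) (sphere 0 1) = 0 :=
      Measure.addHaar_sphere_of_ne_zero _ _ one_ne_zero
    filter_upwards [compl_mem_ae_iff.2 hs] with z hz
    by_cases hb : z ∈ ball (0 : EuclideanSpace ℝ (Fin n)) 1
    · rw [indicator_of_mem hb, lineDeriv_weight_of_mem hb]
    · have hc : z ∉ closedBall (0 : EuclideanSpace ℝ (Fin n)) 1 := by
        rw [← ball_union_sphere]
        exact fun h => h.elim hb hz
      rw [indicator_of_notMem hb, lineDeriv_weight_of_notMem hc, zero_mul]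

lemma integral_weight_mul_fderiv (k : ℕ) {f : EuclideanSpace ℝ (Fin n) → ℝ}
    (hf : ContDiff ℝ 2 f) (hs : HasCompactSupport f) (x : EuclideanSpace ℝ (Fin n)) (r : ℝ) :
    ∫ z in ball 0 1, (1 - ‖z‖ ^ 2) ^ k * fderiv ℝ f (x + r • z) z =
      r / (2 * (k + 1)) * wInt (k + 1) (lap f) x r := by
  have hG : ∀ i : Fin n, ContDiff ℝ 1 (fun y => fderiv ℝ f y (EuclideanSpace.single i 1)) :=
    fun i => (hf.fderiv_right (by norm_num)).clm_apply contDiff_const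
  have hA : ∀ z : EuclideanSpace ℝ (Fin n), HasFDerivAt (fun z => x + r • z)
      (r • ContinuousLinearMap.id ℝ (EuclideanSpace ℝ (Fin n))) z := fun z =>
    ((hasFDerivAt_id z).const_smul r).const_add x
  have hcomp : ∀ i : Fin n, ∀ z, lineDeriv ℝ
      (fun z => fderiv ℝ f (x + r • z) (EuclideanSpace.single i 1)) z (EuclideanSpace.single i 1) =
      r * fderiv ℝ (fun y => fderiv ℝ f y (EuclideanSpace.single i 1)) (x + r • z)
        (EuclideanSpace.single i 1) := by
    intro i z
    have h1 := ((hG i).differentiable one_ne_zero (x + r • z)).hasFDerivAt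
    have h2 := (h1.comp z (hA z)).hasLineDerivAt (EuclideanSpace.single i 1)
    rw [Function.comp_def] at h2
    rw [h2.lineDeriv]
    simp
  have hlip : ∀ i : Fin n, ∃ C, LipschitzWith C
      (fun z => fderiv ℝ f (x + r • z) (EuclideanSpace.single i 1)) := by
    intro i
    obtain ⟨C, hC⟩ := (hG i).lipschitzWith_of_hasCompactSupport
      (hs.fderiv_apply ℝ _) one_ne_zero
    exact ⟨_, hC.comp ((LipschitzWith.const x).add (lipschitzWith_smul r))⟩
  have hk : (0 : ℝ) < 2 * (k + 1) := by positivity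
  have hcG : ∀ i : Fin n, Continuous
      (fun z => fderiv ℝ f (x + r • z) (EuclideanSpace.single i 1)) := fun i =>
    (hlip i).choose_spec.continuous
  have hcH : ∀ i : Fin n, Continuous (fun z => fderiv ℝ
      (fun y => fderiv ℝ f y (EuclideanSpace.single i 1)) (x + r • z)
        (EuclideanSpace.single i 1)) := fun i =>
    (((hG i).continuous_fderiv one_ne_zero).clm_apply continuous_const).comp
      (by fun_prop : Continuous fun z => x + r • z)
  have hexp : ∀ z : EuclideanSpace ℝ (Fin n), fderiv ℝ f (x + r • z) z =
      ∑ i, z i * fderiv ℝ f (x + r • z) (EuclideanSpace.single i 1) := by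
    intro z
    generalize fderiv ℝ f (x + r • z) = L
    conv_lhs => rw [← (EuclideanSpace.basisFun (Fin n) ℝ).sum_repr z]
    rw [map_sum]
    simp
  have hL : ∫ z in ball 0 1, (1 - ‖z‖ ^ 2) ^ k * fderiv ℝ f (x + r • z) z =
      ∑ i, ∫ z in ball 0 1, (1 - ‖z‖ ^ 2) ^ k * z i *
        fderiv ℝ f (x + r • z) (EuclideanSpace.single i 1) := by
    rw [← integral_finsetSum]
    · simp_rw [hexp, Finset.mul_sum, mul_assoc]
    · intro i _
      have := hcG i
      exact integrableOn_ball_of_continuous (by fun_prop)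
  have hR : wInt (k + 1) (lap f) x r = ∑ i, ∫ z in ball 0 1, (1 - ‖z‖ ^ 2) ^ (k + 1) *
      fderiv ℝ (fun y => fderiv ℝ f y (EuclideanSpace.single i 1)) (x + r • z)
        (EuclideanSpace.single i 1) := by
    rw [wInt, ← integral_finsetSum]
    · simp_rw [lap, Finset.mul_sum]
    · intro i _
      have := hcH i
      exact integrableOn_ball_of_continuous (by fun_prop)
  rw [hL, hR, Finset.mul_sum]
  refine Finset.sum_congr rfl fun i _ => ?_
  obtain ⟨C, hC⟩ := hlip i
  have h := integral_lineDeriv_weight_mul k i hC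
  simp_rw [hcomp i, mul_assoc] at h
  simp only [integral_const_mul] at h
  rw [div_mul_eq_mul_div, eq_div_iff hk.ne']
  simp_rw [mul_assoc, mul_comm ((1 - ‖_‖ ^ 2) ^ (k + 1) : ℝ)]
  linarith

lemma hasDerivAt_wInt (k : ℕ) {f : EuclideanSpace ℝ (Fin n) → ℝ}
    (hf : ContDiff ℝ 2 f) (hs : HasCompactSupport f) (x : EuclideanSpace ℝ (Fin n)) (r : ℝ) :
    HasDerivAt (wInt k f x) (r / (2 * (k + 1)) * wInt (k + 1) (lap f) x r) r := by
  rw [← integral_weight_mul_fderiv k hf hs]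
  obtain ⟨C, hC⟩ := (hs.fderiv ℝ).exists_bound_of_continuous (hf.continuous_fderiv two_ne_zero)
  have hcf := hf.continuous
  have hcd := hf.continuous_fderiv two_ne_zero
  refine (hasDerivAt_integral_of_dominated_loc_of_deriv_le (μ := volume.restrict (ball 0 1))
    (F := fun r z => (1 - ‖z‖ ^ 2) ^ k * f (x + r • z))
    (F' := fun r z => (1 - ‖z‖ ^ 2) ^ k * fderiv ℝ f (x + r • z) z)
    (bound := fun _ => C) (s := univ) univ_mem ?_ ?_ ?_ ?_ ?_ ?_).2
  · exact Eventually.of_forall fun r =>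
      (by fun_prop : Continuous fun z => (1 - ‖z‖ ^ 2) ^ k * f (x + r • z)).aestronglyMeasurable
  · exact integrableOn_ball_of_continuous (by fun_prop)
  · exact (by fun_prop : Continuous fun z =>
      (1 - ‖z‖ ^ 2) ^ k * fderiv ℝ f (x + r • z) z).aestronglyMeasurable
  · refine (ae_restrict_mem measurableSet_ball).mono fun z hz t _ => ?_
    have hz1 : ‖z‖ ≤ 1 := (mem_ball_zero_iff.1 hz).le
    have hz0 := norm_nonneg z
    have h1 : ‖(1 - ‖z‖ ^ 2) ^ k‖ ≤ 1 := by
      rw [norm_pow, Real.norm_eq_abs]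
      refine pow_le_one₀ (abs_nonneg _) ?_
      rw [abs_le]; constructor <;> nlinarith
    have hC0 : 0 ≤ C := (norm_nonneg _).trans (hC x)
    have h2 : ‖fderiv ℝ f (x + t • z) z‖ ≤ C * 1 :=
      ((fderiv ℝ f (x + t • z)).le_opNorm z).trans (by gcongr; exact hC _)
    rw [norm_mul]
    calc _ ≤ 1 * (C * 1) := by gcongr
      _ = C := by ring
  · exact integrableOn_ball_of_continuous continuous_const
  · refine Eventually.of_forall fun z t _ => ?_
    have h1 := ((hf.differentiable two_ne_zero) (x + t • z)).hasFDerivAt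
    have h2 : HasDerivAt (fun t : ℝ => x + t • z) z t := by
      simpa using ((hasDerivAt_id t).smul_const z).const_add x
    exact (h1.comp_hasDerivAt t h2).const_mul _

/-- The coefficients of the expansion of `wInt k f x` in powers of the radius. -/
noncomputable def coeff (n : ℕ) : ℕ → ℕ → ℝ
  | k, 0 => ∫ z in ball (0 : EuclideanSpace ℝ (Fin n)) 1, (1 - ‖z‖ ^ 2) ^ k
  | k, i + 1 => coeff n (k + 1) i / (2 * (k + 1) * (2 * i + 2))

lemma coeff_pos (i : ℕ) : ∀ k, 0 < coeff n k i := by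
  induction i with
  | zero =>
    intro k
    rw [coeff, setIntegral_pos_iff_support_of_nonneg_ae]
    · refine (measure_ball_pos volume (0 : EuclideanSpace ℝ (Fin n)) one_pos).trans_le
        (measure_mono fun z hz => ⟨?_, hz⟩)
      have := mem_ball_zero_iff.1 hz
      have := norm_nonneg z
      exact (pow_pos (by nlinarith) k).ne'
    · refine (ae_restrict_mem measurableSet_ball).mono fun z hz => ?_
      have := mem_ball_zero_iff.1 hz
      have := norm_nonneg z
      exact (pow_pos (by nlinarith) k).le
    · exact integrableOn_ball_of_continuous (by fun_prop)
  | succ i ih =>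
    intro k
    rw [coeff]
    have := ih (k + 1)
    positivity

lemma wInt_eq_sum (m : ℕ) : ∀ (k : ℕ) (f : EuclideanSpace ℝ (Fin n) → ℝ)
    (x : EuclideanSpace ℝ (Fin n)) (R : ℝ), 0 < R → ContDiff ℝ ((2 * m : ℕ) : WithTop ℕ∞) f →
    HasCompactSupport f → (∀ y ∈ ball x R, lap^[m] f y = 0) → ∀ r ∈ Icc 0 R,
    wInt k f x r = ∑ i ∈ Finset.range m, coeff n k i * r ^ (2 * i) * lap^[i] f x := by
  induction m with
  | zero =>
    intro k f x R hR _ _ h0 r hr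
    rw [wInt, Finset.range_zero, Finset.sum_empty]
    refine setIntegral_eq_zero_of_forall_eq_zero fun z hz => ?_
    have : f (x + r • z) = 0 := by
      refine h0 _ ?_
      rw [mem_ball_iff_norm, add_sub_cancel_left, norm_smul, Real.norm_of_nonneg hr.1]
      have := mem_ball_zero_iff.1 hz
      nlinarith [hr.2, norm_nonneg z]
    rw [this, mul_zero]
  | succ m ih =>
    intro k f x R hR hf hs h0 r hr
    have hf2 : ContDiff ℝ 2 f := hf.of_le (by norm_cast; omega)
    have hd := hasDerivAt_wInt k hf2 hs x
    have ih' := ih (k + 1) (lap f) x R hR (lap_contDiff hf) (lap_hasCompactSupport hs) h0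
    have hp : ∀ t, HasDerivAt (fun r : ℝ => ∑ i ∈ Finset.range (m + 1),
        coeff n k i * r ^ (2 * i) * lap^[i] f x) (∑ i ∈ Finset.range (m + 1),
        coeff n k i * ((2 * i : ℕ) * t ^ (2 * i - 1)) * lap^[i] f x) t := fun t =>
      HasDerivAt.fun_sum fun i _ => ((hasDerivAt_pow (2 * i) t).const_mul _).mul_const _
    refine eq_of_has_deriv_right_eq (fun t _ => (hd t).hasDerivWithinAt)
      (fun t ht => ?_) (fun t _ => (hd t).continuousAt.continuousWithinAt)
      (fun t _ => (hp t).continuousAt.continuousWithinAt) ?_ r hr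
    · convert (hp t).hasDerivWithinAt using 1
      rw [ih' t ⟨ht.1, ht.2.le⟩, Finset.sum_range_succ', Finset.mul_sum]
      simp only [mul_zero, Nat.cast_zero, zero_mul, add_zero]
      refine Finset.sum_congr rfl fun i _ => ?_
      rw [coeff, Function.iterate_succ_apply, show 2 * (i + 1) - 1 = 2 * i + 1 by omega]
      push_cast
      field_simp
      ring
    · rw [Finset.sum_range_succ']
      simp [wInt, coeff, integral_mul_const]

lemma setAverage_ball_eq (f : EuclideanSpace ℝ (Fin n) → ℝ) (x : EuclideanSpace ℝ (Fin n))
    {R : ℝ} (hR : 0 < R) : ⨍ z in ball x R, f z = wInt 0 f x R / coeff n 0 0 := by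
  have hpre : (fun z => x + R • z) ⁻¹' ball x R = ball 0 1 := by
    ext z
    rw [mem_preimage, mem_ball_iff_norm, add_sub_cancel_left, norm_smul,
      Real.norm_of_nonneg hR.le, mem_ball_zero_iff]
    exact ⟨fun h => by nlinarith, fun h => by nlinarith⟩
  have hI : ∀ g : EuclideanSpace ℝ (Fin n) → ℝ,
      ∫ z in ball 0 1, g (x + R • z) = (R ^ n)⁻¹ * ∫ z in ball x R, g z := by
    intro g
    rw [← integral_indicator measurableSet_ball, ← integral_indicator measurableSet_ball]
    have h1 := Measure.integral_comp_smul (volume : Measure (EuclideanSpace ℝ (Fin n)))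
      (fun z => (ball x R).indicator g (x + z)) R
    rw [integral_add_left_eq_self (fun z => (ball x R).indicator g z) x, finrank_euclideanSpace_fin,
      abs_of_pos (by positivity), smul_eq_mul] at h1
    rw [← h1]
    congr 1
    ext z
    rw [← hpre]
    rfl
  have h1 := hI f
  have h2 := hI fun _ => 1
  rw [setAverage_eq, wInt, coeff]
  simp only [pow_zero, one_mul]
  rw [h1, h2]
  simp only [integral_const, smul_eq_mul, mul_one, measureReal_restrict_apply_univ]
  have : R ^ n ≠ 0 := by positivity
  field_simp

end Pizzetti

open Pizzetti in
theorem stmt_6 (n : ℕ) (hn : 1 ≤ n) :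
    ∃ c : ℕ → ℝ, (∀ i, 0 < c i) ∧ c 0 = 1 ∧
      ∀ m : ℕ, 1 ≤ m →
      ∀ (x0 : EuclideanSpace ℝ (Fin n)) (R : ℝ), 0 < R →
      ∀ h : EuclideanSpace ℝ (Fin n) → ℝ,
        (∃ U : Set (EuclideanSpace ℝ (Fin n)), IsOpen U ∧ closedBall x0 R ⊆ U ∧
          ContDiffOn ℝ (2*m) h U ∧ ∀ x ∈ U, lap^[m] h x = 0) →
        (⨍ z in ball x0 R, h z) =
          ∑ i ∈ Finset.range m, c i * R^(2*i) * lap^[i] h x0 := by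
  have hc := coeff_pos (n := n)
  refine ⟨fun i => coeff n 0 i / coeff n 0 0, fun i => div_pos (hc _ _) (hc _ _),
    div_self (hc _ _).ne', ?_⟩
  rintro m - x0 R hR h ⟨U, hU, hRU, hh, h0⟩
  obtain ⟨δ, hδ, hδU⟩ := (isCompact_closedBall x0 R).exists_cthickening_subset_open hU hRU
  rw [cthickening_closedBall hδ.le hR.le] at hδU
  let χ : ContDiffBump x0 := ⟨R + δ / 2, R + δ, by positivity, by linarith⟩
  have hχU : tsupport χ ⊆ U := by
    rw [χ.tsupport_eq]
    exact (closedBall_subset_closedBall (by simp [χ]; linarith)).trans hδU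
  have hf : ContDiff ℝ ((2 * m : ℕ) : WithTop ℕ∞) fun z => χ z * h z := by
    rw [contDiff_iff_contDiffAt]
    intro x
    by_cases hx : x ∈ U
    · have := hh.contDiffAt (hU.mem_nhds hx)
      exact χ.contDiff.contDiffAt.mul (by push_cast; exact this)
    · refine (contDiffAt_const (c := (0 : ℝ))).congr_of_eventuallyEq ?_
      filter_upwards [(isClosed_tsupport χ).isOpen_compl.mem_nhds fun h => hx (hχU h)] with y hy
      rw [image_eq_zero_of_notMem_tsupport hy, zero_mul]
  have hs : HasCompactSupport fun z => χ z * h z := χ.hasCompactSupport.mul_right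
  have hV : EqOn (fun z => χ z * h z) h (ball x0 (R + δ / 2)) := fun z hz => by
    have : χ z = 1 := χ.one_of_mem_closedBall (ball_subset_closedBall hz)
    simp [this]
  have hlap := iterate_lap_congr isOpen_ball hV
  have hsub : ball x0 R ⊆ ball x0 (R + δ / 2) := ball_subset_ball (by linarith)
  have key := wInt_eq_sum m 0 _ x0 R hR hf hs (fun y hy => by
    rw [hlap m (hsub hy)]
    exact h0 y (hRU (ball_subset_closedBall hy))) R ⟨hR.le, le_rfl⟩
  rw [← setAverage_congr_fun measurableSet_ball (Eventually.of_forall fun z hz => hV (hsub hz)),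
    setAverage_ball_eq _ _ hR, key, Finset.sum_div]
  refine Finset.sum_congr rfl fun i _ => ?_
  rw [hlap i (mem_ball_self (by positivity))]
  ring
end

section
/- Liouville-type theorem for polyharmonic functions: let n, m ≥ 1 and ℓ ≥ 0 be integers, and let h : ℝ^n → ℝ be a smooth function with Δ^m h = 0 on all of ℝ^n and satisfying the one-sided bound h(x) ≤ C(1 + |x|^ℓ) for all x ∈ ℝ^n, for some constant C. Then h is a polynomial of degree at most d := max(ℓ, 2m−2); equivalently, the (d+1)-th total derivative of h vanishes identically on ℝ^n. -/
open MeasureTheory Metric Filter Set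
open scoped ENNReal Topology

section DirectionalDerivatives

variable {E : Type*} [NormedAddCommGroup E] [NormedSpace ℝ E]

/-- The directional derivative of `f` in the direction `v`, as a function of the base point. -/
noncomputable def dirDeriv (v : E) (f : E → ℝ) : E → ℝ := fun y => fderiv ℝ f y v

theorem contDiff_dirDeriv {f : E → ℝ} (hf : ContDiff ℝ (⊤ : ℕ∞) f) (v : E) :
    ContDiff ℝ (⊤ : ℕ∞) (dirDeriv v f) :=
  (hf.fderiv_right (m := (⊤ : ℕ∞)) (by simp)).clm_apply contDiff_const

theorem dirDeriv_comm {f : E → ℝ} (hf : ContDiff ℝ (⊤ : ℕ∞) f) (v w : E) :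
    dirDeriv v (dirDeriv w f) = dirDeriv w (dirDeriv v f) := by
  have hd : Differentiable ℝ (fderiv ℝ f) :=
    (hf.fderiv_right (m := (⊤ : ℕ∞)) (by simp)).differentiable (by simp)
  have key : ∀ (a b x : E), dirDeriv a (dirDeriv b f) x = fderiv ℝ (fderiv ℝ f) x a b := by
    intro a b x
    change fderiv ℝ (fun y => fderiv ℝ f y b) x a = _
    rw [fderiv_clm_apply (hd x) (differentiableAt_const b)]
    simp
  ext x
  rw [key, key]
  exact (contDiff_infty.1 hf 2).contDiffAt.isSymmSndFDerivAt (by simp) v w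

theorem iteratedFDeriv_succ_eq_dirDeriv {f : E → ℝ} (hf : ContDiff ℝ (⊤ : ℕ∞) f) (k : ℕ)
    (V : Fin (k + 1) → E) :
    (fun y => iteratedFDeriv ℝ (k + 1) f y V) =
      dirDeriv (V 0) (fun y => iteratedFDeriv ℝ k f y (Fin.tail V)) := by
  ext y
  have hd : Differentiable ℝ (iteratedFDeriv ℝ k f) :=
    hf.differentiable_iteratedFDeriv (by exact_mod_cast ENat.natCast_lt_top k)
  simp only [dirDeriv, iteratedFDeriv_succ_apply_left]
  rw [fderiv_continuousMultilinear_apply_const_apply (hd y)]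

theorem contDiff_iteratedFDeriv_apply {f : E → ℝ} (hf : ContDiff ℝ (⊤ : ℕ∞) f) (k : ℕ)
    (V : Fin k → E) : ContDiff ℝ (⊤ : ℕ∞) (fun y => iteratedFDeriv ℝ k f y V) := by
  induction k with
  | zero => simpa using hf
  | succ k ih =>
    rw [iteratedFDeriv_succ_eq_dirDeriv hf]
    exact contDiff_dirDeriv (ih _) _

end DirectionalDerivatives

section Laplacian

variable {n : ℕ}

theorem lap_eq_sum_dirDeriv (f : EuclideanSpace ℝ (Fin n) → ℝ) :
    lap f = ∑ i : Fin n,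
      dirDeriv (EuclideanSpace.single i 1) (dirDeriv (EuclideanSpace.single i 1) f) := by
  ext x
  simp only [lap, Finset.sum_apply]
  rfl

theorem contDiff_lap {f : EuclideanSpace ℝ (Fin n) → ℝ} (hf : ContDiff ℝ (⊤ : ℕ∞) f) :
    ContDiff ℝ (⊤ : ℕ∞) (lap f) :=
  ContDiff.sum fun _ _ => contDiff_dirDeriv (contDiff_dirDeriv hf _) _

theorem lap_dirDeriv {f : EuclideanSpace ℝ (Fin n) → ℝ} (hf : ContDiff ℝ (⊤ : ℕ∞) f)
    (v : EuclideanSpace ℝ (Fin n)) : lap (dirDeriv v f) = dirDeriv v (lap f) := by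
  have hsum : dirDeriv v (lap f) = ∑ i : Fin n, dirDeriv v
      (dirDeriv (EuclideanSpace.single i 1) (dirDeriv (EuclideanSpace.single i 1) f)) := by
    ext x
    rw [lap_eq_sum_dirDeriv, dirDeriv, fderiv_sum fun i _ =>
      (contDiff_dirDeriv (contDiff_dirDeriv hf _) _).differentiable (by simp) x]
    simp [dirDeriv]
  rw [hsum, lap_eq_sum_dirDeriv]
  refine Finset.sum_congr rfl fun i _ => ?_
  rw [dirDeriv_comm hf, dirDeriv_comm (contDiff_dirDeriv hf _)]

theorem lap_iterate_dirDeriv (m : ℕ) {f : EuclideanSpace ℝ (Fin n) → ℝ}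
    (hf : ContDiff ℝ (⊤ : ℕ∞) f) (v : EuclideanSpace ℝ (Fin n)) :
    lap^[m] (dirDeriv v f) = dirDeriv v (lap^[m] f) := by
  induction m generalizing f with
  | zero => rfl
  | succ m ih =>
    rw [Function.iterate_succ_apply, lap_dirDeriv hf, ih (contDiff_lap hf),
      Function.iterate_succ_apply]

theorem lap_iterate_iteratedFDeriv_apply_eq_zero {m : ℕ} {f : EuclideanSpace ℝ (Fin n) → ℝ}
    (hf : ContDiff ℝ (⊤ : ℕ∞) f) (h0 : lap^[m] f = 0) (k : ℕ)
    (V : Fin k → EuclideanSpace ℝ (Fin n)) :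
    lap^[m] (fun y => iteratedFDeriv ℝ k f y V) = 0 := by
  induction k with
  | zero => simpa using h0
  | succ k ih =>
    rw [iteratedFDeriv_succ_eq_dirDeriv hf,
      lap_iterate_dirDeriv m (contDiff_iteratedFDeriv_apply hf k _), ih]
    ext x
    simp [dirDeriv]

end Laplacian

section DilatedAverages

variable {E : Type*} [NormedAddCommGroup E] [InnerProductSpace ℝ E] [FiniteDimensional ℝ E]
  [MeasurableSpace E] [BorelSpace E]

theorem integrable_comp_dilation_mul {u φ : E → ℝ} (hu : Continuous u) (hφ : Continuous φ)
    (hc : HasCompactSupport φ) (x : E) (R : ℝ) :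
    Integrable (fun y => u (x + R • y) * φ y) :=
  Continuous.integrable_of_hasCompactSupport (by fun_prop) hc.mul_left

/-- Integration by parts against a dilated test function. -/
theorem mul_integral_dirDeriv_comp_dilation {u φ : E → ℝ} (hu : ContDiff ℝ (⊤ : ℕ∞) u)
    (hφ : ContDiff ℝ (⊤ : ℕ∞) φ) (hc : HasCompactSupport φ) (v x : E) (R : ℝ) :
    R * ∫ y, dirDeriv v u (x + R • y) * φ y = -∫ y, u (x + R • y) * dirDeriv v φ y := by
  have hcomp : ContDiff ℝ (⊤ : ℕ∞) (fun y => u (x + R • y)) := by fun_prop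
  have hderiv : ∀ y, fderiv ℝ (fun y => u (x + R • y)) y v = R * dirDeriv v u (x + R • y) := by
    intro y
    have h1 : HasFDerivAt (fun y : E => x + R • y) (R • ContinuousLinearMap.id ℝ E) y :=
      ((hasFDerivAt_id y).const_smul R).const_add x
    have h2 := ((hu.differentiable (by simp)) (x + R • y)).hasFDerivAt.comp y h1
    have h3 := h2.fderiv
    simp only [Function.comp_def] at h3
    simp [h3, dirDeriv]
  have hcd : HasCompactSupport (dirDeriv v φ) := hc.fderiv_apply (𝕜 := ℝ) v
  have hu' := (contDiff_dirDeriv hu v).continuous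
  have := integral_mul_fderiv_eq_neg_fderiv_mul_of_integrable (μ := (volume : Measure E))
    (f := fun y => u (x + R • y)) (g := φ) (v := v)
    (by simpa only [hderiv, mul_assoc] using
      (integrable_comp_dilation_mul hu' hφ.continuous hc x R).const_mul R)
    (integrable_comp_dilation_mul hu.continuous (contDiff_dirDeriv hφ v).continuous hcd x R)
    (integrable_comp_dilation_mul hu.continuous hφ.continuous hc x R)
    (fun y _ => hcomp.differentiable (by simp) y) (fun y _ => hφ.differentiable (by simp) y)
  simp only [hderiv, mul_assoc, integral_const_mul] at this
  rw [← neg_eq_iff_eq_neg.2 this]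
  rfl

theorem hasDerivAt_integral_comp_dilation {u φ : E → ℝ} (hu : ContDiff ℝ (⊤ : ℕ∞) u)
    (hφ : Continuous φ) (hc : HasCompactSupport φ) (x : E) (R : ℝ) :
    HasDerivAt (fun r : ℝ => ∫ y, u (x + r • y) * φ y)
      (∫ y, fderiv ℝ u (x + R • y) y * φ y) R := by
  have hu' : Continuous (fderiv ℝ u) := hu.continuous_fderiv (by simp)
  have hjoint : Continuous (fun p : ℝ × E => fderiv ℝ u (x + p.1 • p.2) p.2) := by fun_prop
  obtain ⟨K, hK⟩ := ((isCompact_closedBall R 1).prod hc.isCompact).exists_bound_of_continuousOn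
    hjoint.continuousOn
  refine (hasDerivAt_integral_of_dominated_loc_of_deriv_le (bound := fun y => K * ‖φ y‖)
    (F' := fun r y => fderiv ℝ u (x + r • y) y * φ y)
    (closedBall_mem_nhds R one_pos) (.of_forall fun r => ?_)
    (integrable_comp_dilation_mul hu.continuous hφ hc x R) ?_ (.of_forall fun y r hr => ?_)
    ((hφ.integrable_of_hasCompactSupport hc).norm.const_mul K)
    (.of_forall fun y r _ => ?_)).2
  · exact (integrable_comp_dilation_mul hu.continuous hφ hc x r).aestronglyMeasurable
  · exact Continuous.aestronglyMeasurable (by fun_prop)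
  · by_cases hy : y ∈ tsupport φ
    · rw [norm_mul]
      exact mul_le_mul_of_nonneg_right (hK (r, y) ⟨hr, hy⟩) (norm_nonneg _)
    · simp [image_eq_zero_of_notMem_tsupport hy]
  · have h1 : HasDerivAt (fun r : ℝ => x + r • y) y r := by
      simpa using ((hasDerivAt_id r).smul_const y).const_add x
    exact (((hu.differentiable (by simp)) (x + r • y)).hasFDerivAt.comp_hasDerivAt r h1).mul_const _

/-- Moving iterated derivatives onto the test function. -/
theorem exists_pow_mul_integral_iteratedFDeriv_comp_dilation {u φ : E → ℝ}
    (hu : ContDiff ℝ (⊤ : ℕ∞) u) (hφ : ContDiff ℝ (⊤ : ℕ∞) φ) (hc : HasCompactSupport φ)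
    (k : ℕ) (V : Fin k → E) :
    ∃ ψ : E → ℝ, Continuous ψ ∧ tsupport ψ ⊆ tsupport φ ∧ ∀ (x : E) (R : ℝ),
      R ^ k * ∫ y, iteratedFDeriv ℝ k u (x + R • y) V * φ y = ∫ y, u (x + R • y) * ψ y := by
  induction k generalizing φ with
  | zero => exact ⟨φ, hφ.continuous, subset_rfl, by simp⟩
  | succ k ih =>
    obtain ⟨ψ, hψ, hsupp, h⟩ := ih (φ := fun y => -dirDeriv (V 0) φ y)
      (contDiff_dirDeriv hφ _).neg (HasCompactSupport.neg (hc.fderiv_apply (𝕜 := ℝ) (V 0)))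
      (Fin.tail V)
    refine ⟨ψ, hψ, hsupp.trans ?_, fun x R => ?_⟩
    · exact (tsupport_neg (dirDeriv (V 0) φ)).subset.trans (tsupport_fderiv_apply_subset ℝ (V 0))
    · have hstep := mul_integral_dirDeriv_comp_dilation
        (contDiff_iteratedFDeriv_apply hu k (Fin.tail V)) hφ hc (V 0) x R
      have hrw := fun z => congrFun (iteratedFDeriv_succ_eq_dirDeriv hu k V) z
      simp only [hrw, pow_succ, mul_assoc, hstep, ← h x R, mul_neg, integral_neg]

end DilatedAverages

/-- A smooth function vanishing on `[T, ∞)` has a smooth primitive vanishing on `[T, ∞)`. -/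
theorem exists_primitive_eq_zero_of_le {g : ℝ → ℝ} (hg : ContDiff ℝ (⊤ : ℕ∞) g) {T : ℝ}
    (h0 : ∀ t, T ≤ t → g t = 0) :
    ∃ G : ℝ → ℝ, ContDiff ℝ (⊤ : ℕ∞) G ∧ (∀ t, T ≤ t → G t = 0) ∧ ∀ t, HasDerivAt G (g t) t := by
  have hd : ∀ t, HasDerivAt (fun t => ∫ s in T..t, g s) (g t) t := fun t =>
    (hg.continuous.integral_hasStrictDerivAt T t).hasDerivAt
  refine ⟨fun t => ∫ s in T..t, g s, ?_, fun t ht => ?_, hd⟩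
  · rw [contDiff_infty_iff_deriv]
    exact ⟨fun t => (hd t).differentiableAt, by rwa [funext fun t => (hd t).deriv]⟩
  · change ∫ s in T..t, g s = 0
    rw [intervalIntegral.integral_congr (g := fun _ => (0 : ℝ))]
    · simp
    · intro s hs
      rw [Set.uIcc_of_le ht] at hs
      exact h0 s hs.1

theorem hasCompactSupport_comp_norm_sq {E : Type*} [NormedAddCommGroup E] [ProperSpace E]
    {g : ℝ → ℝ} {T : ℝ} (h0 : ∀ t, T ≤ t → g t = 0) :
    HasCompactSupport (fun y : E => g (‖y‖ ^ 2)) := by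
  refine HasCompactSupport.intro (isCompact_closedBall (0 : E) √T) fun y hy => h0 _ ?_
  rw [mem_closedBall_zero_iff, not_le] at hy
  exact ((Real.sqrt_lt' ((Real.sqrt_nonneg T).trans_lt hy)).1 hy).le

section Pizzetti

variable {n : ℕ}

theorem hasDerivAt_radial_average {h : EuclideanSpace ℝ (Fin n) → ℝ}
    (hh : ContDiff ℝ (⊤ : ℕ∞) h) {g G : ℝ → ℝ} (hg : ContDiff ℝ (⊤ : ℕ∞) g)
    (hG : ContDiff ℝ (⊤ : ℕ∞) G) {T : ℝ} (hg0 : ∀ t, T ≤ t → g t = 0)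
    (hG0 : ∀ t, T ≤ t → G t = 0) (hGg : ∀ t, HasDerivAt G (g t) t)
    (x : EuclideanSpace ℝ (Fin n)) (R : ℝ) :
    HasDerivAt (fun r : ℝ => ∫ y, h (x + r • y) * g (‖y‖ ^ 2))
      (-(R / 2) * ∫ y, lap h (x + R • y) * G (‖y‖ ^ 2)) R := by
  let e : Fin n → EuclideanSpace ℝ (Fin n) := fun i => EuclideanSpace.single i 1
  let Ψ : EuclideanSpace ℝ (Fin n) → ℝ := fun y => G (‖y‖ ^ 2)
  have hΨ : ContDiff ℝ (⊤ : ℕ∞) Ψ := hG.comp (contDiff_id.norm_sq ℝ)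
  have hΨc : HasCompactSupport Ψ := hasCompactSupport_comp_norm_sq hG0
  have hΨd : ∀ i y, dirDeriv (e i) Ψ y = 2 * (y i * g (‖y‖ ^ 2)) := by
    intro i y
    have h1 := (hGg (‖y‖ ^ 2)).comp_hasFDerivAt y (hasStrictFDerivAt_norm_sq y).hasFDerivAt
    have h2 : fderiv ℝ Ψ y = _ := h1.fderiv
    simp [dirDeriv, h2, e, EuclideanSpace.inner_single_right]
    ring
  have hgrad : ∀ y, fderiv ℝ h (x + R • y) y * g (‖y‖ ^ 2) =
      ∑ i, 2⁻¹ * (dirDeriv (e i) h (x + R • y) * dirDeriv (e i) Ψ y) := by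
    intro y
    have hy : y = ∑ i, y i • e i := by
      ext j
      simp [e, Finset.sum_apply, Pi.single_apply]
    conv_lhs => rw [show fderiv ℝ h (x + R • y) y = ∑ i, y i * dirDeriv (e i) h (x + R • y) by
      conv_lhs => arg 2; rw [hy]
      simp [dirDeriv]]
    rw [Finset.sum_mul]
    refine Finset.sum_congr rfl fun i _ => ?_
    rw [hΨd]
    ring
  have key := hasDerivAt_integral_comp_dilation hh (hg.comp (contDiff_id.norm_sq ℝ)).continuous
    (hasCompactSupport_comp_norm_sq hg0) x R
  refine key.congr_deriv ?_
  change ∫ y, fderiv ℝ h (x + R • y) y * g (‖y‖ ^ 2) = _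
  simp only [hgrad]
  rw [integral_finsetSum _ fun i _ => (integrable_comp_dilation_mul
    (contDiff_dirDeriv hh _).continuous (contDiff_dirDeriv hΨ _).continuous
    (hΨc.fderiv_apply (𝕜 := ℝ) _) x R).const_mul _]
  simp only [integral_const_mul]
  have hlap : ∀ y, lap h (x + R • y) * G (‖y‖ ^ 2) =
      ∑ i, dirDeriv (e i) (dirDeriv (e i) h) (x + R • y) * Ψ y := by
    intro y
    rw [lap_eq_sum_dirDeriv, Finset.sum_apply, Finset.sum_mul]
  simp only [hlap]
  rw [integral_finsetSum _ fun i _ => integrable_comp_dilation_mul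
    (contDiff_dirDeriv (contDiff_dirDeriv hh _) _).continuous hΨ.continuous hΨc x R,
    Finset.mul_sum]
  refine Finset.sum_congr rfl fun i _ => ?_
  have := mul_integral_dirDeriv_comp_dilation (contDiff_dirDeriv hh (e i)) hΨ hΨc (e i) x R
  linarith

/-- Pizzetti's formula in qualitative form: radial averages of a polyharmonic function of order
`m` are even polynomials of degree at most `2 * m - 2` in the dilation parameter. -/
theorem exists_radial_average_eq_sum (m : ℕ) {h : EuclideanSpace ℝ (Fin n) → ℝ}
    (hh : ContDiff ℝ (⊤ : ℕ∞) h) (hph : lap^[m] h = 0) {g : ℝ → ℝ}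
    (hg : ContDiff ℝ (⊤ : ℕ∞) g) {T : ℝ} (hg0 : ∀ t, T ≤ t → g t = 0)
    (x : EuclideanSpace ℝ (Fin n)) :
    ∃ c : ℕ → ℝ, ∀ R : ℝ, ∫ y, h (x + R • y) * g (‖y‖ ^ 2) =
      ∑ j ∈ Finset.range m, c j * R ^ (2 * j) := by
  induction m generalizing h g with
  | zero =>
    have : h = 0 := hph
    exact ⟨0, by simp [this]⟩
  | succ m ih =>
    obtain ⟨G, hG, hG0, hGg⟩ := exists_primitive_eq_zero_of_le hg hg0
    obtain ⟨c, hc⟩ := ih (contDiff_lap hh) hph hG hG0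
    let F : ℝ → ℝ := fun R => ∫ y, h (x + R • y) * g (‖y‖ ^ 2)
    let P : ℝ → ℝ := fun R => ∑ j ∈ Finset.range m, -(c j / (4 * (j + 1))) * R ^ (2 * (j + 1))
    have hF : ∀ R, HasDerivAt F (-(R / 2) * ∑ j ∈ Finset.range m, c j * R ^ (2 * j)) R :=
      fun R => hc R ▸ hasDerivAt_radial_average hh hg hG hg0 hG0 hGg x R
    have hP : ∀ R, HasDerivAt P (-(R / 2) * ∑ j ∈ Finset.range m, c j * R ^ (2 * j)) R := by
      intro R
      rw [Finset.mul_sum]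
      refine HasDerivAt.fun_sum fun j _ => ?_
      refine ((hasDerivAt_pow (2 * (j + 1)) R).const_mul
        (-(c j / (4 * ((j : ℝ) + 1))))).congr_deriv ?_
      have : (j : ℝ) + 1 ≠ 0 := by positivity
      rw [show 2 * (j + 1) - 1 = 2 * j + 1 by omega]
      push_cast
      field_simp
      ring
    have hFP : ∀ R, F R - P R = F 0 - P 0 := fun R =>
      is_const_of_deriv_eq_zero (fun r => ((hF r).sub (hP r)).differentiableAt)
        (fun r => by rw [((hF r).sub (hP r)).deriv, sub_self]) R 0
    refine ⟨fun j => if j = 0 then F 0 else -(c (j - 1) / (4 * j)), fun R => ?_⟩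
    have hP0 : P 0 = 0 := by simp [P]
    rw [Finset.sum_range_succ']
    have := hFP R
    simp only [hP0, sub_zero] at this
    rw [show ∫ y, h (x + R • y) * g (‖y‖ ^ 2) = P R + F 0 by rw [← this]; simp [F]]
    simp [P]

open Polynomial in
theorem exists_radial_average_eq_eval (m : ℕ) {h : EuclideanSpace ℝ (Fin n) → ℝ}
    (hh : ContDiff ℝ (⊤ : ℕ∞) h) (hph : lap^[m] h = 0) {g : ℝ → ℝ}
    (hg : ContDiff ℝ (⊤ : ℕ∞) g) {T : ℝ} (hg0 : ∀ t, T ≤ t → g t = 0)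
    (x : EuclideanSpace ℝ (Fin n)) :
    ∃ p : ℝ[X], p.natDegree ≤ 2 * m - 2 ∧
      ∀ R : ℝ, ∫ y, h (x + R • y) * g (‖y‖ ^ 2) = p.eval R := by
  obtain ⟨c, hc⟩ := exists_radial_average_eq_sum m hh hph hg hg0 x
  refine ⟨∑ j ∈ Finset.range m, C (c j) * X ^ (2 * j), ?_, fun R => ?_⟩
  · refine natDegree_sum_le_of_forall_le _ _ fun j hj => (natDegree_C_mul_X_pow_le _ _).trans ?_
    have := Finset.mem_range.1 hj
    omega
  · simp [hc, eval_finsetSum]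

end Pizzetti

open Polynomial in
/-- A polyharmonic function with a one-sided polynomial bound has weighted averages of at most
the corresponding two-sided polynomial growth. -/
theorem exists_abs_integral_comp_dilation_le {n m ℓ : ℕ} {h : EuclideanSpace ℝ (Fin n) → ℝ}
    (hh : ContDiff ℝ (⊤ : ℕ∞) h) (hph : lap^[m] h = 0) {K : ℝ}
    (hbd : ∀ x, h x ≤ K * (1 + ‖x‖ ^ ℓ)) {ψ : EuclideanSpace ℝ (Fin n) → ℝ}
    (hψ : Continuous ψ) (hψsupp : tsupport ψ ⊆ closedBall 0 1) (x : EuclideanSpace ℝ (Fin n)) :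
    ∃ A : ℝ[X], A.natDegree ≤ max ℓ (2 * m - 2) ∧
      ∀ R : ℝ, 0 ≤ R → |∫ y, h (x + R • y) * ψ y| ≤ A.eval R := by
  let g : ℝ → ℝ := fun t => Real.smoothTransition (2 - t)
  have hg : ContDiff ℝ (⊤ : ℕ∞) g := Real.smoothTransition.contDiff.comp (by fun_prop)
  have hg0 : ∀ t, 2 ≤ t → g t = 0 := fun t ht =>
    Real.smoothTransition.zero_of_nonpos (by linarith)
  have hgnn : ∀ t, 0 ≤ g t := fun t => Real.smoothTransition.nonneg _
  let φ : EuclideanSpace ℝ (Fin n) → ℝ := fun y => g (‖y‖ ^ 2)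
  have hφ : Continuous φ := (hg.comp (contDiff_id.norm_sq ℝ)).continuous
  have hφc : HasCompactSupport φ := hasCompactSupport_comp_norm_sq hg0
  have hψc : HasCompactSupport ψ :=
    (isCompact_closedBall _ _).of_isClosed_subset (isClosed_tsupport ψ) hψsupp
  obtain ⟨M, hM⟩ := hψ.bounded_above_of_compact_support hψc
  have hM0 : 0 ≤ M := (norm_nonneg _).trans (hM 0)
  have hψφ : ∀ y, |ψ y| ≤ M * φ y := by
    intro y
    by_cases hy : y ∈ tsupport ψ
    · have hy1 : ‖y‖ ≤ 1 := mem_closedBall_zero_iff.1 (hψsupp hy)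
      have hφ1 : φ y = 1 := Real.smoothTransition.one_of_one_le
        (by linarith [pow_le_one₀ (n := 2) (norm_nonneg y) hy1])
      simpa [hφ1] using hM y
    · rw [image_eq_zero_of_notMem_tsupport hy, abs_zero]
      exact mul_nonneg hM0 (hgnn _)
  obtain ⟨p, hp, hpeq⟩ := exists_radial_average_eq_eval m hh hph hg hg0 x
  let b : ℝ → ℝ := fun R => |K| * (1 + (‖x‖ + 2 * R) ^ ℓ)
  refine ⟨C M * (C (2 * ∫ y, φ y) * (C |K| * (1 + (C ‖x‖ + C 2 * X) ^ ℓ)) - p), ?_, ?_⟩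
  · refine (natDegree_C_mul_le _ _).trans ((natDegree_sub_le _ _).trans (max_le_max ?_ hp))
    refine (natDegree_C_mul_le _ _).trans ((natDegree_C_mul_le _ _).trans ?_)
    refine (natDegree_add_le _ _).trans (max_le (by simp) (natDegree_pow_le.trans ?_))
    have : (Polynomial.C ‖x‖ + Polynomial.C 2 * X : ℝ[X]).natDegree ≤ 1 := by compute_degree
    nlinarith
  · intro R hR
    have hb0 : 0 ≤ b R := by positivity
    have hle : ∀ y, φ y ≠ 0 → h (x + R • y) ≤ b R := by
      intro y hy
      have hy2 : ‖y‖ ≤ 2 := by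
        by_contra! hlt
        exact hy (hg0 _ (by nlinarith))
      have hnorm : ‖x + R • y‖ ≤ ‖x‖ + 2 * R := by
        refine (norm_add_le _ _).trans (add_le_add_right ?_ _)
        rw [norm_smul, Real.norm_of_nonneg hR, mul_comm]
        exact mul_le_mul_of_nonneg_right hy2 hR
      refine (hbd _).trans ((mul_le_mul_of_nonneg_right (le_abs_self K) (by positivity)).trans ?_)
      simp only [b]
      gcongr
    have hpt : ∀ y, ‖h (x + R • y) * ψ y‖ ≤ M * (2 * b R * φ y - h (x + R • y) * φ y) := by
      intro y
      rw [norm_mul, Real.norm_eq_abs, Real.norm_eq_abs, ← sub_mul]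
      by_cases hy : φ y = 0
      · have : |ψ y| = 0 := le_antisymm (by simpa [hy] using hψφ y) (abs_nonneg _)
        simp [hy, this]
      · have habs : |h (x + R • y)| ≤ 2 * b R - h (x + R • y) :=
          abs_le.2 ⟨by linarith, by linarith [hle y hy]⟩
        calc |h (x + R • y)| * |ψ y|
            ≤ (2 * b R - h (x + R • y)) * (M * φ y) :=
              mul_le_mul habs (hψφ y) (abs_nonneg _) ((abs_nonneg _).trans habs)
          _ = M * ((2 * b R - h (x + R • y)) * φ y) := by ring
    have hi1 : Integrable (fun y => 2 * b R * φ y) :=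
      (hφ.integrable_of_hasCompactSupport hφc).const_mul _
    have hi2 : Integrable (fun y => h (x + R • y) * φ y) :=
      integrable_comp_dilation_mul hh.continuous hφ hφc x R
    refine (norm_integral_le_of_norm_le ((hi1.sub hi2).const_mul M) (.of_forall hpt)).trans_eq ?_
    rw [integral_const_mul, integral_sub' hi1 hi2, integral_const_mul, hpeq R]
    simp only [b, eval_mul, eval_sub, eval_add, eval_pow, eval_C, eval_X, eval_one]
    ring

theorem stmt_8 (n m ℓ : ℕ) (hn : 1 ≤ n) (hm : 1 ≤ m)
    (h : EuclideanSpace ℝ (Fin n) → ℝ) (hsm : ContDiff ℝ (⊤ : ℕ∞) h)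
    (hph : ∀ x, lap^[m] h x = 0)
    (C : ℝ) (hbd : ∀ x, h x ≤ C * (1 + ‖x‖^ℓ)) :
    ∀ x, iteratedFDeriv ℝ (max ℓ (2*m-2) + 1) h x = 0 := by
  let g : ℝ → ℝ := fun t => Real.smoothTransition (1 - t)
  have hg : ContDiff ℝ (⊤ : ℕ∞) g := Real.smoothTransition.contDiff.comp (by fun_prop)
  have hg0 : ∀ t, 1 ≤ t → g t = 0 := fun t ht =>
    Real.smoothTransition.zero_of_nonpos (by linarith)
  let φ : EuclideanSpace ℝ (Fin n) → ℝ := fun y => g (‖y‖ ^ 2)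
  have hφ : ContDiff ℝ (⊤ : ℕ∞) φ := hg.comp (contDiff_id.norm_sq ℝ)
  have hφc : HasCompactSupport φ := hasCompactSupport_comp_norm_sq hg0
  have hφball : tsupport φ ⊆ closedBall 0 1 := by
    refine closure_minimal (fun y hy => ?_) isClosed_closedBall
    by_contra hy1
    rw [mem_closedBall_zero_iff, not_le] at hy1
    exact hy (hg0 _ (one_le_pow₀ hy1.le))
  have hφpos : 0 < ∫ y, φ y := by
    refine hφ.continuous.integral_pos_of_hasCompactSupport_nonneg_nonzero hφc
      (fun y => Real.smoothTransition.nonneg _) (x := 0) ?_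
    simp [φ, g]
  have hph0 : lap^[m] h = 0 := funext hph
  intro x
  set k := max ℓ (2 * m - 2) + 1
  ext V
  obtain ⟨ψ, hψ, hψsupp, hψeq⟩ :=
    exists_pow_mul_integral_iteratedFDeriv_comp_dilation hsm hφ hφc k V
  obtain ⟨q, -, hq⟩ := exists_radial_average_eq_eval m (contDiff_iteratedFDeriv_apply hsm k V)
    (lap_iterate_iteratedFDeriv_apply_eq_zero hsm hph0 k V) hg hg0 x
  obtain ⟨A, hA, hAle⟩ := exists_abs_integral_comp_dilation_le hsm hph0 hbd hψ
    (hψsupp.trans hφball) x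
  have hlim : Tendsto (fun R => q.eval R) atTop (𝓝 0) := by
    have hAk : Tendsto (fun R => A.eval R / (Polynomial.X ^ k : Polynomial ℝ).eval R) atTop
        (𝓝 0) := by
      refine Polynomial.div_tendsto_atTop_zero_of_degree_lt _ _ ?_
      rw [Polynomial.degree_X_pow]
      exact (Polynomial.natDegree_le_iff_degree_le.1 hA).trans_lt
        (by exact_mod_cast Nat.lt_succ_self _)
    refine squeeze_zero_norm' ?_ hAk
    filter_upwards [eventually_gt_atTop 0] with R hR
    rw [Polynomial.eval_pow, Polynomial.eval_X, le_div_iff₀ (by positivity), ← hq,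
      Real.norm_eq_abs, ← abs_of_pos (pow_pos hR k), ← abs_mul, mul_comm, hψeq]
    exact hAle R hR.le
  have hq0 : q = 0 := Polynomial.leadingCoeff_eq_zero.1 (q.tendsto_nhds_iff.1 hlim).1
  have := hq 0
  simp only [zero_smul, add_zero, integral_const_mul, hq0, Polynomial.eval_zero] at this
  simpa using (mul_eq_zero.1 this).resolve_right hφpos.ne'
end

section
/- Let Ω ⊂ ℝ^n be a bounded open set with smooth boundary and let 1 ≤ p < n/(n−1). Then there is a constant C = C(p, Ω), independent of u, such that every u ∈ C²(cl(Ω)) with u = 0 on ∂Ω satisfies ‖u‖_{L^p(Ω)} + ‖∇u‖_{L^p(Ω)} ≤ C ‖Δu‖_{L¹(Ω)}. -/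
open MeasureTheory Metric Filter Set
open scoped ENNReal Topology

/-- A bounded open set `Ω ⊂ ℝ^n` has smooth boundary if it is the sublevel set of a smooth
function having no critical points on the boundary. -/
def HasSmoothBoundary {n : ℕ} (Ω : Set (EuclideanSpace ℝ (Fin n))) : Prop :=
  ∃ F : EuclideanSpace ℝ (Fin n) → ℝ, ContDiff ℝ (⊤ : ℕ∞) F ∧ Ω = {x | F x < 0} ∧
    ∀ x ∈ frontier Ω, fderiv ℝ F x ≠ 0

theorem sq_norm_le_sum_sq_apply_single {n : ℕ} (l : EuclideanSpace ℝ (Fin n) →L[ℝ] ℝ) :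
    ‖l‖ ^ 2 ≤ ∑ i : Fin n, l (EuclideanSpace.single i 1) ^ 2 := by
  set z := (InnerProductSpace.toDual ℝ (EuclideanSpace ℝ (Fin n))).symm l with hz
  have h1 : ‖l‖ = ‖z‖ := by simp [hz]
  have h2 : ∀ i, l (EuclideanSpace.single i 1) = z i := by
    intro i
    rw [← InnerProductSpace.toDual_symm_apply (𝕜 := ℝ) (y := l), ← hz]
    simp [EuclideanSpace.inner_single_right]
  rw [h1, EuclideanSpace.norm_sq_eq]
  simp [h2]

theorem continuous_mul_of_tsupport_subset {X : Type*} [TopologicalSpace X] {Ω : Set X}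
    (hΩ : IsOpen Ω) {w f : X → ℝ} (hw : Continuous w) (hs : tsupport w ⊆ Ω)
    (hf : ContinuousOn f Ω) : Continuous fun x => w x * f x := by
  rw [continuous_iff_continuousAt]
  intro x
  by_cases hx : x ∈ Ω
  · exact hw.continuousAt.mul (hf.continuousAt (hΩ.mem_nhds hx))
  · have h0 : w =ᶠ[𝓝 x] 0 := notMem_tsupport_iff_eventuallyEq.1 fun h => hx (hs h)
    refine ContinuousAt.congr (f := fun _ => (0 : ℝ)) continuousAt_const ?_
    filter_upwards [h0] with y hy
    simp [hy]

theorem contDiffOn_fderiv_apply {n : ℕ} {Ω : Set (EuclideanSpace ℝ (Fin n))} (hΩ : IsOpen Ω)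
    {u : EuclideanSpace ℝ (Fin n) → ℝ} (hu : ContDiffOn ℝ 2 u Ω) (e : EuclideanSpace ℝ (Fin n)) :
    ContDiffOn ℝ 1 (fun y => fderiv ℝ u y e) Ω :=
  (hu.fderiv_of_isOpen hΩ (m := 1) (by norm_num)).clm_apply contDiffOn_const

theorem continuousOn_lap {n : ℕ} {Ω : Set (EuclideanSpace ℝ (Fin n))} (hΩ : IsOpen Ω)
    {u : EuclideanSpace ℝ (Fin n) → ℝ} (hu : ContDiffOn ℝ 2 u Ω) : ContinuousOn (lap u) Ω := by
  refine continuousOn_finsetSum _ fun i _ => ?_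
  exact (((contDiffOn_fderiv_apply hΩ hu (EuclideanSpace.single i 1)).fderiv_of_isOpen hΩ
    (m := 0) (by norm_num)).clm_apply contDiffOn_const).continuousOn

theorem integral_sum_fderiv_mul_fderiv_eq_neg_integral_mul_lap {n : ℕ}
    {Ω : Set (EuclideanSpace ℝ (Fin n))} (hΩ : IsOpen Ω)
    {u w : EuclideanSpace ℝ (Fin n) → ℝ} (hu : ContDiffOn ℝ 2 u Ω) (hw : ContDiff ℝ 1 w)
    (hc : HasCompactSupport w) (hs : tsupport w ⊆ Ω) :
    ∫ x, ∑ i : Fin n, fderiv ℝ w x (EuclideanSpace.single i 1) *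
        fderiv ℝ u x (EuclideanSpace.single i 1) = -∫ x, w x * lap u x := by
  have hcd := fun i : Fin n => contDiffOn_fderiv_apply hΩ hu (EuclideanSpace.single i 1)
  have hcdd : ∀ i : Fin n, ContinuousOn (fun x => fderiv ℝ (fun y =>
      fderiv ℝ u y (EuclideanSpace.single i 1)) x (EuclideanSpace.single i 1)) Ω := fun i =>
    (((hcd i).fderiv_of_isOpen hΩ (m := 0) (by norm_num)).clm_apply contDiffOn_const).continuousOn
  have hw' : ∀ i : Fin n, Continuous fun x => fderiv ℝ w x (EuclideanSpace.single i 1) :=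
    fun i => (hw.continuous_fderiv (by norm_num)).clm_apply continuous_const
  have hc' : ∀ i : Fin n, HasCompactSupport fun x => fderiv ℝ w x (EuclideanSpace.single i 1) :=
    fun i => hc.fderiv_apply ℝ _
  have hs' : ∀ i : Fin n, tsupport (fun x => fderiv ℝ w x (EuclideanSpace.single i 1)) ⊆ Ω :=
    fun i => (tsupport_fderiv_apply_subset ℝ _).trans hs
  have hI1 : ∀ i : Fin n, Integrable fun x => fderiv ℝ w x (EuclideanSpace.single i 1) *
        fderiv ℝ u x (EuclideanSpace.single i 1) := fun i =>
    (continuous_mul_of_tsupport_subset hΩ (hw' i) (hs' i)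
      (hcd i).continuousOn).integrable_of_hasCompactSupport (hc' i).mul_right
  have hI2 : ∀ i : Fin n, Integrable fun x => w x * fderiv ℝ (fun y =>
      fderiv ℝ u y (EuclideanSpace.single i 1)) x (EuclideanSpace.single i 1) := fun i =>
    (continuous_mul_of_tsupport_subset hΩ hw.continuous hs
      (hcdd i)).integrable_of_hasCompactSupport hc.mul_right
  have hI3 : ∀ i : Fin n, Integrable fun x => w x * fderiv ℝ u x (EuclideanSpace.single i 1) :=
    fun i => (continuous_mul_of_tsupport_subset hΩ hw.continuous hs
      (hcd i).continuousOn).integrable_of_hasCompactSupport hc.mul_right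
  simp only [lap, Finset.mul_sum]
  rw [integral_finsetSum _ fun i _ => hI1 i, integral_finsetSum _ fun i _ => hI2 i,
    ← Finset.sum_neg_distrib]
  refine Finset.sum_congr rfl fun i _ => ?_
  rw [integral_mul_fderiv_eq_neg_fderiv_mul_of_integrable (hI1 i) (hI2 i) (hI3 i), neg_neg]
  · exact fun x _ => (hw.differentiable (by norm_num)).differentiableAt
  · exact fun x hx => ((hcd i).differentiableOn (by norm_num)).differentiableAt
      (hΩ.mem_nhds (hs hx))

/-- A `C¹` approximation of the positive part which vanishes on `(-∞, ε]`. -/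
noncomputable def smoothPos (ε s : ℝ) : ℝ := (max s ε - ε) ^ 2 / max s ε

/-- The derivative of `smoothPos`. -/
noncomputable def smoothPosDeriv (ε s : ℝ) : ℝ := 1 - ε ^ 2 / max s ε ^ 2

section smoothPos

variable {ε : ℝ}

theorem smoothPos_nonneg (hε : 0 < ε) (s : ℝ) : 0 ≤ smoothPos ε s :=
  div_nonneg (sq_nonneg _) (hε.le.trans (le_max_right _ _))

theorem smoothPos_of_le {s : ℝ} (hs : s ≤ ε) : smoothPos ε s = 0 := by
  simp [smoothPos, max_eq_right hs]

theorem smoothPosDeriv_nonneg (hε : 0 < ε) (s : ℝ) : 0 ≤ smoothPosDeriv ε s := by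
  have h : ε ≤ max s ε := le_max_right _ _
  rw [smoothPosDeriv, sub_nonneg]
  exact div_le_one_of_le₀ (by gcongr) (sq_nonneg _)

theorem smoothPosDeriv_le_one (s : ℝ) : smoothPosDeriv ε s ≤ 1 := by
  have : 0 ≤ ε ^ 2 / max s ε ^ 2 := by positivity
  rw [smoothPosDeriv]
  linarith

theorem continuous_smoothPosDeriv (hε : 0 < ε) : Continuous (smoothPosDeriv ε) := by
  have h : ∀ s : ℝ, max s ε ^ 2 ≠ 0 := fun s =>
    pow_ne_zero _ (hε.trans_le (le_max_right _ _)).ne'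
  exact continuous_const.sub (continuous_const.div (by fun_prop) h)

theorem continuous_smoothPos (hε : 0 < ε) : Continuous (smoothPos ε) :=
  Continuous.div (by fun_prop) (by fun_prop) fun _ => (hε.trans_le (le_max_right _ _)).ne'

theorem hasDerivAt_smoothPos (hε : 0 < ε) (s : ℝ) :
    HasDerivAt (smoothPos ε) (smoothPosDeriv ε s) s := by
  refine hasDerivAt_of_hasDerivAt_of_ne' (x := ε) (fun y hy => ?_)
    (continuous_smoothPos hε).continuousAt (continuous_smoothPosDeriv hε).continuousAt s
  rcases lt_or_gt_of_ne hy with h | h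
  · have h1 : smoothPosDeriv ε y = 0 := by
      simp [smoothPosDeriv, max_eq_right h.le, hε.ne']
    rw [h1]
    refine (hasDerivAt_const y (0 : ℝ)).congr_of_eventuallyEq ?_
    filter_upwards [Iio_mem_nhds h] with z hz using smoothPos_of_le (le_of_lt hz)
  · have hy0 : y ≠ 0 := (hε.trans h).ne'
    have h2 : HasDerivAt (fun z : ℝ => (z - ε) ^ 2 / z) (smoothPosDeriv ε y) y := by
      refine HasDerivAt.congr_deriv
        ((((hasDerivAt_id y).sub_const ε).pow 2).div (hasDerivAt_id y) hy0) ?_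
      simp only [smoothPosDeriv, max_eq_left h.le, id, Pi.pow_apply]
      field_simp
      push_cast
      ring
    refine h2.congr_of_eventuallyEq ?_
    filter_upwards [Ioi_mem_nhds h] with z hz
    simp [smoothPos, max_eq_left (le_of_lt (mem_Ioi.1 hz))]

theorem contDiff_smoothPos (hε : 0 < ε) : ContDiff ℝ 1 (smoothPos ε) := by
  rw [contDiff_one_iff_deriv]
  refine ⟨fun s => (hasDerivAt_smoothPos hε s).differentiableAt, ?_⟩
  rw [show deriv (smoothPos ε) = smoothPosDeriv ε from
    funext fun s => (hasDerivAt_smoothPos hε s).deriv]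
  exact continuous_smoothPosDeriv hε

theorem tendsto_smoothPos (s : ℝ) :
    Tendsto (fun k : ℕ => smoothPos (1 / (k + 1)) s) atTop (𝓝 (max s 0)) := by
  have h0 := tendsto_one_div_add_atTop_nhds_zero_nat (𝕜 := ℝ)
  rcases le_or_gt s 0 with hs | hs
  · rw [max_eq_right hs]
    refine tendsto_const_nhds.congr fun k => (smoothPos_of_le ?_).symm
    exact hs.trans (by positivity)
  · rw [max_eq_left hs.le]
    have hm : Tendsto (fun k : ℕ => max s (1 / ((k : ℝ) + 1))) atTop (𝓝 (max s 0)) :=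
      tendsto_const_nhds.max h0
    rw [max_eq_left hs.le] at hm
    have := ((hm.sub h0).pow 2).div hm hs.ne'
    rw [sub_zero, sq, mul_div_cancel_right₀ _ hs.ne'] at this
    exact this

theorem tendsto_smoothPosDeriv (s : ℝ) :
    Tendsto (fun k : ℕ => smoothPosDeriv (1 / (k + 1)) s) atTop (𝓝 (if 0 < s then 1 else 0)) := by
  have h0 := tendsto_one_div_add_atTop_nhds_zero_nat (𝕜 := ℝ)
  split_ifs with h
  · have hm : Tendsto (fun k : ℕ => max s (1 / ((k : ℝ) + 1))) atTop (𝓝 (max s 0)) :=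
      tendsto_const_nhds.max h0
    rw [max_eq_left h.le] at hm
    have := (tendsto_const_nhds (x := (1 : ℝ))).sub ((h0.pow 2).div (hm.pow 2) (pow_ne_zero 2 h.ne'))
    simpa [smoothPosDeriv] using this
  · refine tendsto_const_nhds.congr fun k => ?_
    have hk : (0 : ℝ) < 1 / ((k : ℝ) + 1) := by positivity
    rw [smoothPosDeriv, max_eq_right ((not_lt.1 h).trans hk.le), div_self (by positivity), sub_self]

end smoothPos

theorem indicator_smoothPos_comp_spec {n : ℕ} {Ω : Set (EuclideanSpace ℝ (Fin n))}
    (hΩ : IsOpen Ω) (hb : Bornology.IsBounded Ω) {u : EuclideanSpace ℝ (Fin n) → ℝ}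
    (hu : ContDiffOn ℝ 2 u Ω) (hcl : ContinuousOn u (closure Ω))
    (h0 : ∀ x ∈ frontier Ω, u x = 0) {ε : ℝ} (hε : 0 < ε) :
    ContDiff ℝ 1 (Ω.indicator fun x => smoothPos ε (u x)) ∧
      HasCompactSupport (Ω.indicator fun x => smoothPos ε (u x)) ∧
      tsupport (Ω.indicator fun x => smoothPos ε (u x)) ⊆ Ω ∧
      ∀ x ∈ Ω, fderiv ℝ (Ω.indicator fun x => smoothPos ε (u x)) x =
        smoothPosDeriv ε (u x) • fderiv ℝ u x := by
  set v := Ω.indicator fun x => smoothPos ε (u x) with hv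
  set K := closure Ω ∩ u ⁻¹' Ici ε with hK
  have hKc : IsClosed K := hcl.preimage_isClosed_of_isClosed isClosed_closure isClosed_Ici
  have hKΩ : K ⊆ Ω := by
    rintro x ⟨hx, hxε⟩
    by_contra hxΩ
    have := h0 x ⟨hx, by rwa [hΩ.interior_eq]⟩
    rw [mem_preimage, this] at hxε
    exact absurd hε (not_lt.2 hxε)
  have hsupp : Function.support v ⊆ K := by
    intro x hx
    have hxΩ : x ∈ Ω := by
      by_contra h
      exact hx (by simp [hv, h])
    refine ⟨subset_closure hxΩ, ?_⟩
    by_contra h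
    refine hx ?_
    simp only [hv, indicator_of_mem hxΩ]
    exact smoothPos_of_le (le_of_lt (not_le.1 h))
  have hts : tsupport v ⊆ K := closure_minimal hsupp hKc
  have hcK : IsCompact K :=
    Metric.isCompact_of_isClosed_isBounded hKc (hb.subset hKΩ)
  have hev : ∀ x ∈ Ω, v =ᶠ[𝓝 x] fun x => smoothPos ε (u x) := by
    intro x hx
    filter_upwards [hΩ.mem_nhds hx] with y hy
    simp [hv, hy]
  refine ⟨?_, hcK.of_isClosed_subset (isClosed_tsupport _) hts, hts.trans hKΩ, fun x hx => ?_⟩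
  · rw [contDiff_iff_contDiffAt]
    intro x
    by_cases hx : x ∈ Ω
    · have h1 : ContDiffAt ℝ 1 u x :=
        ((hu.contDiffAt (hΩ.mem_nhds hx)).of_le (by norm_num))
      exact ((contDiff_smoothPos hε).contDiffAt.comp x h1).congr_of_eventuallyEq (hev x hx)
    · have := notMem_tsupport_iff_eventuallyEq.1 fun h => hx (hKΩ (hts h))
      exact (contDiffAt_const (c := (0 : ℝ))).congr_of_eventuallyEq this
  · rw [(hev x hx).fderiv_eq]
    have h1 : HasFDerivAt u (fderiv ℝ u x) x :=
      ((hu.contDiffAt (hΩ.mem_nhds hx)).differentiableAt (by norm_num)).hasFDerivAt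
    exact ((hasDerivAt_smoothPos hε (u x)).comp_hasFDerivAt x h1).fderiv

theorem integral_sq_norm_fderiv_mul_rpow_le {n : ℕ} {Ω : Set (EuclideanSpace ℝ (Fin n))}
    (hΩ : IsOpen Ω) {u v : EuclideanSpace ℝ (Fin n) → ℝ} (hu : ContDiffOn ℝ 2 u Ω)
    (hv : ContDiff ℝ 1 v) (hc : HasCompactSupport v) (hs : tsupport v ⊆ Ω) (hv0 : ∀ x, 0 ≤ v x)
    (huv : ∀ x ∈ Ω, ∃ c : ℝ, 0 ≤ c ∧ c ≤ 1 ∧ fderiv ℝ v x = c • fderiv ℝ u x)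
    {m δ : ℝ} (hm : 0 < m) (hδ : 0 < δ)
    (hM : eLpNorm (fun x => lap u x) 1 (volume.restrict Ω) ≤ ENNReal.ofReal m) :
    ∫ x, ‖fderiv ℝ v x‖ ^ 2 * (m + v x) ^ (-1 - δ) ≤ m ^ (1 - δ) / δ := by
  have hpos : ∀ x, 0 < m + v x := fun x => by linarith [hv0 x]
  set w : EuclideanSpace ℝ (Fin n) → ℝ := fun x => m ^ (-δ) - (m + v x) ^ (-δ) with hw
  have hwC : ContDiff ℝ 1 w :=
    contDiff_const.sub ((contDiff_const.add hv).rpow_const_of_ne fun x => (hpos x).ne')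
  have hwsupp : Function.support w ⊆ Function.support v := by
    intro x hx hvx
    exact hx (by simp [hw, hvx])
  have hwts : tsupport w ⊆ tsupport v := closure_mono hwsupp
  have hwc : HasCompactSupport w := hc.of_isClosed_subset (isClosed_tsupport _) hwts
  have hw1 : ∀ x, |w x| ≤ m ^ (-δ) := by
    intro x
    have h1 : (m + v x) ^ (-δ) ≤ m ^ (-δ) :=
      Real.rpow_le_rpow_of_nonpos hm (by linarith [hv0 x]) (by linarith)
    have h2 : 0 ≤ (m + v x) ^ (-δ) := Real.rpow_nonneg (hpos x).le _
    rw [abs_of_nonneg (sub_nonneg.2 h1)]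
    linarith
  have hw' : ∀ x, fderiv ℝ w x = (δ * (m + v x) ^ (-1 - δ)) • fderiv ℝ v x := by
    intro x
    have h1 : HasFDerivAt v (fderiv ℝ v x) x :=
      (hv.differentiable (by norm_num)).differentiableAt.hasFDerivAt
    have h2 : HasDerivAt (fun t : ℝ => m ^ (-δ) - (m + t) ^ (-δ))
        (δ * (m + v x) ^ (-1 - δ)) (v x) := by
      refine HasDerivAt.congr_deriv ((hasDerivAt_const (v x) (m ^ (-δ))).sub
        (((hasDerivAt_id (v x)).const_add m).rpow_const (p := -δ) (Or.inl (hpos x).ne'))) ?_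
      simp only [id]
      rw [show -δ - 1 = -1 - δ by ring]
      ring
    exact (h2.comp_hasFDerivAt x h1).fderiv
  have hgreen := integral_sum_fderiv_mul_fderiv_eq_neg_integral_mul_lap hΩ hu hwC hwc
    (hwts.trans hs)
  have hlap := continuousOn_lap hΩ hu
  have hInt : IntegrableOn (fun x => lap u x) Ω := by
    rw [IntegrableOn, ← memLp_one_iff_integrable]
    exact ⟨hlap.aestronglyMeasurable hΩ.measurableSet, hM.trans_lt ENNReal.ofReal_lt_top⟩
  have hnorm : ∫ x in Ω, ‖lap u x‖ ≤ m := by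
    rw [integral_norm_eq_lintegral_enorm hInt.aestronglyMeasurable,
      ← eLpNorm_one_eq_lintegral_enorm]
    exact ENNReal.toReal_le_of_le_ofReal hm.le hM
  have hrhs : -∫ x, w x * lap u x ≤ m ^ (1 - δ) := by
    have hzero : ∀ x, x ∉ Ω → w x * lap u x = 0 := fun x hx => by
      rw [image_eq_zero_of_notMem_tsupport fun h => hx (hs (hwts h)), zero_mul]
    rw [← setIntegral_eq_integral_of_forall_compl_eq_zero hzero]
    calc -∫ x in Ω, w x * lap u x ≤ ‖∫ x in Ω, w x * lap u x‖ := neg_le_abs _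
      _ ≤ ∫ x in Ω, m ^ (-δ) * ‖lap u x‖ := by
        refine norm_integral_le_of_norm_le (hInt.norm.const_mul _) (.of_forall fun x => ?_)
        rw [norm_mul]
        exact mul_le_mul_of_nonneg_right (hw1 x) (norm_nonneg _)
      _ = m ^ (-δ) * ∫ x in Ω, ‖lap u x‖ := integral_const_mul _ _
      _ ≤ m ^ (-δ) * m := mul_le_mul_of_nonneg_left hnorm (Real.rpow_nonneg hm.le _)
      _ = m ^ (1 - δ) := by
        rw [show 1 - δ = -δ + 1 by ring, Real.rpow_add hm, Real.rpow_one]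
  have hcont : Continuous fun x => ‖fderiv ℝ v x‖ ^ 2 * (m + v x) ^ (-1 - δ) :=
    ((hv.continuous_fderiv (by norm_num)).norm.pow 2).mul
      ((continuous_const.add hv.continuous).rpow_const fun x => Or.inl (hpos x).ne')
  have hcs : HasCompactSupport fun x => ‖fderiv ℝ v x‖ ^ 2 * (m + v x) ^ (-1 - δ) :=
    ((hc.fderiv (𝕜 := ℝ)).comp_left (g := fun l => ‖l‖ ^ 2) (by simp)).mul_right
  have hleft : δ * ∫ x, ‖fderiv ℝ v x‖ ^ 2 * (m + v x) ^ (-1 - δ) ≤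
      ∫ x, ∑ i : Fin n, fderiv ℝ w x (EuclideanSpace.single i 1) *
        fderiv ℝ u x (EuclideanSpace.single i 1) := by
    rw [← integral_const_mul]
    refine integral_mono ((hcont.integrable_of_hasCompactSupport hcs).const_mul _) ?_ fun x => ?_
    · refine integrable_finsetSum _ fun i _ => ?_
      exact (continuous_mul_of_tsupport_subset hΩ
        ((hwC.continuous_fderiv (by norm_num)).clm_apply continuous_const)
        ((tsupport_fderiv_apply_subset ℝ _).trans (hwts.trans hs))
        (contDiffOn_fderiv_apply hΩ hu _).continuousOn).integrable_of_hasCompactSupport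
        (hwc.fderiv_apply ℝ _).mul_right
    · simp only
      have hA : 0 ≤ δ * (m + v x) ^ (-1 - δ) := mul_nonneg hδ.le (Real.rpow_nonneg (hpos x).le _)
      simp only [hw']
      by_cases hx : x ∈ Ω
      · obtain ⟨c, hc0, hc1, hcx⟩ := huv x hx
        have h1 := sq_norm_le_sum_sq_apply_single (fderiv ℝ v x)
        calc δ * (‖fderiv ℝ v x‖ ^ 2 * (m + v x) ^ (-1 - δ))
            = δ * (m + v x) ^ (-1 - δ) * ‖fderiv ℝ v x‖ ^ 2 := by ring
          _ ≤ δ * (m + v x) ^ (-1 - δ) *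
              ∑ i : Fin n, fderiv ℝ v x (EuclideanSpace.single i 1) ^ 2 := by gcongr
          _ ≤ _ := by
            rw [Finset.mul_sum]
            refine Finset.sum_le_sum fun i _ => ?_
            simp only [hcx, smul_apply, smul_eq_mul]
            set t := fderiv ℝ u x (EuclideanSpace.single i 1)
            rw [mul_assoc _ (c * t) t]
            refine mul_le_mul_of_nonneg_left ?_ hA
            nlinarith [mul_nonneg hc0 (sub_nonneg.2 hc1), sq_nonneg t,
              mul_nonneg (mul_nonneg hc0 (sub_nonneg.2 hc1)) (sq_nonneg t)]
      · have h0 : fderiv ℝ v x = 0 := image_eq_zero_of_notMem_tsupport fun h =>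
          hx (hs (tsupport_fderiv_subset ℝ h))
        simp [h0]
  rw [le_div_iff₀ hδ]
  linarith

theorem exists_le_mul_of_le_rpow_mul_add_rpow {δ A B : ℝ} (hδ : 0 < δ) (hδ1 : δ < 1)
    (hA : 0 ≤ A) (hB : 0 ≤ B) :
    ∃ K : ℝ, 0 ≤ K ∧ ∀ m x : ℝ, 0 < m → 0 ≤ x →
      x ≤ (m ^ (1 - δ) / δ) ^ (1 / 2 : ℝ) * (m * A + B * x) ^ ((1 + δ) / 2) → x ≤ K * m := by
  set D := (1 / δ) ^ (1 / 2 : ℝ) * (A + B) ^ ((1 + δ) / 2) with hD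
  have hD0 : 0 ≤ D := by positivity
  refine ⟨max 1 (D ^ (2 / (1 - δ))), by positivity, fun m x hm hx h => ?_⟩
  rcases le_or_gt x m with hxm | hxm
  · exact hxm.trans (le_mul_of_one_le_left hm.le (le_max_left _ _))
  have hx0 : 0 < x := hm.trans hxm
  have h1 : x ≤ D * m ^ ((1 - δ) / 2) * x ^ ((1 + δ) / 2) := by
    calc x ≤ (m ^ (1 - δ) / δ) ^ (1 / 2 : ℝ) * (m * A + B * x) ^ ((1 + δ) / 2) := h
      _ ≤ (m ^ (1 - δ) / δ) ^ (1 / 2 : ℝ) * ((A + B) * x) ^ ((1 + δ) / 2) := by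
        have : m * A + B * x ≤ (A + B) * x := by nlinarith
        gcongr
      _ = D * m ^ ((1 - δ) / 2) * x ^ ((1 + δ) / 2) := by
        rw [Real.mul_rpow (by positivity) hx0.le, div_eq_mul_one_div, Real.mul_rpow
          (by positivity) (by positivity), ← Real.rpow_mul hm.le, hD]
        rw [show (1 - δ) * (1 / 2) = (1 - δ) / 2 by ring]
        ring
  have h2 : x ^ ((1 - δ) / 2) ≤ D * m ^ ((1 - δ) / 2) := by
    have h3 : x = x ^ ((1 - δ) / 2) * x ^ ((1 + δ) / 2) := by
      rw [← Real.rpow_add hx0, show (1 - δ) / 2 + (1 + δ) / 2 = 1 by ring, Real.rpow_one]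
    have h4 : 0 < x ^ ((1 + δ) / 2) := Real.rpow_pos_of_pos hx0 _
    refine le_of_mul_le_mul_right ?_ h4
    rw [← h3]
    exact h1
  have he : 0 < 2 / (1 - δ) := div_pos two_pos (by linarith)
  have hne : (1 - δ) ≠ 0 := by linarith
  have h5 := Real.rpow_le_rpow (by positivity) h2 he.le
  rw [Real.mul_rpow hD0 (by positivity), ← Real.rpow_mul hx0.le, ← Real.rpow_mul hm.le,
    show (1 - δ) / 2 * (2 / (1 - δ)) = 1 by field_simp, Real.rpow_one, Real.rpow_one] at h5
  exact h5.trans (mul_le_mul_of_nonneg_right (le_max_right _ _) hm.le)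

theorem exists_eLpNorm_fderiv_le_of_energy_le {n : ℕ} {Ω : Set (EuclideanSpace ℝ (Fin n))}
    (hb : Bornology.IsBounded Ω) {p δ : ℝ} (hp : 1 ≤ p) (hp2 : p < 2)
    (hpn : p < n) (hδ : 0 < δ) (hδ1 : δ < 1) (hδp : (1 + δ) * (n - p) ≤ n * (2 - p)) :
    ∃ K : ℝ, 0 ≤ K ∧ ∀ (v : EuclideanSpace ℝ (Fin n) → ℝ) (m : ℝ), ContDiff ℝ 1 v →
      HasCompactSupport v → tsupport v ⊆ Ω → (∀ x, 0 ≤ v x) → 0 < m →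
      ∫ x, ‖fderiv ℝ v x‖ ^ 2 * (m + v x) ^ (-1 - δ) ≤ m ^ (1 - δ) / δ →
      eLpNorm (fderiv ℝ v) (ENNReal.ofReal p) volume ≤ ENNReal.ofReal (K * m) := by
  set q : ℝ := (1 + δ) * p / (2 - p) with hq
  have h2p : 0 < 2 - p := by linarith
  have hq1 : 1 ≤ q := by
    rw [hq, le_div_iff₀ h2p]
    nlinarith
  have hn0 : (0 : ℝ) < n := by linarith
  have hp0 : 0 < p := by linarith
  set A : ℝ≥0∞ := eLpNorm (fun _ : EuclideanSpace ℝ (Fin n) => (1 : ℝ)) (ENNReal.ofReal q)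
    (volume.restrict Ω) with hA
  have hAfin : A ≠ ∞ := by
    have : IsFiniteMeasure (volume.restrict Ω) := ⟨by simpa using hb.measure_lt_top⟩
    exact (memLp_const (1 : ℝ)).eLpNorm_ne_top
  set B : NNReal := eLpNormLESNormFDerivOfLeConst ℝ
    (volume : Measure (EuclideanSpace ℝ (Fin n))) Ω p.toNNReal q.toNNReal
  obtain ⟨K, hK0, hK⟩ := exists_le_mul_of_le_rpow_mul_add_rpow hδ hδ1
    (A := A.toReal) (B := B) ENNReal.toReal_nonneg B.2
  refine ⟨K, hK0, fun v m hv hc hs hv0 hm hE => ?_⟩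
  have hpos : ∀ x, 0 < m + v x := fun x => by linarith [hv0 x]
  have hdc : Continuous (fderiv ℝ v) := hv.continuous_fderiv (by norm_num)
  set X := eLpNorm (fderiv ℝ v) (ENNReal.ofReal p) volume with hX
  have hXfin : X ≠ ∞ :=
    (hdc.memLp_of_hasCompactSupport (hc.fderiv (𝕜 := ℝ))).eLpNorm_ne_top
  have hsob : eLpNorm v (ENNReal.ofReal q) volume ≤ B * X := by
    refine eLpNorm_le_eLpNorm_fderiv_of_le volume hv ((subset_tsupport v).trans hs)
      (by simpa using hp) ?_ ?_ hb
    · rw [← NNReal.coe_lt_coe, Real.coe_toNNReal p hp0.le]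
      simpa using hpn
    · rw [NNReal.coe_inv, Real.coe_toNNReal p hp0.le, Real.coe_toNNReal q (by linarith),
        finrank_euclideanSpace_fin, hq]
      rw [inv_div, le_div_iff₀ (by positivity)]
      have : (p⁻¹ - (n : ℝ)⁻¹) * ((1 + δ) * p) = (1 + δ) * (n - p) / n := by
        field_simp
      rw [this, div_le_iff₀ hn0]
      linarith
  set g : EuclideanSpace ℝ (Fin n) → ℝ :=
    fun x => ‖fderiv ℝ v x‖ * (m + v x) ^ ((-1 - δ) / 2) with hg
  set h : EuclideanSpace ℝ (Fin n) → ℝ := fun x => (m + v x) ^ ((1 + δ) / 2) with hh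
  have hgc : Continuous g := hdc.norm.mul
    ((continuous_const.add hv.continuous).rpow_const fun x => Or.inl (hpos x).ne')
  have hhc : Continuous h :=
    (continuous_const.add hv.continuous).rpow_const fun x => Or.inl (hpos x).ne'
  have hgs : HasCompactSupport g :=
    ((hc.fderiv (𝕜 := ℝ)).comp_left (g := fun l => ‖l‖) (by simp)).mul_right
  have hg2 : eLpNorm g 2 volume ≤ ENNReal.ofReal ((m ^ (1 - δ) / δ) ^ (1 / 2 : ℝ)) := by
    rw [(hgc.memLp_of_hasCompactSupport (p := 2) hgs).eLpNorm_eq_integral_rpow_norm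
      two_ne_zero ENNReal.ofNat_ne_top]
    simp only [ENNReal.toReal_ofNat, ← one_div]
    have hgeq : ∀ x, ‖g x‖ ^ (2 : ℝ) = ‖fderiv ℝ v x‖ ^ 2 * (m + v x) ^ (-1 - δ) := by
      intro x
      rw [Real.rpow_two, Real.norm_eq_abs, sq_abs, hg, mul_pow, ← Real.rpow_natCast
        ((m + v x) ^ _), ← Real.rpow_mul (hpos x).le]
      congr 2
      push_cast
      ring
    simp only [hgeq]
    refine ENNReal.ofReal_le_ofReal (Real.rpow_le_rpow ?_ hE (by norm_num))
    exact integral_nonneg fun x => mul_nonneg (sq_nonneg _) (Real.rpow_nonneg (hpos x).le _)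
  have hr : ENNReal.HolderTriple 2 (ENNReal.ofReal (2 * p / (2 - p))) (ENNReal.ofReal p) := by
    constructor
    rw [← ENNReal.ofReal_inv_of_pos hp0, ← ENNReal.ofReal_inv_of_pos (by positivity),
      show (2 : ℝ≥0∞) = ENNReal.ofReal 2 by simp, ← ENNReal.ofReal_inv_of_pos two_pos,
      ← ENNReal.ofReal_add (by positivity) (by positivity)]
    congr 1
    field_simp
    ring
  have hh2 : eLpNorm h (ENNReal.ofReal (2 * p / (2 - p))) (volume.restrict Ω) ≤
      (ENNReal.ofReal m * A + B * X) ^ ((1 + δ) / 2) := by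
    have e1 : h = fun x => ‖m + v x‖ ^ ((1 + δ) / 2) := by
      ext x
      rw [Real.norm_of_nonneg (hpos x).le]
    rw [e1, eLpNorm_norm_rpow _ (by positivity), ← ENNReal.ofReal_mul (by positivity),
      show 2 * p / (2 - p) * ((1 + δ) / 2) = q by rw [hq]; ring]
    refine ENNReal.rpow_le_rpow ?_ (by positivity)
    refine (eLpNorm_add_le (f := fun _ => m) (g := v) (by fun_prop)
      hv.continuous.aestronglyMeasurable (by simpa using hq1)).trans (add_le_add ?_ ?_)
    · have := eLpNorm_const_smul (c := m) (f := fun _ : EuclideanSpace ℝ (Fin n) => (1 : ℝ))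
        (p := ENNReal.ofReal q) (μ := volume.restrict Ω)
      rw [Real.enorm_of_nonneg hm.le] at this
      rw [hA, ← this]
      exact le_of_eq (by congr 1; ext; simp)
    · exact (eLpNorm_restrict_le _ _ _ _).trans hsob
  have hXle : X ≤ ENNReal.ofReal ((m ^ (1 - δ) / δ) ^ (1 / 2 : ℝ)) *
      (ENNReal.ofReal m * A + B * X) ^ ((1 + δ) / 2) := by
    have hsupp : Function.support (fun x => ‖fderiv ℝ v x‖) ⊆ Ω := by
      intro x hx
      refine hs (support_fderiv_subset ℝ fun h0 => hx ?_)
      simp [h0]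
    calc X = eLpNorm (fderiv ℝ v) (ENNReal.ofReal p) (volume.restrict Ω) := by
          rw [hX, ← eLpNorm_norm, ← eLpNorm_norm (fderiv ℝ v),
            eLpNorm_restrict_eq_of_support_subset hsupp]
      _ ≤ eLpNorm (fun x => g x * h x) (ENNReal.ofReal p) (volume.restrict Ω) := by
        refine eLpNorm_mono fun x => ?_
        have : g x * h x = ‖fderiv ℝ v x‖ := by
          simp only [hg, hh]
          rw [mul_assoc, ← Real.rpow_add (hpos x),
            show (-1 - δ) / 2 + (1 + δ) / 2 = 0 by ring, Real.rpow_zero, mul_one]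
        rw [this, norm_norm]
      _ ≤ eLpNorm g 2 (volume.restrict Ω) *
          eLpNorm h (ENNReal.ofReal (2 * p / (2 - p))) (volume.restrict Ω) := by
        exact eLpNorm_smul_le_mul_eLpNorm (φ := g) (f := h) hhc.aestronglyMeasurable
          hgc.aestronglyMeasurable
      _ ≤ _ := mul_le_mul' ((eLpNorm_restrict_le _ _ _ _).trans hg2) hh2
  have hreal : X.toReal ≤ (m ^ (1 - δ) / δ) ^ (1 / 2 : ℝ) *
      (m * A.toReal + B * X.toReal) ^ ((1 + δ) / 2) := by
    have hfin : ENNReal.ofReal m * A + B * X ≠ ∞ := by finiteness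
    have := ENNReal.toReal_mono (by finiteness) hXle
    rwa [ENNReal.toReal_mul, ENNReal.toReal_ofReal (by positivity), ← ENNReal.toReal_rpow,
      ENNReal.toReal_add (by finiteness) (by finiteness), ENNReal.toReal_mul, ENNReal.toReal_mul,
      ENNReal.toReal_ofReal hm.le, ENNReal.coe_toReal] at this
  exact (ENNReal.le_ofReal_iff_toReal_le hXfin (by positivity)).2
    (hK m X.toReal hm ENNReal.toReal_nonneg hreal)

theorem ae_fderiv_eq_zero_of_eq_zero {n : ℕ} {Ω : Set (EuclideanSpace ℝ (Fin n))}
    (hΩ : IsOpen Ω) {u : EuclideanSpace ℝ (Fin n) → ℝ} (hu : DifferentiableOn ℝ u Ω) :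
    ∀ᵐ x ∂(volume.restrict Ω), u x = 0 → fderiv ℝ u x = 0 := by
  have key : ∀ i : Fin n, ∀ᵐ x : EuclideanSpace ℝ (Fin n),
      x ∈ (Ω ∩ u ⁻¹' {0} ∩ {x | fderiv ℝ u x (EuclideanSpace.single i 1) ≠ 0})ᶜ := by
    intro i
    set e : EuclideanSpace ℝ (Fin n) := EuclideanSpace.single i 1
    have hmeas : MeasurableSet (Ω ∩ u ⁻¹' {0} ∩ {x | fderiv ℝ u x e ≠ 0}) := by
      refine MeasurableSet.inter ?_ ?_
      · have : Ω ∩ u ⁻¹' {0} = Ω \ (Ω ∩ u ⁻¹' {0}ᶜ) := by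
          ext x
          simp +contextual
        rw [this]
        exact hΩ.measurableSet.diff
          (hu.continuousOn.isOpen_inter_preimage hΩ isOpen_compl_singleton).measurableSet
      · exact (measurable_fderiv_apply_const ℝ u e) (measurableSet_singleton 0).compl
    refine ae_mem_of_ae_add_linearMap_mem (LinearMap.toSpanSingleton ℝ _ e) volume volume
      hmeas.compl fun y => ?_
    set T : Set ℝ := {t | y + t • e ∈ Ω ∩ u ⁻¹' {0} ∩ {x | fderiv ℝ u x e ≠ 0}} with hT
    have hTd : DiscreteTopology T := by
      refine discreteTopology_subtype_iff.2 fun t ht => ?_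
      obtain ⟨⟨htΩ, -⟩, ht1⟩ := ht
      have hd : HasDerivAt (fun s : ℝ => u (y + s • e)) (fderiv ℝ u (y + t • e) e) t := by
        have h1 : HasDerivAt (fun s : ℝ => y + s • e) e t := by
          simpa using ((hasDerivAt_id t).smul_const e).const_add y
        exact (hu.differentiableAt (hΩ.mem_nhds htΩ)).hasFDerivAt.comp_hasDerivAt t h1
      have hev := hd.eventually_ne (c := 0) ht1
      rw [← _root_.disjoint_iff, Filter.disjoint_principal_right]
      filter_upwards [hev] with s hs hsT
      exact hs hsT.1.2
    have hTc : T.Countable := TopologicalSpace.separableSpace_iff_countable.1 inferInstance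
    filter_upwards [hTc.ae_notMem volume] with t ht
    simpa [hT] using ht
  rw [ae_restrict_iff' hΩ.measurableSet]
  filter_upwards [ae_all_iff.2 key] with x hx hxΩ hx0
  have h0 : ∀ i : Fin n, fderiv ℝ u x (EuclideanSpace.single i 1) = 0 := by
    intro i
    by_contra h
    exact hx i ⟨⟨hxΩ, hx0⟩, h⟩
  have := sq_norm_le_sum_sq_apply_single (fderiv ℝ u x)
  simp only [h0, ne_eq, OfNat.ofNat_ne_zero, not_false_eq_true, zero_pow,
    Finset.sum_const_zero] at this
  exact norm_eq_zero.1 (pow_eq_zero_iff two_ne_zero |>.1 (le_antisymm this (sq_nonneg _)))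

theorem exists_eLpNorm_posPart_le {n : ℕ} {Ω : Set (EuclideanSpace ℝ (Fin n))}
    (hΩ : IsOpen Ω) (hb : Bornology.IsBounded Ω) {p : ℝ} (hp : 1 ≤ p) (hp2 : p < 2)
    (hpn : p < n) (hp' : p * ((n : ℝ) - 1) < n) :
    ∃ K : ℝ, 0 ≤ K ∧ ∀ (u : EuclideanSpace ℝ (Fin n) → ℝ) (m : ℝ),
      ContDiffOn ℝ 2 u Ω → ContinuousOn u (closure Ω) → (∀ x ∈ frontier Ω, u x = 0) → 0 < m →
      eLpNorm (fun x => lap u x) 1 (volume.restrict Ω) ≤ ENNReal.ofReal m →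
      AEStronglyMeasurable (fun x => if 0 < u x then fderiv ℝ u x else 0) (volume.restrict Ω) ∧
      eLpNorm (fun x => max (u x) 0) (ENNReal.ofReal p) (volume.restrict Ω) ≤
        ENNReal.ofReal (K * m) ∧
      eLpNorm (fun x => if 0 < u x then fderiv ℝ u x else 0) (ENNReal.ofReal p)
        (volume.restrict Ω) ≤ ENNReal.ofReal (K * m) := by
  have hnp : 0 < (n : ℝ) - p := by linarith
  obtain ⟨δ, hδ, hδ1, hδp⟩ : ∃ δ : ℝ, 0 < δ ∧ δ < 1 ∧ (1 + δ) * (n - p) ≤ n * (2 - p) := by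
    refine ⟨min (1 / 2) (n * (2 - p) / (n - p) - 1), lt_min (by norm_num) ?_,
      (min_le_left _ _).trans_lt (by norm_num), ?_⟩
    · rw [sub_pos, lt_div_iff₀ hnp]
      linarith
    · rw [← le_div_iff₀ hnp]
      linarith [min_le_right (1 / 2 : ℝ) (n * (2 - p) / (n - p) - 1)]
  obtain ⟨K, hK0, hK⟩ := exists_eLpNorm_fderiv_le_of_energy_le hb hp hp2 hpn hδ hδ1 hδp
  set B : NNReal := eLpNormLESNormFDerivOfLeConst ℝ
    (volume : Measure (EuclideanSpace ℝ (Fin n))) Ω p.toNNReal p.toNNReal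
  refine ⟨max K (B * K), by positivity, fun u m hu hcl h0 hm hM => ?_⟩
  set v : ℕ → EuclideanSpace ℝ (Fin n) → ℝ := fun k =>
    Ω.indicator fun x => smoothPos (1 / ((k : ℝ) + 1)) (u x) with hv
  have hε : ∀ k : ℕ, (0 : ℝ) < 1 / ((k : ℝ) + 1) := fun k => by positivity
  have hspec := fun k : ℕ => indicator_smoothPos_comp_spec hΩ hb hu hcl h0 (hε k)
  have hgrad : ∀ k, eLpNorm (fderiv ℝ (v k)) (ENNReal.ofReal p) volume ≤
      ENNReal.ofReal (K * m) := by
    intro k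
    obtain ⟨h1, h2, h3, h4⟩ := hspec k
    have hv0 : ∀ x, 0 ≤ v k x := fun x =>
      indicator_nonneg (fun y _ => smoothPos_nonneg (hε k) (u y)) x
    refine hK (v k) m h1 h2 h3 hv0 hm ?_
    exact integral_sq_norm_fderiv_mul_rpow_le hΩ hu h1 h2 h3 hv0
      (fun x hx => ⟨_, smoothPosDeriv_nonneg (hε k) _, smoothPosDeriv_le_one _, h4 x hx⟩)
      hm hδ hM
  have hval : ∀ k, eLpNorm (v k) (ENNReal.ofReal p) volume ≤ ENNReal.ofReal (B * K * m) := by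
    intro k
    obtain ⟨h1, h2, h3, h4⟩ := hspec k
    calc eLpNorm (v k) (ENNReal.ofReal p) volume
        ≤ B * eLpNorm (fderiv ℝ (v k)) (ENNReal.ofReal p) volume := by
          refine eLpNorm_le_eLpNorm_fderiv volume h1 ((subset_tsupport _).trans h3)
            (by simpa using hp) ?_ hb
          rw [← NNReal.coe_lt_coe, Real.coe_toNNReal p (by linarith)]
          simpa using hpn
      _ ≤ B * ENNReal.ofReal (K * m) := mul_le_mul_right (hgrad k) _
      _ = ENNReal.ofReal (B * K * m) := by
          rw [mul_assoc, ENNReal.ofReal_mul B.coe_nonneg, ENNReal.ofReal_coe_nnreal]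
  have hlimv : ∀ᵐ x ∂(volume.restrict Ω),
      Tendsto (fun k => v k x) atTop (𝓝 (max (u x) 0)) := by
    refine ae_restrict_of_forall_mem hΩ.measurableSet fun x hx => ?_
    simpa only [hv, indicator_of_mem hx] using tendsto_smoothPos (u x)
  have hlimg : ∀ᵐ x ∂(volume.restrict Ω), Tendsto (fun k => fderiv ℝ (v k) x) atTop
      (𝓝 (if 0 < u x then fderiv ℝ u x else 0)) := by
    refine ae_restrict_of_forall_mem hΩ.measurableSet fun x hx => ?_
    have h := (tendsto_smoothPosDeriv (u x)).smul_const (fderiv ℝ u x)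
    rw [ite_smul, one_smul, zero_smul] at h
    exact h.congr fun k => ((hspec k).2.2.2 x hx).symm
  have hmv : ∀ k, AEStronglyMeasurable (v k) (volume.restrict Ω) := fun k =>
    (hspec k).1.continuous.aestronglyMeasurable
  have hmg : ∀ k, AEStronglyMeasurable (fderiv ℝ (v k)) (volume.restrict Ω) := fun k =>
    ((hspec k).1.continuous_fderiv (by norm_num)).aestronglyMeasurable
  have hfatou : ∀ {F : Type} [NormedAddCommGroup F] (f : ℕ → EuclideanSpace ℝ (Fin n) → F)
      (f' : EuclideanSpace ℝ (Fin n) → F) (c : ℝ≥0∞),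
      (∀ k, AEStronglyMeasurable (f k) (volume.restrict Ω)) →
      (∀ᵐ x ∂(volume.restrict Ω), Tendsto (fun k => f k x) atTop (𝓝 (f' x))) →
      (∀ k, eLpNorm (f k) (ENNReal.ofReal p) volume ≤ c) →
      eLpNorm f' (ENNReal.ofReal p) (volume.restrict Ω) ≤ c := by
    intro F _ f f' c hm hl hc
    refine (Lp.eLpNorm_lim_le_liminf_eLpNorm hm f' hl).trans ?_
    refine (liminf_le_liminf (v := fun _ => c) (.of_forall fun k =>
      (eLpNorm_restrict_le _ _ _ _).trans (hc k))).trans ?_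
    simp
  refine ⟨aestronglyMeasurable_of_tendsto_ae atTop hmg hlimg, ?_, ?_⟩
  · refine (hfatou v _ _ hmv hlimv hval).trans (ENNReal.ofReal_le_ofReal ?_)
    exact mul_le_mul_of_nonneg_right (le_max_right _ _) hm.le
  · refine (hfatou (fun k => fderiv ℝ (v k)) _ _ hmg hlimg hgrad).trans
      (ENNReal.ofReal_le_ofReal ?_)
    exact mul_le_mul_of_nonneg_right (le_max_left _ _) hm.le

theorem lap_neg {n : ℕ} (u : EuclideanSpace ℝ (Fin n) → ℝ) (x : EuclideanSpace ℝ (Fin n)) :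
    lap (fun y => -u y) x = -lap u x := by
  simp [lap, fderiv_fun_neg]

theorem exists_eLpNorm_add_eLpNorm_fderiv_le {n : ℕ} (hn : 2 ≤ n)
    {Ω : Set (EuclideanSpace ℝ (Fin n))} (hΩ : IsOpen Ω) (hb : Bornology.IsBounded Ω) {p : ℝ}
    (hp : 1 ≤ p) (hp' : p * ((n : ℝ) - 1) < n) :
    ∃ K : ℝ, 0 ≤ K ∧ ∀ (u : EuclideanSpace ℝ (Fin n) → ℝ) (m : ℝ),
      ContDiffOn ℝ 2 u Ω → ContinuousOn u (closure Ω) → (∀ x ∈ frontier Ω, u x = 0) → 0 < m →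
      eLpNorm (fun x => lap u x) 1 (volume.restrict Ω) ≤ ENNReal.ofReal m →
      eLpNorm u (ENNReal.ofReal p) (volume.restrict Ω) +
        eLpNorm (fun x => fderiv ℝ u x) (ENNReal.ofReal p) (volume.restrict Ω) ≤
        ENNReal.ofReal (K * m) := by
  have hn' : (2 : ℝ) ≤ n := by exact_mod_cast hn
  have hp2 : p < 2 := by nlinarith
  have hpn : p < n := by nlinarith
  have hp1 : 1 ≤ ENNReal.ofReal p := by simpa using hp
  obtain ⟨K, hK0, hK⟩ := exists_eLpNorm_posPart_le hΩ hb hp hp2 hpn hp'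
  refine ⟨4 * K, by positivity, fun u m hu hcl h0 hm hM => ?_⟩
  obtain ⟨a1, a2, a3⟩ := hK u m hu hcl h0 hm hM
  obtain ⟨b1, b2, b3⟩ := hK (fun x => -u x) m hu.neg hcl.neg (fun x hx => by simp [h0 x hx]) hm
    (by
      simp only [lap_neg]
      exact (eLpNorm_neg (fun x => lap u x) 1 _).trans_le hM)
  have hum : AEStronglyMeasurable u (volume.restrict Ω) :=
    hu.continuousOn.aestronglyMeasurable hΩ.measurableSet
  have e1 : eLpNorm u (ENNReal.ofReal p) (volume.restrict Ω) ≤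
      ENNReal.ofReal (K * m) + ENNReal.ofReal (K * m) := by
    have : u = (fun x => max (u x) 0) - fun x => max (-u x) 0 := by
      ext x
      simp only [Pi.sub_apply]
      rcases le_total (u x) 0 with h | h
      · rw [max_eq_right h, max_eq_left (neg_nonneg.2 h)]
        ring
      · rw [max_eq_left h, max_eq_right (neg_nonpos.2 h)]
        ring
    calc eLpNorm u (ENNReal.ofReal p) (volume.restrict Ω)
        = eLpNorm ((fun x => max (u x) 0) - fun x => max (-u x) 0) (ENNReal.ofReal p)
          (volume.restrict Ω) := by rw [← this]
      _ ≤ _ := eLpNorm_sub_le (hum.sup aestronglyMeasurable_const)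
          (hum.neg.sup aestronglyMeasurable_const) hp1
      _ ≤ _ := add_le_add a2 b2
  have e2 : eLpNorm (fun x => fderiv ℝ u x) (ENNReal.ofReal p) (volume.restrict Ω) ≤
      ENNReal.ofReal (K * m) + ENNReal.ofReal (K * m) := by
    have : (fun x => fderiv ℝ u x) =ᵐ[volume.restrict Ω]
        (fun x => if 0 < u x then fderiv ℝ u x else 0) -
          fun x => if 0 < -u x then fderiv ℝ (fun y => -u y) x else 0 := by
      filter_upwards [ae_fderiv_eq_zero_of_eq_zero hΩ (hu.differentiableOn (by norm_num))]
        with x hx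
      simp only [Pi.sub_apply, fderiv_fun_neg]
      rcases lt_trichotomy (u x) 0 with h | h | h
      · simp [h, h.not_gt]
      · simp [h, hx h]
      · simp [h, h.not_gt]
    rw [eLpNorm_congr_ae this]
    exact (eLpNorm_sub_le a1 b1 hp1).trans (add_le_add a3 b3)
  refine (add_le_add e1 e2).trans_eq ?_
  have hKm : 0 ≤ K * m := by positivity
  rw [← ENNReal.ofReal_add hKm hKm, ← ENNReal.ofReal_add (by positivity) (by positivity)]
  congr 1
  ring

theorem abs_deriv_le_and_abs_le_of_integral_le {O : Set ℝ} (hO : IsOpen O) {R : ℝ}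
    (hR : O ⊆ Ioo (-R) R) {g g₁ g₂ : ℝ → ℝ} (hg : ContinuousOn g (closure O))
    (h0 : ∀ x ∈ frontier O, g x = 0) (h1 : ∀ x ∈ O, HasDerivAt g (g₁ x) x)
    (h2 : ∀ x ∈ O, HasDerivAt g₁ (g₂ x) x) (hc : ContinuousOn g₂ O) {m : ℝ} (hm : 0 ≤ m)
    (hi : ∫⁻ x in O, ‖g₂ x‖ₑ ≤ ENNReal.ofReal m) {x : ℝ} (hx : x ∈ O) :
    |g₁ x| ≤ m ∧ |g x| ≤ 2 * R * m := by
  have hInt : IntegrableOn g₂ O :=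
    ⟨hc.aestronglyMeasurable hO.measurableSet, hi.trans_lt ENNReal.ofReal_lt_top⟩
  have hnorm : ∫ x in O, ‖g₂ x‖ ≤ m := by
    rw [integral_norm_eq_lintegral_enorm hInt.aestronglyMeasurable]
    exact ENNReal.toReal_le_of_le_ofReal hm hi
  have hRx := hR hx
  obtain ⟨a, haO, hax, hRa, ha⟩ : ∃ a, a ∉ O ∧ a < x ∧ -R ≤ a ∧ Ioc a x ⊆ O := by
    have hbdd : BddAbove (Oᶜ ∩ Iic x) := ⟨x, fun y hy => hy.2⟩
    have hmemR : -R ∈ Oᶜ ∩ Iic x := ⟨fun h => (lt_irrefl _ (hR h).1), hRx.1.le⟩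
    have hmem := (hO.isClosed_compl.inter isClosed_Iic).csSup_mem ⟨_, hmemR⟩ hbdd
    refine ⟨_, hmem.1, lt_of_le_of_ne hmem.2 fun h => hmem.1 (by rwa [h]), le_csSup hbdd hmemR, ?_⟩
    intro y hy
    by_contra h
    exact absurd hy.1 (not_lt.2 (le_csSup hbdd ⟨h, hy.2⟩))
  obtain ⟨b, hbO, hxb, hb⟩ : ∃ b, b ∉ O ∧ x < b ∧ Ico x b ⊆ O := by
    have hbdd : BddBelow (Oᶜ ∩ Ici x) := ⟨x, fun y hy => hy.2⟩
    have hmemR : R ∈ Oᶜ ∩ Ici x := ⟨fun h => (lt_irrefl _ (hR h).2), hRx.2.le⟩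
    have hmem := (hO.isClosed_compl.inter isClosed_Ici).csInf_mem ⟨_, hmemR⟩ hbdd
    refine ⟨_, hmem.1, lt_of_le_of_ne hmem.2 fun h => hmem.1 (by rwa [← h]), ?_⟩
    intro y hy
    by_contra h
    exact absurd hy.2 (not_lt.2 (csInf_le hbdd ⟨h, hy.1⟩))
  have hab : Ioo a b ⊆ O := fun y hy => by
    rcases le_or_gt y x with h | h
    · exact ha ⟨hy.1, h⟩
    · exact hb ⟨h.le, hy.2⟩
  have hab' : a < b := hax.trans hxb
  have hcl : Icc a b ⊆ closure O := by
    rw [← closure_Ioo hab'.ne]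
    exact closure_mono hab
  have hfr : ∀ y ∈ Icc a b, y ∉ O → g y = 0 := fun y hy hyO =>
    h0 y ⟨hcl hy, by rwa [hO.interior_eq]⟩
  have hga : g a = 0 := hfr a (left_mem_Icc.2 hab'.le) haO
  have hgb : g b = 0 := hfr b (right_mem_Icc.2 hab'.le) hbO
  have hbound : ∀ y ∈ Ioo a b, |g₁ y| ≤ m := by
    obtain ⟨c, hcab, hc0⟩ := exists_hasDerivAt_eq_zero hab' (hg.mono hcl) (hga.trans hgb.symm)
      fun y hy => h1 y (hab hy)
    intro y hy
    have hsub : uIcc c y ⊆ O := (ordConnected_Ioo.uIcc_subset hcab hy).trans hab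
    have hFTC := intervalIntegral.integral_eq_sub_of_hasDerivAt (fun z hz => h2 z (hsub hz))
      (hc.mono hsub).intervalIntegrable
    rw [hc0, sub_zero] at hFTC
    rw [← hFTC, ← Real.norm_eq_abs]
    refine (intervalIntegral.norm_integral_le_integral_norm_uIoc).trans (le_trans ?_ hnorm)
    exact setIntegral_mono_set hInt.norm (.of_forall fun _ => norm_nonneg _)
      (LE.le.eventuallyLE (uIoc_subset_uIcc.trans hsub))
  refine ⟨hbound x ⟨hax, hxb⟩, ?_⟩
  obtain ⟨c, hcax, hslope⟩ := exists_hasDerivAt_eq_slope g g₁ hax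
    (hg.mono ((Icc_subset_Icc_right hxb.le).trans hcl)) fun y hy => h1 y (ha (Ioo_subset_Ioc_self hy))
  have hxa : 0 < x - a := sub_pos.2 hax
  have hgx : g x = g₁ c * (x - a) := by
    rw [hslope, hga, sub_zero, div_mul_cancel₀ _ hxa.ne']
  rw [hgx, abs_mul, abs_of_pos hxa, mul_comm]
  refine mul_le_mul ?_ (hbound c ⟨hcax.1, hcax.2.trans hxb⟩) (abs_nonneg _) ?_
  · linarith [hRx.2]
  · linarith [hRx.1, hRx.2]

theorem exists_eLpNorm_add_eLpNorm_fderiv_le_of_dim_one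
    {Ω : Set (EuclideanSpace ℝ (Fin 1))} (hΩ : IsOpen Ω) (hb : Bornology.IsBounded Ω) (p : ℝ) :
    ∃ K : ℝ, 0 ≤ K ∧ ∀ (u : EuclideanSpace ℝ (Fin 1) → ℝ) (m : ℝ),
      ContDiffOn ℝ 2 u Ω → ContinuousOn u (closure Ω) → (∀ x ∈ frontier Ω, u x = 0) → 0 < m →
      eLpNorm (fun x => lap u x) 1 (volume.restrict Ω) ≤ ENNReal.ofReal m →
      eLpNorm u (ENNReal.ofReal p) (volume.restrict Ω) +
        eLpNorm (fun x => fderiv ℝ u x) (ENNReal.ofReal p) (volume.restrict Ω) ≤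
        ENNReal.ofReal (K * m) := by
  set e : EuclideanSpace ℝ (Fin 1) := EuclideanSpace.single 0 1 with he
  have hen : ‖e‖ = 1 := by simp [he]
  set φ : ℝ ≃ₗᵢ[ℝ] EuclideanSpace ℝ (Fin 1) :=
    (LinearIsometry.toSpanSingleton ℝ _ hen).toLinearIsometryEquiv (by simp) with hφ
  have hmp : MeasurePreserving φ volume volume := φ.measurePreserving
  obtain ⟨R, hR0, hR⟩ : ∃ R : ℝ, 0 < R ∧ Ω ⊆ ball 0 R := by
    obtain ⟨R, hR⟩ := hb.subset_ball 0
    exact ⟨max R 1, by positivity, hR.trans (ball_subset_ball (le_max_left _ _))⟩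
  set A : ℝ≥0∞ := eLpNorm (fun _ : EuclideanSpace ℝ (Fin 1) => (1 : ℝ)) (ENNReal.ofReal p)
    (volume.restrict Ω) with hA
  have hAfin : A ≠ ∞ := by
    have : IsFiniteMeasure (volume.restrict Ω) := ⟨by simpa using hb.measure_lt_top⟩
    exact (memLp_const (1 : ℝ)).eLpNorm_ne_top
  refine ⟨(2 * R + 1) * A.toReal, by positivity, fun u m hu hcl h0 hm hM => ?_⟩
  set O : Set ℝ := φ ⁻¹' Ω with hO
  have hOo : IsOpen O := hΩ.preimage φ.continuous
  have hOR : O ⊆ Ioo (-R) R := by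
    intro t ht
    have := hR ht
    rw [mem_ball_zero_iff, φ.norm_map] at this
    exact abs_lt.1 this
  have hOcl : closure O = φ ⁻¹' closure Ω := (φ.toHomeomorph.preimage_closure Ω).symm
  have hOfr : frontier O = φ ⁻¹' frontier Ω := (φ.toHomeomorph.preimage_frontier Ω).symm
  have hφd : ∀ t, HasDerivAt φ e t := fun t => by
    have : HasDerivAt (fun s : ℝ => s • e) e t := by
      simpa using (hasDerivAt_id t).smul_const e
    exact this
  have hlap : ∀ x, lap u x = fderiv ℝ (fun y => fderiv ℝ u y e) x e := by
    intro x
    simp [lap, he]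
  have hpt : ∀ x ∈ Ω, ‖fderiv ℝ u x‖ ≤ m ∧ |u x| ≤ 2 * R * m := by
    intro x hx
    have key := abs_deriv_le_and_abs_le_of_integral_le hOo hOR (g := fun t => u (φ t))
      (g₁ := fun t => fderiv ℝ u (φ t) e) (g₂ := fun t => lap u (φ t))
      (hcl.comp φ.continuous.continuousOn (by rw [hOcl]; exact mapsTo_preimage _ _))
      (fun t ht => h0 _ (by rw [hOfr] at ht; exact ht))
      (fun t ht => ((hu.contDiffAt (hΩ.mem_nhds ht)).differentiableAt
        (by norm_num)).hasFDerivAt.comp_hasDerivAt t (hφd t))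
      (fun t ht => by
        rw [hlap]
        exact (((contDiffOn_fderiv_apply hΩ hu e).contDiffAt
          (hΩ.mem_nhds ht)).differentiableAt (by norm_num)).hasFDerivAt.comp_hasDerivAt t (hφd t))
      ((continuousOn_lap hΩ hu).comp φ.continuous.continuousOn (mapsTo_preimage _ _)) hm.le
      (by
        rw [hO, hmp.setLIntegral_comp_preimage_emb φ.toHomeomorph.measurableEmbedding
          (fun x => ‖lap u x‖ₑ)]
        rwa [eLpNorm_one_eq_lintegral_enorm] at hM)
      (x := φ.symm x) (by simpa [hO] using hx)
    simp only [φ.apply_symm_apply] at key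
    refine ⟨?_, key.2⟩
    have hsq := sq_norm_le_sum_sq_apply_single (fderiv ℝ u x)
    rw [Fin.sum_univ_one, ← he, sq_le_sq, abs_norm] at hsq
    exact hsq.trans key.1
  have hbd : ∀ {F : Type} [NormedAddCommGroup F] (f : EuclideanSpace ℝ (Fin 1) → F) (c : ℝ),
      0 ≤ c → (∀ x ∈ Ω, ‖f x‖ ≤ c) →
      eLpNorm f (ENNReal.ofReal p) (volume.restrict Ω) ≤ ENNReal.ofReal c * A := by
    intro F _ f c hc hf
    refine eLpNorm_le_mul_eLpNorm_of_ae_le_mul ?_ _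
    exact ae_restrict_of_forall_mem hΩ.measurableSet fun x hx => by simpa using hf x hx
  refine (add_le_add (hbd u (2 * R * m) (by positivity) fun x hx => (hpt x hx).2)
    (hbd (fun x => fderiv ℝ u x) m hm.le fun x hx => (hpt x hx).1)).trans_eq ?_
  rw [← add_mul, ← ENNReal.ofReal_add (by positivity) hm.le,
    show (2 * R + 1) * A.toReal * m = (2 * R * m + m) * A.toReal by ring,
    ENNReal.ofReal_mul (by positivity), ENNReal.ofReal_toReal hAfin]

theorem ENNReal.le_ofReal_add_one_mul_of_forall_le {K : ℝ} (hK : 0 ≤ K) {L M : ℝ≥0∞}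
    (h : ∀ m : ℝ, 0 < m → M ≤ ENNReal.ofReal m → L ≤ ENNReal.ofReal (K * m)) :
    L ≤ ENNReal.ofReal (K + 1) * M := by
  by_cases hM : M = ∞
  · rw [hM, ENNReal.mul_top (by simpa using by linarith)]
    exact le_top
  have hlim : Tendsto (fun η : ℝ => ENNReal.ofReal (K * (M.toReal + η))) (𝓝[>] 0)
      (𝓝 (ENNReal.ofReal (K * M.toReal))) := by
    have : Continuous fun η : ℝ => ENNReal.ofReal (K * (M.toReal + η)) :=
      ENNReal.continuous_ofReal.comp (by fun_prop)
    simpa using (this.tendsto 0).mono_left nhdsWithin_le_nhds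
  have hle : L ≤ ENNReal.ofReal (K * M.toReal) := by
    refine ge_of_tendsto hlim ?_
    filter_upwards [self_mem_nhdsWithin] with η hη
    have hη' : 0 < η := hη
    refine h _ (by positivity) ?_
    rw [ENNReal.le_ofReal_iff_toReal_le hM (by positivity)]
    linarith
  refine hle.trans ?_
  rw [ENNReal.ofReal_mul hK, ENNReal.ofReal_toReal hM]
  gcongr
  linarith

theorem stmt_10 (n : ℕ) (hn : 1 ≤ n)
    (Ω : Set (EuclideanSpace ℝ (Fin n)))
    (hΩb : Bornology.IsBounded Ω) (hΩo : IsOpen Ω) (hΩs : HasSmoothBoundary Ω)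
    (p : ℝ) (hp1 : 1 ≤ p) (hp2 : p * ((n : ℝ) - 1) < n) :
    ∃ C : ℝ, 0 ≤ C ∧
      ∀ u : EuclideanSpace ℝ (Fin n) → ℝ,
        ContDiffOn ℝ 2 u (closure Ω) →
        (∀ x ∈ frontier Ω, u x = 0) →
        eLpNorm u (ENNReal.ofReal p) (volume.restrict Ω) +
            eLpNorm (fun x => fderiv ℝ u x) (ENNReal.ofReal p) (volume.restrict Ω) ≤
          ENNReal.ofReal C * eLpNorm (fun x => lap u x) 1 (volume.restrict Ω) := by
  obtain ⟨K, hK0, hK⟩ : ∃ K : ℝ, 0 ≤ K ∧ ∀ (u : EuclideanSpace ℝ (Fin n) → ℝ) (m : ℝ),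
      ContDiffOn ℝ 2 u Ω → ContinuousOn u (closure Ω) → (∀ x ∈ frontier Ω, u x = 0) → 0 < m →
      eLpNorm (fun x => lap u x) 1 (volume.restrict Ω) ≤ ENNReal.ofReal m →
      eLpNorm u (ENNReal.ofReal p) (volume.restrict Ω) +
        eLpNorm (fun x => fderiv ℝ u x) (ENNReal.ofReal p) (volume.restrict Ω) ≤
        ENNReal.ofReal (K * m) := by
    rcases hn.eq_or_lt with rfl | hn2
    · exact exists_eLpNorm_add_eLpNorm_fderiv_le_of_dim_one hΩo hΩb p
    · exact exists_eLpNorm_add_eLpNorm_fderiv_le hn2 hΩo hΩb hp1 hp2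
  refine ⟨K + 1, by positivity, fun u hu h0 => ?_⟩
  exact ENNReal.le_ofReal_add_one_mul_of_forall_le hK0 fun m hm hM =>
    hK u m (hu.mono subset_closure) hu.continuousOn h0 hm hM
end

section
/- Let m ≥ 1 be an integer, let S = {x_1, …, x_I} ⊂ ℝ^{2m} be a finite set, and let h be a smooth function on ℝ^{2m}∖S satisfying Δ^m h = 0 on ℝ^{2m}∖S and dist(x, S)·|∇h(x)| ≤ C for all x ∈ ℝ^{2m}∖S, for some constant C. Then there exist real constants β and λ_1, …, λ_I such that h(x) = Σ_{i=1}^{I} λ_i log(1/|x−x_i|) + β for every x ∈ ℝ^{2m}∖S. -/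
open MeasureTheory Metric Filter Set
open scoped ENNReal Topology

section Laplacian

variable {n : ℕ} {f g : EuclideanSpace ℝ (Fin n) → ℝ} {U : Set (EuclideanSpace ℝ (Fin n))}

lemma lap_congr {x : EuclideanSpace ℝ (Fin n)} (hfg : f =ᶠ[𝓝 x] g) : lap f =ᶠ[𝓝 x] lap g := by
  have h1 : ∀ᶠ y in 𝓝 x, f =ᶠ[𝓝 y] g := hfg.eventually_nhds
  have h2 : ∀ᶠ y in 𝓝 x, ∀ᶠ z in 𝓝 y, f =ᶠ[𝓝 z] g := h1.eventually_nhds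
  filter_upwards [h2] with y hy
  refine Finset.sum_congr rfl fun i _ => ?_
  have : (fun z => fderiv ℝ f z (EuclideanSpace.single i 1))
      =ᶠ[𝓝 y] fun z => fderiv ℝ g z (EuclideanSpace.single i 1) := by
    filter_upwards [hy] with z hz
    rw [hz.fderiv_eq]
  rw [this.fderiv_eq]

lemma iterate_lap_congr {x : EuclideanSpace ℝ (Fin n)} (hfg : f =ᶠ[𝓝 x] g) (k : ℕ) :
    lap^[k] f =ᶠ[𝓝 x] lap^[k] g := by
  induction k with
  | zero => exact hfg
  | succ k ih => simpa only [Function.iterate_succ_apply'] using lap_congr ih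

lemma lap_const (c : ℝ) : lap (fun _ : EuclideanSpace ℝ (Fin n) => c) = fun _ => 0 := by
  funext x
  simp [lap]

lemma iterate_lap_zero (k : ℕ) :
    lap^[k] (fun _ : EuclideanSpace ℝ (Fin n) => (0 : ℝ)) = fun _ => 0 := by
  induction k with
  | zero => rfl
  | succ k ih => rw [Function.iterate_succ_apply, lap_const, ih]

lemma iterate_lap_const {k : ℕ} (hk : 1 ≤ k) (c : ℝ) :
    lap^[k] (fun _ : EuclideanSpace ℝ (Fin n) => c) = fun _ => 0 := by
  obtain ⟨k, rfl⟩ := Nat.exists_eq_add_of_le' hk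
  rw [Function.iterate_succ_apply, lap_const, iterate_lap_zero]

lemma iterate_lap_eq_zero_of_notMem_tsupport {x : EuclideanSpace ℝ (Fin n)} (k : ℕ)
    (hx : x ∉ tsupport f) : lap^[k] f x = 0 := by
  have h0 : f =ᶠ[𝓝 x] fun _ => 0 := notMem_tsupport_iff_eventuallyEq.mp hx
  rw [(iterate_lap_congr h0 k).eq_of_nhds, iterate_lap_zero]

lemma tsupport_iterate_lap_subset (k : ℕ) : tsupport (lap^[k] f) ⊆ tsupport f := by
  refine closure_minimal (fun x hx => ?_) (isClosed_tsupport f)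
  by_contra hxf
  exact hx (iterate_lap_eq_zero_of_notMem_tsupport k hxf)

lemma HasCompactSupport.iterate_lap (hf : HasCompactSupport f) (k : ℕ) :
    HasCompactSupport (lap^[k] f) :=
  hf.mono' ((subset_tsupport _).trans (tsupport_iterate_lap_subset k))

lemma contDiffOn_fderiv_single (hU : IsOpen U) (hf : ContDiffOn ℝ (⊤ : ℕ∞) f U) (i : Fin n) :
    ContDiffOn ℝ (⊤ : ℕ∞) (fun y => fderiv ℝ f y (EuclideanSpace.single i 1)) U :=
  (hf.fderiv_of_isOpen hU (by simp)).clm_apply contDiffOn_const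

lemma contDiffOn_lap (hU : IsOpen U) (hf : ContDiffOn ℝ (⊤ : ℕ∞) f U) :
    ContDiffOn ℝ (⊤ : ℕ∞) (lap f) U :=
  ContDiffOn.sum fun i _ => contDiffOn_fderiv_single hU (contDiffOn_fderiv_single hU hf i) i

lemma contDiffOn_iterate_lap (hU : IsOpen U) (hf : ContDiffOn ℝ (⊤ : ℕ∞) f U) (k : ℕ) :
    ContDiffOn ℝ (⊤ : ℕ∞) (lap^[k] f) U := by
  induction k with
  | zero => exact hf
  | succ k ih => simpa only [Function.iterate_succ_apply'] using contDiffOn_lap hU ih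

lemma contDiff_iterate_lap (hf : ContDiff ℝ (⊤ : ℕ∞) f) (k : ℕ) :
    ContDiff ℝ (⊤ : ℕ∞) (lap^[k] f) :=
  contDiffOn_univ.mp (contDiffOn_iterate_lap isOpen_univ hf.contDiffOn k)

lemma lap_add (hf : ContDiff ℝ (⊤ : ℕ∞) f) (hg : ContDiff ℝ (⊤ : ℕ∞) g) :
    lap (fun x => f x + g x) = fun x => lap f x + lap g x := by
  have d : ∀ {u : EuclideanSpace ℝ (Fin n) → ℝ}, ContDiff ℝ (⊤ : ℕ∞) u → Differentiable ℝ u :=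
    fun hu => hu.differentiable (by simp)
  have d' : ∀ {u : EuclideanSpace ℝ (Fin n) → ℝ} (i : Fin n), ContDiff ℝ (⊤ : ℕ∞) u →
      Differentiable ℝ (fun y => fderiv ℝ u y (EuclideanSpace.single i 1)) := fun i hu =>
    d (contDiffOn_univ.mp (contDiffOn_fderiv_single isOpen_univ hu.contDiffOn i))
  funext x
  simp only [lap, ← Finset.sum_add_distrib]
  refine Finset.sum_congr rfl fun i _ => ?_
  have : (fun y => fderiv ℝ (fun x => f x + g x) y (EuclideanSpace.single i 1)) =
      fun y => fderiv ℝ f y (EuclideanSpace.single i 1)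
        + fderiv ℝ g y (EuclideanSpace.single i 1) := by
    funext y
    rw [fderiv_fun_add (d hf y) (d hg y)]
    rfl
  rw [this, fderiv_fun_add (d' i hf x) (d' i hg x)]
  rfl

lemma iterate_lap_add (hf : ContDiff ℝ (⊤ : ℕ∞) f) (hg : ContDiff ℝ (⊤ : ℕ∞) g) (k : ℕ) :
    lap^[k] (fun x => f x + g x) = fun x => lap^[k] f x + lap^[k] g x := by
  induction k with
  | zero => rfl
  | succ k ih =>
    rw [Function.iterate_succ_apply', ih,
      lap_add (contDiff_iterate_lap hf k) (contDiff_iterate_lap hg k)]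
    simp only [Function.iterate_succ_apply']

lemma lap_const_mul (c : ℝ) (f : EuclideanSpace ℝ (Fin n) → ℝ) :
    lap (fun x => c * f x) = fun x => c * lap f x := by
  funext x
  have key : ∀ u : EuclideanSpace ℝ (Fin n) → ℝ, ∀ y v,
      fderiv ℝ (fun z => c * u z) y v = c * fderiv ℝ u y v := by
    intro u y v
    have : (fun z => c * u z) = c • u := rfl
    rw [this, fderiv_const_smul_field]
    rfl
  simp only [lap, key, Finset.mul_sum]

lemma iterate_lap_const_mul (c : ℝ) (f : EuclideanSpace ℝ (Fin n) → ℝ) (k : ℕ) :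
    lap^[k] (fun x => c * f x) = fun x => c * lap^[k] f x := by
  induction k with
  | zero => rfl
  | succ k ih => simp only [Function.iterate_succ_apply', ih, lap_const_mul]

lemma iterate_lap_sub (hf : ContDiff ℝ (⊤ : ℕ∞) f) (hg : ContDiff ℝ (⊤ : ℕ∞) g) (k : ℕ) :
    lap^[k] (fun x => f x - g x) = fun x => lap^[k] f x - lap^[k] g x := by
  have h1 : (fun x => f x - g x) = fun x => f x + (-1) * g x := by
    funext x; ring
  rw [h1, iterate_lap_add hf (contDiff_const.mul hg), iterate_lap_const_mul]
  funext x; ring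

lemma iterate_lap_sum {ι : Type*} (s : Finset ι) (F : ι → EuclideanSpace ℝ (Fin n) → ℝ)
    (hF : ∀ i, ContDiff ℝ (⊤ : ℕ∞) (F i)) (k : ℕ) :
    lap^[k] (fun x => ∑ i ∈ s, F i x) = fun x => ∑ i ∈ s, lap^[k] (F i) x := by
  classical
  induction s using Finset.induction_on with
  | empty => simpa using iterate_lap_zero k
  | insert a s ha ih =>
    simp only [Finset.sum_insert ha]
    rw [iterate_lap_add (hF a) (ContDiff.sum fun i _ => hF i), ih]

lemma lap_comp_affine (f : EuclideanSpace ℝ (Fin n) → ℝ) (t : ℝ) (b : EuclideanSpace ℝ (Fin n)) :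
    lap (fun y => f (t • (y - b))) = fun y => t ^ 2 * lap f (t • (y - b)) := by
  have key : ∀ u : EuclideanSpace ℝ (Fin n) → ℝ, ∀ y v,
      fderiv ℝ (fun z => u (t • (z - b))) y v = t * fderiv ℝ u (t • (y - b)) v := by
    intro u y v
    rw [fderiv_comp_sub (f := fun z => u (t • z)) b, fderiv_comp_smul (f := u) t]
    rfl
  have key' : ∀ u : EuclideanSpace ℝ (Fin n) → ℝ, ∀ y v,
      fderiv ℝ (fun z => t * u z) y v = t * fderiv ℝ u y v := by
    intro u y v
    have : (fun z => t * u z) = t • u := rfl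
    rw [this, fderiv_const_smul_field]
    rfl
  funext x
  simp only [lap, key, key', Finset.mul_sum]
  refine Finset.sum_congr rfl fun i _ => ?_
  rw [key (fun z => fderiv ℝ f z (EuclideanSpace.single i 1))]
  ring

lemma iterate_lap_comp_affine (f : EuclideanSpace ℝ (Fin n) → ℝ) (t : ℝ)
    (b : EuclideanSpace ℝ (Fin n)) (k : ℕ) :
    lap^[k] (fun y => f (t • (y - b))) = fun y => t ^ (2 * k) * lap^[k] f (t • (y - b)) := by
  induction k with
  | zero => simp
  | succ k ih =>
    rw [Function.iterate_succ_apply', ih, lap_const_mul, lap_comp_affine]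
    simp only [Function.iterate_succ_apply']
    funext y; ring

lemma continuous_mul_of_tsupport_subset_s11 (hU : IsOpen U) (hf : ContinuousOn f U)
    (hg : Continuous g) (hgU : tsupport g ⊆ U) : Continuous fun x => f x * g x := by
  rw [continuous_iff_continuousAt]
  intro x
  by_cases hx : x ∈ tsupport g
  · exact (hf.continuousAt (hU.mem_nhds (hgU hx))).mul hg.continuousAt
  · have h0 : g =ᶠ[𝓝 x] fun _ => 0 := notMem_tsupport_iff_eventuallyEq.mp hx
    have h1 : (fun x => f x * g x) =ᶠ[𝓝 x] fun _ => 0 := by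
      filter_upwards [h0] with y hy
      simp [hy]
    exact continuousAt_const.congr h1.symm

lemma integrable_mul_of_tsupport_subset (hU : IsOpen U) (hf : ContinuousOn f U)
    (hg : Continuous g) (hgc : HasCompactSupport g) (hgU : tsupport g ⊆ U) :
    Integrable (fun x => f x * g x) :=
  (continuous_mul_of_tsupport_subset_s11 hU hf hg hgU).integrable_of_hasCompactSupport hgc.mul_left

lemma integral_mul_fderiv_single (hU : IsOpen U) (hf : ContDiffOn ℝ (⊤ : ℕ∞) f U)
    (hg : ContDiff ℝ (⊤ : ℕ∞) g) (hgc : HasCompactSupport g) (hgU : tsupport g ⊆ U) (i : Fin n) :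
    ∫ x, f x * fderiv ℝ g x (EuclideanSpace.single i 1)
      = - ∫ x, fderiv ℝ f x (EuclideanSpace.single i 1) * g x := by
  have hg' := contDiffOn_univ.mp (contDiffOn_fderiv_single isOpen_univ hg.contDiffOn i)
  have hsub := tsupport_fderiv_apply_subset ℝ (f := g) (EuclideanSpace.single i (1 : ℝ))
  apply integral_mul_fderiv_eq_neg_fderiv_mul_of_integrable
  · exact integrable_mul_of_tsupport_subset hU (contDiffOn_fderiv_single hU hf i).continuousOn
      hg.continuous hgc hgU
  · exact integrable_mul_of_tsupport_subset hU hf.continuousOn hg'.continuous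
      (hgc.mono' ((subset_tsupport _).trans hsub)) (hsub.trans hgU)
  · exact integrable_mul_of_tsupport_subset hU hf.continuousOn hg.continuous hgc hgU
  · exact fun x hx => (hf.contDiffAt (hU.mem_nhds (hgU hx))).differentiableAt (by simp)
  · exact fun x _ => hg.differentiable (by simp) x

lemma integral_mul_lap_eq_neg (hU : IsOpen U) (hf : ContDiffOn ℝ (⊤ : ℕ∞) f U)
    (hg : ContDiff ℝ (⊤ : ℕ∞) g) (hgc : HasCompactSupport g) (hgU : tsupport g ⊆ U) :
    ∫ x, f x * lap g x = - ∑ i, ∫ x, fderiv ℝ f x (EuclideanSpace.single i 1)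
      * fderiv ℝ g x (EuclideanSpace.single i 1) := by
  have hg' : ∀ i : Fin n, ContDiff ℝ (⊤ : ℕ∞) fun y => fderiv ℝ g y (EuclideanSpace.single i 1) :=
    fun i => contDiffOn_univ.mp (contDiffOn_fderiv_single isOpen_univ hg.contDiffOn i)
  have hg'' : ∀ i : Fin n, ContDiff ℝ (⊤ : ℕ∞) fun x => fderiv ℝ (fun y => fderiv ℝ g y
      (EuclideanSpace.single i 1)) x (EuclideanSpace.single i 1) :=
    fun i => contDiffOn_univ.mp (contDiffOn_fderiv_single isOpen_univ (hg' i).contDiffOn i)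
  have hs : ∀ i : Fin n, tsupport (fun y => fderiv ℝ g y (EuclideanSpace.single i 1))
      ⊆ tsupport g := fun i => tsupport_fderiv_apply_subset ℝ _
  have hs' : ∀ i : Fin n, tsupport (fun x => fderiv ℝ (fun y => fderiv ℝ g y
      (EuclideanSpace.single i 1)) x (EuclideanSpace.single i 1)) ⊆ tsupport g :=
    fun i => (tsupport_fderiv_apply_subset ℝ _).trans (hs i)
  simp only [lap, Finset.mul_sum]
  rw [integral_finsetSum, ← Finset.sum_neg_distrib]
  · exact Finset.sum_congr rfl fun i _ => integral_mul_fderiv_single hU hf (hg' i)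
      (hgc.mono' ((subset_tsupport _).trans (hs i))) ((hs i).trans hgU) i
  · exact fun i _ => integrable_mul_of_tsupport_subset hU hf.continuousOn (hg'' i).continuous
      (hgc.mono' ((subset_tsupport _).trans (hs' i))) ((hs' i).trans hgU)

lemma integral_mul_lap (hU : IsOpen U) (hf : ContDiffOn ℝ (⊤ : ℕ∞) f U)
    (hg : ContDiff ℝ (⊤ : ℕ∞) g) (hgc : HasCompactSupport g) (hgU : tsupport g ⊆ U) :
    ∫ x, f x * lap g x = ∫ x, lap f x * g x := by
  have hf' : ∀ i : Fin n, ContDiffOn ℝ (⊤ : ℕ∞)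
      (fun y => fderiv ℝ f y (EuclideanSpace.single i 1)) U :=
    fun i => contDiffOn_fderiv_single hU hf i
  rw [integral_mul_lap_eq_neg hU hf hg hgc hgU]
  simp only [lap, Finset.sum_mul]
  rw [integral_finsetSum, ← Finset.sum_neg_distrib]
  · refine Finset.sum_congr rfl fun i _ => ?_
    rw [integral_mul_fderiv_single hU (hf' i) hg hgc hgU, neg_neg]
  · exact fun i _ => integrable_mul_of_tsupport_subset hU
      (contDiffOn_fderiv_single hU (hf' i) i).continuousOn hg.continuous hgc hgU

lemma integral_mul_iterate_lap (hU : IsOpen U) (hf : ContDiffOn ℝ (⊤ : ℕ∞) f U)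
    (hg : ContDiff ℝ (⊤ : ℕ∞) g) (hgc : HasCompactSupport g) (hgU : tsupport g ⊆ U) (k : ℕ) :
    ∫ x, f x * lap^[k] g x = ∫ x, lap^[k] f x * g x := by
  induction k generalizing f with
  | zero => rfl
  | succ k ih =>
    rw [Function.iterate_succ_apply', Function.iterate_succ_apply,
      integral_mul_lap hU hf (contDiff_iterate_lap hg k) (hgc.iterate_lap k)
        ((tsupport_iterate_lap_subset k).trans hgU), ih (contDiffOn_lap hU hf)]

lemma integral_comp_affine (H G : EuclideanSpace ℝ (Fin n) → ℝ) {t : ℝ} (ht : 0 < t)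
    (b : EuclideanSpace ℝ (Fin n)) :
    ∫ y, H y * (t ^ n * G (t • (y - b))) = ∫ z, H (b + t⁻¹ • z) * G z := by
  have h1 := Measure.integral_comp_smul (volume : Measure (EuclideanSpace ℝ (Fin n)))
    (fun z => H (b + t⁻¹ • z) * G z) t
  have h2 := integral_sub_right_eq_self (μ := (volume : Measure (EuclideanSpace ℝ (Fin n))))
    (fun y => H (b + y) * G (t • y)) b
  simp only [finrank_euclideanSpace, Fintype.card_fin, smul_smul, inv_mul_cancel₀ ht.ne',
    one_smul, add_sub_cancel, smul_eq_mul] at h1 h2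
  rw [← h2, abs_of_pos (by positivity)] at h1
  have h3 : ∀ y, H y * (t ^ n * G (t • (y - b))) = t ^ n * (H y * G (t • (y - b))) := by
    intro y; ring
  simp only [h3]
  rw [integral_const_mul, h1, mul_inv_cancel_left₀ (by positivity)]

lemma contDiff_uncurry_iterate_lap {G : ℝ → EuclideanSpace ℝ (Fin n) → ℝ}
    (hG : ContDiff ℝ (⊤ : ℕ∞) (Function.uncurry G)) (k : ℕ) :
    ContDiff ℝ (⊤ : ℕ∞) (Function.uncurry fun s => lap^[k] (G s)) := by
  have step : ∀ {G : ℝ → EuclideanSpace ℝ (Fin n) → ℝ} (i : Fin n),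
      ContDiff ℝ (⊤ : ℕ∞) (Function.uncurry G) →
      ContDiff ℝ (⊤ : ℕ∞) (Function.uncurry fun s y =>
        fderiv ℝ (G s) y (EuclideanSpace.single i 1)) := by
    intro G i hG
    have hG' : ContDiff ℝ (⊤ : ℕ∞) (Function.uncurry fun (p : ℝ × EuclideanSpace ℝ (Fin n)) y =>
        G p.1 y) := hG.comp ((contDiff_fst.comp contDiff_fst).prodMk contDiff_snd)
    exact (ContDiff.fderiv hG' contDiff_snd (by simp)).clm_apply contDiff_const
  induction k with
  | zero => exact hG
  | succ k ih =>
    simp only [Function.iterate_succ_apply']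
    exact ContDiff.sum (s := Finset.univ)
      (f := fun i => Function.uncurry fun s y => fderiv ℝ (fun z => fderiv ℝ (lap^[k] (G s)) z
        (EuclideanSpace.single i 1)) y (EuclideanSpace.single i 1))
      fun i _ => step i (step i ih)

end Laplacian

section TruncatedLog

variable {n : ℕ}

/-- The coefficient `G` in `∇ (Δ^k log ‖z‖) = G ‖z‖^(-2k-2) z`. -/
noncomputable def lapLogCoeff (n : ℕ) : ℕ → ℝ
  | 0 => 1
  | k + 1 => lapLogCoeff n k * (n - 2 * (k + 1)) * (-(2 * (k + 1)))

lemma hasFDerivAt_inv_norm_sq_pow (k : ℕ) {z : EuclideanSpace ℝ (Fin n)} (hz : z ≠ 0) :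
    HasFDerivAt (fun y : EuclideanSpace ℝ (Fin n) => (‖y‖ ^ 2)⁻¹ ^ (k + 1))
      ((-(2 * (k + 1)) * (‖z‖ ^ 2)⁻¹ ^ (k + 2)) • innerSL ℝ z) z := by
  have h0 : ‖z‖ ^ 2 ≠ 0 := by simpa using hz
  have h1 := (hasStrictFDerivAt_norm_sq z).hasFDerivAt
  have h2 := ((hasDerivAt_inv h0).pow (k + 1)).comp_hasFDerivAt z h1
  refine h2.congr_fderiv ?_
  ext v
  simp only [smul_apply, innerSL_apply_apply, smul_eq_mul, nsmul_eq_mul,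
    Nat.add_sub_cancel, Nat.cast_add, Nat.cast_one, Nat.cast_ofNat]
  ring

lemma hasFDerivAt_log_norm {z : EuclideanSpace ℝ (Fin n)} (hz : z ≠ 0) :
    HasFDerivAt (fun y : EuclideanSpace ℝ (Fin n) => Real.log ‖y‖)
      ((‖z‖ ^ 2)⁻¹ • innerSL ℝ z) z := by
  have h0 : ‖z‖ ^ 2 ≠ 0 := by simpa using hz
  have h1 := ((hasStrictFDerivAt_norm_sq z).hasFDerivAt.log h0).const_mul (1 / 2 : ℝ)
  have h2 : (fun y : EuclideanSpace ℝ (Fin n) => Real.log ‖y‖)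
      = fun y => 1 / 2 * Real.log (‖y‖ ^ 2) := by
    funext y
    rw [Real.log_pow]
    push_cast
    ring
  rw [h2]
  refine h1.congr_fderiv ?_
  ext v
  simp only [smul_apply, innerSL_apply_apply, smul_eq_mul, nsmul_eq_mul,
    Nat.cast_ofNat]
  ring

lemma lap_of_hasFDerivAt_radial {u : EuclideanSpace ℝ (Fin n) → ℝ} {G : ℝ} {k : ℕ}
    (hu : ∀ z ≠ 0, HasFDerivAt u ((G * (‖z‖ ^ 2)⁻¹ ^ (k + 1)) • innerSL ℝ z) z)
    {z : EuclideanSpace ℝ (Fin n)} (hz : z ≠ 0) :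
    lap u z = G * (n - 2 * (k + 1)) * (‖z‖ ^ 2)⁻¹ ^ (k + 1) := by
  have h0 : ‖z‖ ^ 2 ≠ 0 := by simpa using hz
  have key : ∀ i : Fin n, fderiv ℝ (fun y => fderiv ℝ u y (EuclideanSpace.single i 1)) z
      (EuclideanSpace.single i 1)
      = G * ((‖z‖ ^ 2)⁻¹ ^ (k + 1) - 2 * (k + 1) * (‖z‖ ^ 2)⁻¹ ^ (k + 2) * z i ^ 2) := by
    intro i
    have e : (fun y => fderiv ℝ u y (EuclideanSpace.single i 1))
        =ᶠ[𝓝 z] fun y => G * ((‖y‖ ^ 2)⁻¹ ^ (k + 1) * EuclideanSpace.proj (𝕜 := ℝ) i y) := by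
      filter_upwards [isOpen_ne.mem_nhds hz] with y hy
      rw [(hu y hy).fderiv]
      simp [EuclideanSpace.inner_single_right]
      ring
    rw [e.fderiv_eq]
    have d := ((hasFDerivAt_inv_norm_sq_pow k hz).mul
      (EuclideanSpace.proj (𝕜 := ℝ) i : EuclideanSpace ℝ (Fin n) →L[ℝ] ℝ).hasFDerivAt).const_mul G
    have d' : fderiv ℝ (fun y : EuclideanSpace ℝ (Fin n) =>
        G * ((‖y‖ ^ 2)⁻¹ ^ (k + 1) * EuclideanSpace.proj (𝕜 := ℝ) i y)) z = _ := d.fderiv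
    rw [d']
    simp [EuclideanSpace.inner_single_right]
    ring
  simp only [lap, key]
  rw [← Finset.mul_sum, Finset.sum_sub_distrib, ← Finset.mul_sum,
    ← EuclideanSpace.real_norm_sq_eq]
  simp only [Finset.sum_const, Finset.card_univ, Fintype.card_fin, nsmul_eq_mul]
  have e : (‖z‖ ^ 2)⁻¹ ^ (k + 2) * ‖z‖ ^ 2 = (‖z‖ ^ 2)⁻¹ ^ (k + 1) := by
    rw [pow_succ _ (k + 1), mul_assoc, inv_mul_cancel₀ h0, mul_one]
  linear_combination (-2 * G * (k + 1)) * e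

lemma lap_inv_norm_sq_hasFDerivAt {u : EuclideanSpace ℝ (Fin n) → ℝ} {G : ℝ} {k : ℕ}
    (hu : ∀ z ≠ 0, HasFDerivAt u ((G * (‖z‖ ^ 2)⁻¹ ^ (k + 1)) • innerSL ℝ z) z)
    {z : EuclideanSpace ℝ (Fin n)} (hz : z ≠ 0) :
    HasFDerivAt (lap u) ((G * (n - 2 * (k + 1)) * (-(2 * (k + 1)))
      * (‖z‖ ^ 2)⁻¹ ^ (k + 1 + 1)) • innerSL ℝ z) z := by
  have e : lap u =ᶠ[𝓝 z] fun y => G * (n - 2 * (k + 1)) * (‖y‖ ^ 2)⁻¹ ^ (k + 1) := by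
    filter_upwards [isOpen_ne.mem_nhds hz] with y hy using lap_of_hasFDerivAt_radial hu hy
  refine HasFDerivAt.congr_of_eventuallyEq ?_ e
  refine ((hasFDerivAt_inv_norm_sq_pow k hz).const_mul _).congr_fderiv ?_
  rw [smul_smul]
  congr 1
  ring

lemma hasFDerivAt_iterate_lap_log_norm (k : ℕ) : ∀ z : EuclideanSpace ℝ (Fin n), z ≠ 0 →
    HasFDerivAt (lap^[k] fun y : EuclideanSpace ℝ (Fin n) => Real.log ‖y‖)
      ((lapLogCoeff n k * (‖z‖ ^ 2)⁻¹ ^ (k + 1)) • innerSL ℝ z) z := by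
  induction k with
  | zero =>
    intro z hz
    simpa [lapLogCoeff] using hasFDerivAt_log_norm hz
  | succ k ih =>
    intro z hz
    rw [Function.iterate_succ_apply']
    simpa [lapLogCoeff] using lap_inv_norm_sq_hasFDerivAt ih hz

lemma iterate_lap_log_norm_eq_zero {m : ℕ} (hm : 1 ≤ m) {z : EuclideanSpace ℝ (Fin (2 * m))}
    (hz : z ≠ 0) :
    lap^[m] (fun y : EuclideanSpace ℝ (Fin (2 * m)) => Real.log ‖y‖) z = 0 := by
  obtain ⟨k, rfl⟩ := Nat.exists_eq_add_of_le' hm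
  rw [Function.iterate_succ_apply',
    lap_of_hasFDerivAt_radial (hasFDerivAt_iterate_lap_log_norm k) hz]
  push_cast
  ring

lemma lapLogCoeff_ne_zero {m k : ℕ} (hk : k < m) : lapLogCoeff (2 * m) k ≠ 0 := by
  induction k with
  | zero => simp [lapLogCoeff]
  | succ k ih =>
    have h1 : ((k : ℝ) + 1) < m := by exact_mod_cast hk
    refine mul_ne_zero (mul_ne_zero (ih (by omega)) ?_) ?_
    · push_cast
      intro h
      linarith
    · have : (0 : ℝ) ≤ k := k.cast_nonneg
      intro h
      linarith

/-- A smooth radial cutoff on `ℝ^n`. -/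
noncomputable def radialCutoff (z : EuclideanSpace ℝ (Fin n)) : ℝ :=
  Real.smoothTransition (2 - 4 * ‖z‖ ^ 2)

lemma contDiff_radialCutoff : ContDiff ℝ (⊤ : ℕ∞) (radialCutoff (n := n)) :=
  Real.smoothTransition.contDiff.comp (contDiff_const.sub (contDiff_const.mul (contDiff_norm_sq ℝ)))

lemma radialCutoff_eq_one {z : EuclideanSpace ℝ (Fin n)} (hz : ‖z‖ ≤ 1 / 2) :
    radialCutoff z = 1 :=
  Real.smoothTransition.one_of_one_le (by nlinarith [norm_nonneg z])

lemma radialCutoff_eq_zero {z : EuclideanSpace ℝ (Fin n)} (hz : 1 ≤ ‖z‖) :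
    radialCutoff z = 0 :=
  Real.smoothTransition.zero_of_nonpos (by nlinarith [norm_nonneg z])

/-- The logarithm of the norm, smoothly truncated near the origin. -/
noncomputable def truncLog (z : EuclideanSpace ℝ (Fin n)) : ℝ :=
  (1 - radialCutoff z) * Real.log ‖z‖

lemma truncLog_eq_log {z : EuclideanSpace ℝ (Fin n)} (hz : 1 ≤ ‖z‖) :
    truncLog z = Real.log ‖z‖ := by
  rw [truncLog, radialCutoff_eq_zero hz]
  ring

lemma truncLog_eq_zero {z : EuclideanSpace ℝ (Fin n)} (hz : ‖z‖ ≤ 1 / 2) : truncLog z = 0 := by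
  rw [truncLog, radialCutoff_eq_one hz]
  ring

lemma truncLog_eventuallyEq_zero {z : EuclideanSpace ℝ (Fin n)} (hz : ‖z‖ < 1 / 2) :
    truncLog =ᶠ[𝓝 z] fun _ => 0 := by
  filter_upwards [continuous_norm.continuousAt.eventually_lt continuousAt_const hz] with y hy
    using truncLog_eq_zero hy.le

lemma truncLog_eventuallyEq_log {z : EuclideanSpace ℝ (Fin n)} (hz : 1 < ‖z‖) :
    truncLog =ᶠ[𝓝 z] fun y => Real.log ‖y‖ := by
  filter_upwards [continuousAt_const.eventually_lt continuous_norm.continuousAt hz] with y hy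
    using truncLog_eq_log hy.le

lemma contDiff_truncLog : ContDiff ℝ (⊤ : ℕ∞) (truncLog (n := n)) := by
  rw [contDiff_iff_contDiffAt]
  intro z
  by_cases hz : z = 0
  · exact contDiffAt_const.congr_of_eventuallyEq
      (truncLog_eventuallyEq_zero (by rw [hz, norm_zero]; norm_num))
  · exact (contDiffAt_const.sub contDiff_radialCutoff.contDiffAt).mul
      ((contDiffAt_norm ℝ hz).log (by simpa using hz))

lemma iterate_lap_truncLog_support {m : ℕ} (hm : 1 ≤ m) {z : EuclideanSpace ℝ (Fin (2 * m))}
    (hz : lap^[m] truncLog z ≠ 0) : 1 / 2 ≤ ‖z‖ ∧ ‖z‖ ≤ 1 := by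
  constructor
  · by_contra! h
    rw [(iterate_lap_congr (truncLog_eventuallyEq_zero h) m).eq_of_nhds, iterate_lap_zero] at hz
    exact hz rfl
  · by_contra! h
    rw [(iterate_lap_congr (truncLog_eventuallyEq_log h) m).eq_of_nhds,
      iterate_lap_log_norm_eq_zero hm (norm_pos_iff.mp (by linarith))] at hz
    exact hz rfl

lemma hasCompactSupport_iterate_lap_truncLog {m : ℕ} (hm : 1 ≤ m) :
    HasCompactSupport (lap^[m] (truncLog (n := 2 * m))) := by
  refine HasCompactSupport.intro' (isCompact_closedBall 0 1) isClosed_closedBall fun z hz => ?_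
  by_contra h
  exact hz (mem_closedBall_zero_iff.mpr (iterate_lap_truncLog_support hm h).2)

lemma exists_deriv_smoothTransition_pos :
    ∃ t ∈ Set.Ioo (0 : ℝ) 1, 0 < deriv Real.smoothTransition t := by
  obtain ⟨t, ht, h⟩ := exists_deriv_eq_slope Real.smoothTransition zero_lt_one
    Real.smoothTransition.continuous.continuousOn
    ((Real.smoothTransition.contDiff (n := 1)).differentiable (by simp)).differentiableOn
  refine ⟨t, ht, ?_⟩
  rw [h, Real.smoothTransition.one, Real.smoothTransition.zero]
  norm_num

lemma integral_iterate_lap_truncLog_ne_zero {m : ℕ} (hm : 1 ≤ m) :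
    ∫ z : EuclideanSpace ℝ (Fin (2 * m)), lap^[m] truncLog z ≠ 0 := by
  obtain ⟨k, rfl⟩ := Nat.exists_eq_add_of_le' hm
  set σ := Real.smoothTransition
  set φ : EuclideanSpace ℝ (Fin (2 * (k + 1))) → ℝ := fun z => σ (5 - ‖z‖ ^ 2)
  set v : EuclideanSpace ℝ (Fin (2 * (k + 1))) → ℝ := lap^[k] truncLog
  set G := lapLogCoeff (2 * (k + 1)) k
  have hG0 : G ≠ 0 := lapLogCoeff_ne_zero k.lt_succ_self
  have hσd : ∀ t, HasDerivAt σ (deriv σ t) t := fun t =>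
    ((Real.smoothTransition.contDiff (n := 1)).differentiable (by simp) t).hasDerivAt
  have hφs : ContDiff ℝ (⊤ : ℕ∞) φ :=
    Real.smoothTransition.contDiff.comp (contDiff_const.sub (contDiff_norm_sq ℝ))
  have hφc : HasCompactSupport φ := by
    refine HasCompactSupport.intro' (isCompact_closedBall 0 3) isClosed_closedBall fun z hz => ?_
    rw [mem_closedBall_zero_iff, not_le] at hz
    exact Real.smoothTransition.zero_of_nonpos (by nlinarith)
  have hvs : ContDiff ℝ (⊤ : ℕ∞) v := contDiff_iterate_lap contDiff_truncLog k
  have hφd : ∀ z w, fderiv ℝ φ z w = -2 * deriv σ (5 - ‖z‖ ^ 2) * inner ℝ z w := by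
    intro z w
    have := (hσd (5 - ‖z‖ ^ 2)).comp_hasFDerivAt z
      ((hasStrictFDerivAt_norm_sq z).hasFDerivAt.const_sub 5)
    have this' : fderiv ℝ φ z = _ := this.fderiv
    rw [this']
    simp
    ring
  set D : EuclideanSpace ℝ (Fin (2 * (k + 1))) → ℝ := fun z =>
    2 * deriv σ (5 - ‖z‖ ^ 2) * (‖z‖ ^ 2)⁻¹ ^ (k + 1) * ‖z‖ ^ 2 with hD
  have hpt : ∀ z, -∑ i, fderiv ℝ v z (EuclideanSpace.single i 1)
      * fderiv ℝ φ z (EuclideanSpace.single i 1) = G * D z := by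
    intro z
    simp only [hφd, hD]
    rcases le_or_gt ‖z‖ 1 with hz | hz
    · have h0 : deriv σ (5 - ‖z‖ ^ 2) = 0 := by
        have : σ =ᶠ[𝓝 (5 - ‖z‖ ^ 2)] fun _ => 1 := by
          filter_upwards [lt_mem_nhds (show (1 : ℝ) < 5 - ‖z‖ ^ 2 by nlinarith [norm_nonneg z])]
            with t ht using Real.smoothTransition.one_of_one_le ht.le
        rw [this.deriv_eq, deriv_const]
      simp [h0]
    · have hz0 : z ≠ 0 := norm_pos_iff.mp (by linarith)
      have h1 := (iterate_lap_congr (truncLog_eventuallyEq_log hz) k).fderiv_eq (𝕜 := ℝ)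
      have h2 : fderiv ℝ v z = _ := h1.trans (hasFDerivAt_iterate_lap_log_norm k z hz0).fderiv
      rw [h2, EuclideanSpace.real_norm_sq_eq, Finset.mul_sum, Finset.mul_sum,
        ← Finset.sum_neg_distrib]
      refine Finset.sum_congr rfl fun i _ => ?_
      simp [EuclideanSpace.inner_single_right]
      ring
  have hintg : ∀ i : Fin (2 * (k + 1)), Continuous fun z => fderiv ℝ v z (EuclideanSpace.single i 1)
      * fderiv ℝ φ z (EuclideanSpace.single i 1) := fun i =>
    (contDiffOn_univ.mp (contDiffOn_fderiv_single isOpen_univ hvs.contDiffOn i)).continuous.mul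
      (contDiffOn_univ.mp (contDiffOn_fderiv_single isOpen_univ hφs.contDiffOn i)).continuous
  have hφc' : ∀ i : Fin (2 * (k + 1)),
      HasCompactSupport fun z => fderiv ℝ φ z (EuclideanSpace.single i 1) := fun i =>
    hφc.mono' ((subset_tsupport _).trans (tsupport_fderiv_apply_subset ℝ _))
  have hflux : ∫ z : EuclideanSpace ℝ (Fin (2 * (k + 1))), lap^[k + 1] truncLog z
      = G * ∫ z, D z := by
    have h1 : ∀ z : EuclideanSpace ℝ (Fin (2 * (k + 1))), lap^[k + 1] truncLog z
        = lap v z * φ z := by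
      intro z
      rw [Function.iterate_succ_apply']
      by_cases h0 : lap v z = 0
      · rw [h0, zero_mul]
      · have := (iterate_lap_truncLog_support hm (z := z)
          (by rwa [Function.iterate_succ_apply'])).2
        have h2 : φ z = 1 := Real.smoothTransition.one_of_one_le (by nlinarith [norm_nonneg z])
        rw [h2, mul_one]
    simp only [h1]
    rw [← integral_mul_lap isOpen_univ hvs.contDiffOn hφs hφc (subset_univ _),
      integral_mul_lap_eq_neg isOpen_univ hvs.contDiffOn hφs hφc (subset_univ _),
      ← integral_finsetSum, ← integral_neg, ← integral_const_mul]
    · exact integral_congr_ae (ae_of_all _ hpt)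
    · exact fun i _ => (hintg i).integrable_of_hasCompactSupport (hφc' i).mul_left
  have hDeq : D = fun z => G⁻¹ * -∑ i, fderiv ℝ v z (EuclideanSpace.single i 1)
      * fderiv ℝ φ z (EuclideanSpace.single i 1) := by
    funext z
    rw [hpt z, inv_mul_cancel_left₀ hG0]
  have hDc : Continuous D := by
    rw [hDeq]
    exact continuous_const.mul (continuous_finsetSum _ fun i _ => hintg i).neg
  have hDs : HasCompactSupport D := by
    refine HasCompactSupport.intro' (isCompact_closedBall 0 3) isClosed_closedBall fun z hz => ?_
    rw [mem_closedBall_zero_iff, not_le] at hz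
    have h0 : deriv σ (5 - ‖z‖ ^ 2) = 0 := by
      have : σ =ᶠ[𝓝 (5 - ‖z‖ ^ 2)] fun _ => 0 := by
        filter_upwards [gt_mem_nhds (show 5 - ‖z‖ ^ 2 < (0 : ℝ) by nlinarith)]
          with t ht using Real.smoothTransition.zero_of_nonpos ht.le
      rw [this.deriv_eq, deriv_const]
    simp [hD, h0]
  have hD0 : 0 ≤ D := by
    intro z
    have : 0 ≤ deriv σ (5 - ‖z‖ ^ 2) := Real.smoothTransition.monotone.deriv_nonneg
    simp only [hD, Pi.zero_apply]
    positivity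
  obtain ⟨t, ht, htpos⟩ := exists_deriv_smoothTransition_pos
  have hz1 : ‖(EuclideanSpace.single (0 : Fin (2 * (k + 1))) (√(5 - t)) : EuclideanSpace ℝ _)‖ ^ 2
      = 5 - t := by
    rw [PiLp.norm_single, Real.norm_eq_abs, sq_abs, Real.sq_sqrt (by linarith [ht.2])]
  have hDne : D (EuclideanSpace.single (0 : Fin (2 * (k + 1))) (√(5 - t))) ≠ 0 := by
    have : (0 : ℝ) < 5 - t := by linarith [ht.2]
    simp only [hD, hz1, sub_sub_cancel]
    positivity
  rw [hflux]
  exact mul_ne_zero hG0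
    (hDc.integral_pos_of_hasCompactSupport_nonneg_nonzero hDs hD0 hDne).ne'

end TruncatedLog

section Moments

/-- The radial cutoff rescaled to the ball of radius `s` about `p`. -/
noncomputable def cutoffAt {n : ℕ} (p : EuclideanSpace ℝ (Fin n)) (s : ℝ)
    (y : EuclideanSpace ℝ (Fin n)) : ℝ :=
  radialCutoff (s⁻¹ • (y - p))

lemma norm_inv_smul_sub {n : ℕ} {s : ℝ} (hs : 0 < s) (y p : EuclideanSpace ℝ (Fin n)) :
    ‖s⁻¹ • (y - p)‖ = ‖y - p‖ / s := by
  rw [norm_smul, norm_inv, Real.norm_of_nonneg hs.le, div_eq_inv_mul]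

variable {n : ℕ} {p y : EuclideanSpace ℝ (Fin n)} {s : ℝ}

lemma contDiff_cutoffAt (p : EuclideanSpace ℝ (Fin n)) (s : ℝ) :
    ContDiff ℝ (⊤ : ℕ∞) (cutoffAt p s) :=
  contDiff_radialCutoff.comp ((contDiff_id.sub contDiff_const).const_smul s⁻¹)

lemma cutoffAt_eq_zero (hs : 0 < s) (hy : s ≤ ‖y - p‖) : cutoffAt p s y = 0 := by
  refine radialCutoff_eq_zero ?_
  rwa [norm_inv_smul_sub hs, le_div_iff₀ hs, one_mul]

lemma cutoffAt_eventuallyEq_one (hs : 0 < s) (hy : ‖y - p‖ < s / 2) :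
    cutoffAt p s =ᶠ[𝓝 y] fun _ => 1 := by
  have hc : ContinuousAt (fun y => ‖y - p‖) y := by fun_prop
  filter_upwards [hc.eventually_lt continuousAt_const hy] with w hw
  refine radialCutoff_eq_one ?_
  rw [norm_inv_smul_sub hs, div_le_iff₀ hs]
  linarith

lemma cutoffAt_eventuallyEq_zero (hs : 0 < s) (hy : s < ‖y - p‖) :
    cutoffAt p s =ᶠ[𝓝 y] fun _ => 0 := by
  have hc : ContinuousAt (fun y => ‖y - p‖) y := by fun_prop
  filter_upwards [continuousAt_const.eventually_lt hc hy] with w hw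
    using cutoffAt_eq_zero hs hw.le

lemma hasCompactSupport_cutoffAt (p : EuclideanSpace ℝ (Fin n)) (hs : 0 < s) :
    HasCompactSupport (cutoffAt p s) := by
  refine HasCompactSupport.intro' (isCompact_closedBall p s) isClosed_closedBall fun z hz => ?_
  rw [mem_closedBall, not_le, dist_eq_norm] at hz
  exact cutoffAt_eq_zero hs hz.le

lemma notMem_tsupport_iterate_lap {f : EuclideanSpace ℝ (Fin n) → ℝ} {k : ℕ} (hk : 1 ≤ k) {c : ℝ}
    (hf : f =ᶠ[𝓝 p] fun _ => c) : p ∉ tsupport (lap^[k] f) := by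
  rw [notMem_tsupport_iff_eventuallyEq]
  have := iterate_lap_congr hf k
  rwa [iterate_lap_const hk] at this

lemma iterate_lap_sub_const {f : EuclideanSpace ℝ (Fin n) → ℝ} (hf : ContDiff ℝ (⊤ : ℕ∞) f)
    {k : ℕ} (hk : 1 ≤ k) (c : ℝ) : lap^[k] (fun y => f y - c) = lap^[k] f := by
  rw [iterate_lap_sub hf contDiff_const, iterate_lap_const hk]
  simp

lemma integral_mul_iterate_lap_eq_sum {S : Finset (EuclideanSpace ℝ (Fin n))}
    {h Q : EuclideanSpace ℝ (Fin n) → ℝ} {k : ℕ} (hk : 1 ≤ k)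
    (hsm : ContDiffOn ℝ (⊤ : ℕ∞) h (S : Set (EuclideanSpace ℝ (Fin n)))ᶜ)
    (hph : ∀ x ∉ S, lap^[k] h x = 0)
    (hQ : ContDiff ℝ (⊤ : ℕ∞) Q) (hQc : HasCompactSupport Q)
    (hQS : ∀ p ∈ S, p ∉ tsupport (lap^[k] Q))
    {s s₀ : ℝ} (hs : 0 < s) (hss : s ≤ s₀)
    (hsep : ∀ p ∈ S, ∀ q ∈ S, p ≠ q → 2 * s₀ ≤ ‖p - q‖) :
    ∫ y, h y * lap^[k] Q y =
      (∑ p ∈ S, ∫ y, h y * lap^[k] (fun w => cutoffAt p s w * (Q w - Q p)) y)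
      + ∑ p ∈ S, Q p * ∫ y, h y * lap^[k] (cutoffAt p s₀) y := by
  have hs₀ : 0 < s₀ := hs.trans_le hss
  have hU : IsOpen (S : Set (EuclideanSpace ℝ (Fin n)))ᶜ := S.finite_toSet.isClosed.isOpen_compl
  set A : EuclideanSpace ℝ (Fin n) → EuclideanSpace ℝ (Fin n) → ℝ :=
    fun p w => cutoffAt p s w * (Q w - Q p) with hA
  set B : EuclideanSpace ℝ (Fin n) → EuclideanSpace ℝ (Fin n) → ℝ :=
    fun p w => Q p * cutoffAt p s₀ w with hB
  have hAs : ∀ p, ContDiff ℝ (⊤ : ℕ∞) (A p) := fun p =>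
    (contDiff_cutoffAt p s).mul (hQ.sub contDiff_const)
  have hBs : ∀ p, ContDiff ℝ (⊤ : ℕ∞) (B p) := fun p =>
    contDiff_const.mul (contDiff_cutoffAt p s₀)
  have hAc : ∀ p, HasCompactSupport (A p) := fun p =>
    (hasCompactSupport_cutoffAt p hs).mul_right
  have hBc : ∀ p, HasCompactSupport (B p) := fun p =>
    (hasCompactSupport_cutoffAt p hs₀).mul_left
  have hAq : ∀ p ∈ S, ∀ q ∈ S, q ≠ p → A q =ᶠ[𝓝 p] fun _ => 0 := by
    intro p hp q hq hqp
    have := hsep p hp q hq hqp.symm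
    filter_upwards [cutoffAt_eventuallyEq_zero hs (show s < ‖p - q‖ by linarith)] with w hw
    simp [hA, hw]
  have hBq : ∀ p ∈ S, ∀ q ∈ S, q ≠ p → B q =ᶠ[𝓝 p] fun _ => 0 := by
    intro p hp q hq hqp
    have := hsep p hp q hq hqp.symm
    filter_upwards [cutoffAt_eventuallyEq_zero hs₀ (show s₀ < ‖p - q‖ by linarith)] with w hw
    simp [hB, hw]
  have hAp : ∀ p, A p =ᶠ[𝓝 p] fun w => Q w - Q p := by
    intro p
    filter_upwards [cutoffAt_eventuallyEq_one (y := p) (p := p) hs (by simpa using hs)] with w hw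
    simp [hA, hw]
  have hBp : ∀ p, B p =ᶠ[𝓝 p] fun _ => Q p := by
    intro p
    filter_upwards [cutoffAt_eventuallyEq_one (y := p) (p := p) hs₀ (by simpa using hs₀)] with w hw
    simp [hB, hw]
  have hAS : ∀ q ∈ S, tsupport (lap^[k] (A q)) ⊆ (S : Set (EuclideanSpace ℝ (Fin n)))ᶜ := by
    intro q hq p hp hpS
    by_cases hqp : q = p
    · subst hqp
      refine absurd hp ?_
      have h1 := iterate_lap_congr (hAp q) k
      rw [iterate_lap_sub_const hQ hk] at h1
      exact notMem_tsupport_iff_eventuallyEq.mpr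
        (h1.trans (notMem_tsupport_iff_eventuallyEq.mp (hQS q hq)))
    · exact notMem_tsupport_iterate_lap hk (hAq p hpS q hq hqp) hp
  have hBS : ∀ q ∈ S, tsupport (lap^[k] (B q)) ⊆ (S : Set (EuclideanSpace ℝ (Fin n)))ᶜ := by
    intro q hq p hp hpS
    by_cases hqp : q = p
    · subst hqp
      exact notMem_tsupport_iterate_lap hk (hBp q) hp
    · exact notMem_tsupport_iterate_lap hk (hBq p hpS q hq hqp) hp
  have hintg : ∀ {g : EuclideanSpace ℝ (Fin n) → ℝ}, ContDiff ℝ (⊤ : ℕ∞) g → HasCompactSupport g →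
      tsupport (lap^[k] g) ⊆ (S : Set (EuclideanSpace ℝ (Fin n)))ᶜ →
      Integrable fun y => h y * lap^[k] g y := fun hg hgc hgS =>
    integrable_mul_of_tsupport_subset hU hsm.continuousOn (contDiff_iterate_lap hg k).continuous
      (hgc.iterate_lap k) hgS
  have hAsum : ContDiff ℝ (⊤ : ℕ∞) fun y => ∑ p ∈ S, A p y := ContDiff.sum fun p _ => hAs p
  have hBsum : ContDiff ℝ (⊤ : ℕ∞) fun y => ∑ p ∈ S, B p y := ContDiff.sum fun p _ => hBs p
  set Φ : EuclideanSpace ℝ (Fin n) → ℝ := fun y => (Q y - ∑ p ∈ S, A p y) - ∑ p ∈ S, B p y with hΦ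
  have hΦs : ContDiff ℝ (⊤ : ℕ∞) Φ := (hQ.sub hAsum).sub hBsum
  have hsumc : ∀ {F : EuclideanSpace ℝ (Fin n) → EuclideanSpace ℝ (Fin n) → ℝ},
      (∀ p, HasCompactSupport (F p)) → HasCompactSupport fun y => ∑ p ∈ S, F p y := by
    intro F hF
    refine HasCompactSupport.intro (S.isCompact_biUnion fun p _ => (hF p).isCompact) ?_
    intro x hx
    refine Finset.sum_eq_zero fun p hp => image_eq_zero_of_notMem_tsupport fun hxp => hx ?_
    exact Set.mem_biUnion (show p ∈ (S : Set _) from hp) hxp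
  have hΦc : HasCompactSupport Φ := (hQc.sub (hsumc hAc)).sub (hsumc hBc)
  have hΦS : tsupport Φ ⊆ (S : Set (EuclideanSpace ℝ (Fin n)))ᶜ := by
    intro p hp hpS
    refine notMem_tsupport_iff_eventuallyEq.mpr ?_ hp
    have hAall : ∀ᶠ w in 𝓝 p, ∀ q ∈ S, q ≠ p → A q w = 0 := by
      rw [Filter.eventually_all_finset]
      intro q hq
      by_cases hqp : q = p
      · simp [hqp]
      · filter_upwards [hAq p hpS q hq hqp] with w hw _ using hw
    have hBall : ∀ᶠ w in 𝓝 p, ∀ q ∈ S, q ≠ p → B q w = 0 := by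
      rw [Filter.eventually_all_finset]
      intro q hq
      by_cases hqp : q = p
      · simp [hqp]
      · filter_upwards [hBq p hpS q hq hqp] with w hw _ using hw
    filter_upwards [hAall, hBall, hAp p, hBp p] with w h1 h2 h3 h4
    simp only [hΦ, Pi.zero_apply]
    rw [Finset.sum_eq_single_of_mem p hpS h1, Finset.sum_eq_single_of_mem p hpS h2, h3, h4]
    ring
  have hzero : ∫ y, h y * lap^[k] Φ y = 0 := by
    rw [integral_mul_iterate_lap hU hsm hΦs hΦc hΦS]
    refine integral_eq_zero_of_ae (ae_of_all _ fun y => ?_)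
    by_cases hy : y ∈ tsupport Φ
    · simp [hph y (hΦS hy)]
    · simp [image_eq_zero_of_notMem_tsupport hy]
  have hexp : ∀ y, h y * lap^[k] Φ y = (h y * lap^[k] Q y - ∑ p ∈ S, h y * lap^[k] (A p) y)
      - ∑ p ∈ S, h y * lap^[k] (B p) y := by
    intro y
    rw [hΦ, iterate_lap_sub (hQ.sub hAsum) hBsum, iterate_lap_sub hQ hAsum,
      iterate_lap_sum S A hAs, iterate_lap_sum S B hBs, ← Finset.mul_sum, ← Finset.mul_sum]
    ring
  have hQi := hintg hQ hQc fun p hp hpS => hQS p hpS hp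
  have hAi : ∀ p ∈ S, Integrable fun y => h y * lap^[k] (A p) y := fun p hp =>
    hintg (hAs p) (hAc p) (hAS p hp)
  have hBi : ∀ p ∈ S, Integrable fun y => h y * lap^[k] (B p) y := fun p hp =>
    hintg (hBs p) (hBc p) (hBS p hp)
  have hBe : ∀ p, ∫ y, h y * lap^[k] (B p) y = Q p * ∫ y, h y * lap^[k] (cutoffAt p s₀) y := by
    intro p
    rw [← integral_const_mul, hB, iterate_lap_const_mul]
    congr 1
    funext y
    ring
  have hQAi : Integrable fun y => h y * lap^[k] Q y - ∑ p ∈ S, h y * lap^[k] (A p) y :=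
    hQi.sub (integrable_finsetSum _ hAi)
  simp only [hexp] at hzero
  rw [integral_sub hQAi (integrable_finsetSum _ hBi),
    integral_sub hQi (integrable_finsetSum _ hAi), integral_finsetSum _ hAi,
    integral_finsetSum _ hBi] at hzero
  simp only [hBe] at hzero
  linarith

lemma exists_log_bound_of_radial_bound {h : EuclideanSpace ℝ (Fin n) → ℝ} {s₀ C : ℝ} (hs₀ : 0 < s₀)
    (hd : ∀ y, 0 < ‖y - p‖ → ‖y - p‖ ≤ s₀ → DifferentiableAt ℝ h y)
    (hC : ∀ y, 0 < ‖y - p‖ → ‖y - p‖ ≤ s₀ → ‖y - p‖ * ‖fderiv ℝ h y‖ ≤ C) :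
    ∃ M, 0 ≤ M ∧ ∀ s, 0 < s → s ≤ s₀ → ∀ z : EuclideanSpace ℝ (Fin n), 1 / 2 ≤ ‖z‖ → ‖z‖ ≤ 1 →
      |h (p + s • z)| ≤ M + |C| * (Real.log s₀ - Real.log s) := by
  have hdist : ∀ s, 0 < s → ∀ z : EuclideanSpace ℝ (Fin n), ‖p + s • z - p‖ = s * ‖z‖ := by
    intro s hs z
    rw [add_sub_cancel_left, norm_smul, Real.norm_of_nonneg hs.le]
  have hK : IsCompact {z : EuclideanSpace ℝ (Fin n) | 1 / 2 ≤ ‖z‖ ∧ ‖z‖ ≤ 1} := by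
    refine (isCompact_closedBall (0 : EuclideanSpace ℝ (Fin n)) 1).of_isClosed_subset ?_ ?_
    · exact (isClosed_le continuous_const continuous_norm).inter
        (isClosed_le continuous_norm continuous_const)
    · exact fun z hz => mem_closedBall_zero_iff.mpr hz.2
  have hcont : ContinuousOn (fun z : EuclideanSpace ℝ (Fin n) => h (p + s₀ • z))
      {z | 1 / 2 ≤ ‖z‖ ∧ ‖z‖ ≤ 1} := by
    intro z hz
    refine ContinuousAt.continuousWithinAt ?_
    have : DifferentiableAt ℝ h (p + s₀ • z) := by
      refine hd _ ?_ ?_ <;> rw [hdist s₀ hs₀]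
      · exact mul_pos hs₀ (by linarith [hz.1])
      · nlinarith [hz.2]
    exact ContinuousAt.comp (f := fun z => p + s₀ • z) this.continuousAt (by fun_prop)
  obtain ⟨M, hM⟩ := hK.exists_bound_of_continuousOn hcont
  refine ⟨|M|, abs_nonneg M, fun s hs hss z hz1 hz2 => ?_⟩
  have hlog : Real.log s ≤ Real.log s₀ := Real.log_le_log hs hss
  set γ : ℝ → EuclideanSpace ℝ (Fin n) := fun t => p + Real.exp t • z with hγ
  have hγd : ∀ t, HasDerivAt γ (Real.exp t • z) t := fun t =>
    ((Real.hasDerivAt_exp t).smul_const z).const_add p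
  have hγn : ∀ t ∈ Set.Icc (Real.log s) (Real.log s₀), 0 < ‖γ t - p‖ ∧ ‖γ t - p‖ ≤ s₀ := by
    intro t ht
    rw [hγ, hdist _ (Real.exp_pos t)]
    refine ⟨mul_pos (Real.exp_pos t) (by linarith), ?_⟩
    have : Real.exp t ≤ s₀ := (Real.le_log_iff_exp_le hs₀).mp ht.2
    nlinarith [Real.exp_pos t]
  have hmv := (convex_Icc (Real.log s) (Real.log s₀)).norm_image_sub_le_of_norm_hasDerivWithin_le
    (f := fun t => h (γ t)) (f' := fun t => fderiv ℝ h (γ t) (Real.exp t • z)) (C := |C|)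
    (fun t ht => ((hd _ (hγn t ht).1 (hγn t ht).2).hasFDerivAt.comp_hasDerivAt t
      (hγd t)).hasDerivWithinAt)
    (fun t ht => by
      refine (ContinuousLinearMap.le_opNorm _ _).trans ?_
      have : ‖Real.exp t • z‖ = ‖γ t - p‖ := by simp [hγ]
      rw [this, mul_comm]
      exact (hC _ (hγn t ht).1 (hγn t ht).2).trans (le_abs_self C))
    (Set.right_mem_Icc.mpr hlog) (Set.left_mem_Icc.mpr hlog)
  have hM' := hM z ⟨hz1, hz2⟩
  simp only [hγ, Real.exp_log hs, Real.exp_log hs₀, Real.norm_eq_abs] at hmv hM'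
  rw [abs_sub_comm (Real.log s), abs_of_nonneg (by linarith : 0 ≤ Real.log s₀ - Real.log s)] at hmv
  have := abs_sub_abs_le_abs_sub (h (p + s • z)) (h (p + s₀ • z))
  linarith [le_abs_self M]

lemma tendsto_integral_mul_iterate_lap_cutoffAt {m : ℕ} (hm : 1 ≤ m)
    {p : EuclideanSpace ℝ (Fin (2 * m))} {h Q : EuclideanSpace ℝ (Fin (2 * m)) → ℝ}
    (hQ : ContDiff ℝ (⊤ : ℕ∞) Q) (hQp : p ∉ tsupport (lap^[m] Q)) {s₀ C : ℝ} (hs₀ : 0 < s₀)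
    (hd : ∀ y, 0 < ‖y - p‖ → ‖y - p‖ ≤ s₀ → DifferentiableAt ℝ h y)
    (hC : ∀ y, 0 < ‖y - p‖ → ‖y - p‖ ≤ s₀ → ‖y - p‖ * ‖fderiv ℝ h y‖ ≤ C) :
    Tendsto (fun s => ∫ y, h y * lap^[m] (fun w => cutoffAt p s w * (Q w - Q p)) y)
      (𝓝[>] 0) (𝓝 0) := by
  obtain ⟨M, hM0, hM⟩ := exists_log_bound_of_radial_bound hs₀ hd hC
  set G : ℝ → EuclideanSpace ℝ (Fin (2 * m)) → ℝ :=
    fun s z => radialCutoff z * (Q (p + s • z) - Q p) with hG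
  have hGs : ContDiff ℝ (⊤ : ℕ∞) (Function.uncurry G) :=
    (contDiff_radialCutoff.comp contDiff_snd).mul
      ((hQ.comp (contDiff_const.add (contDiff_fst.smul contDiff_snd))).sub contDiff_const)
  obtain ⟨K, hK⟩ := (contDiff_uncurry_iterate_lap hGs m).contDiffOn.exists_lipschitzOnWith
    (s := Set.Icc (0 : ℝ) 1 ×ˢ closedBall (0 : EuclideanSpace ℝ (Fin (2 * m))) 1) (by simp)
    ((convex_Icc 0 1).prod (convex_closedBall 0 1)) (isCompact_Icc.prod (isCompact_closedBall 0 1))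
  have hG0 : G 0 = fun _ => 0 := by
    funext z
    simp [hG]
  have hGK : ∀ s, 0 < s → s ≤ 1 → ∀ z ∈ closedBall (0 : EuclideanSpace ℝ (Fin (2 * m))) 1,
      |lap^[m] (G s) z| ≤ K * s := by
    intro s hs hs1 z hz
    have := hK.dist_le_mul (s, z) ⟨⟨hs.le, hs1⟩, hz⟩ (0, z) ⟨⟨le_rfl, zero_le_one⟩, hz⟩
    simpa [Function.uncurry, hG0, iterate_lap_zero, Prod.dist_eq, abs_of_pos hs, hs.le] using this
  have hresc : ∀ s, 0 < s → ∀ y, lap^[m] (fun w => cutoffAt p s w * (Q w - Q p)) y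
      = s⁻¹ ^ (2 * m) * lap^[m] (G s) (s⁻¹ • (y - p)) := by
    intro s hs y
    have e : (fun w => cutoffAt p s w * (Q w - Q p)) = fun w => G s (s⁻¹ • (w - p)) := by
      funext w
      simp [hG, cutoffAt, smul_smul, hs.ne']
    rw [e, iterate_lap_comp_affine]
  obtain ⟨ρ, hρ, hρQ⟩ := Metric.eventually_nhds_iff.mp
    (notMem_tsupport_iff_eventuallyEq.mp hQp)
  have hsupp : ∀ s, 0 < s → s < ρ → ∀ z, lap^[m] (G s) z ≠ 0 → 1 / 2 ≤ ‖z‖ ∧ ‖z‖ ≤ 1 := by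
    intro s hs hsρ z hz
    have hn : ‖p + s • z - p‖ = s * ‖z‖ := by
      rw [add_sub_cancel_left, norm_smul, Real.norm_of_nonneg hs.le]
    have hz' : lap^[m] (fun w => cutoffAt p s w * (Q w - Q p)) (p + s • z) ≠ 0 := by
      rw [hresc s hs, add_sub_cancel_left, smul_smul, inv_mul_cancel₀ hs.ne', one_smul]
      exact mul_ne_zero (by positivity) hz
    constructor
    · by_contra! hlt
      have e1 : (fun w => cutoffAt p s w * (Q w - Q p)) =ᶠ[𝓝 (p + s • z)] fun w => Q w - Q p := by
        filter_upwards [cutoffAt_eventuallyEq_one (y := p + s • z) (p := p) hs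
          (by rw [hn]; nlinarith)] with w hw
        rw [hw, one_mul]
      rw [(iterate_lap_congr e1 m).eq_of_nhds, iterate_lap_sub_const hQ hm] at hz'
      refine hz' (hρQ ?_)
      rw [dist_eq_norm, hn]
      nlinarith [norm_nonneg z]
    · by_contra! hlt
      have e1 : (fun w => cutoffAt p s w * (Q w - Q p)) =ᶠ[𝓝 (p + s • z)] fun _ => 0 := by
        filter_upwards [cutoffAt_eventuallyEq_zero (y := p + s • z) (p := p) hs
          (by rw [hn]; nlinarith)] with w hw
        rw [hw, zero_mul]
      rw [(iterate_lap_congr e1 m).eq_of_nhds, iterate_lap_zero] at hz'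
      exact hz' rfl
  set V : ℝ := (volume : Measure (EuclideanSpace ℝ (Fin (2 * m)))).real (closedBall 0 1)
  have hbound : ∀ᶠ s in 𝓝[>] (0 : ℝ),
      ‖∫ y, h y * lap^[m] (fun w => cutoffAt p s w * (Q w - Q p)) y‖
        ≤ K * ((M + |C| * Real.log s₀) * s - |C| * (s * Real.log s)) * V := by
    have hlt : ∀ {a : ℝ}, 0 < a → ∀ᶠ s in 𝓝[>] (0 : ℝ), s < a := fun ha =>
      mem_nhdsWithin_of_mem_nhds (gt_mem_nhds ha)
    filter_upwards [self_mem_nhdsWithin, hlt zero_lt_one, hlt hs₀, hlt hρ] with s hs hs1 hss hsρ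
    rw [Set.mem_Ioi] at hs
    simp only [hresc s hs]
    rw [integral_comp_affine h (lap^[m] (G s)) (inv_pos.mpr hs) p, inv_inv,
      ← setIntegral_eq_integral_of_forall_compl_eq_zero
        (s := closedBall (0 : EuclideanSpace ℝ (Fin (2 * m))) 1)]
    · refine norm_setIntegral_le_of_norm_le_const measure_closedBall_lt_top fun z hz => ?_
      have hnn : 0 ≤ M + |C| * (Real.log s₀ - Real.log s) :=
        add_nonneg hM0 (mul_nonneg (abs_nonneg C) (sub_nonneg.mpr (Real.log_le_log hs hss.le)))
      have heq : K * ((M + |C| * Real.log s₀) * s - |C| * (s * Real.log s))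
          = (M + |C| * (Real.log s₀ - Real.log s)) * (K * s) := by ring
      rw [heq, norm_mul, Real.norm_eq_abs, Real.norm_eq_abs]
      by_cases h0 : lap^[m] (G s) z = 0
      · rw [h0, abs_zero, mul_zero]
        positivity
      · obtain ⟨h1, h2⟩ := hsupp s hs hsρ z h0
        exact mul_le_mul (hM s hs hss.le z h1 h2) (hGK s hs hs1.le z hz) (abs_nonneg _) hnn
    · intro z hz
      by_contra h0
      exact hz (mem_closedBall_zero_iff.mpr
        (hsupp s hs hsρ z (right_ne_zero_of_mul h0)).2)
  refine squeeze_zero_norm' hbound ?_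
  have hcont : Continuous fun s : ℝ =>
      K * ((M + |C| * Real.log s₀) * s - |C| * (s * Real.log s)) * V := by
    have := Real.continuous_mul_log
    fun_prop
  have := (hcont.tendsto 0).mono_left (nhdsWithin_le_nhds (s := Set.Ioi 0))
  simpa using this

end Moments

section Classification

lemma tsupport_iterate_lap_truncLog_subset {m : ℕ} (hm : 1 ≤ m) :
    tsupport (lap^[m] (truncLog (n := 2 * m))) ⊆ {z | 1 / 2 ≤ ‖z‖ ∧ ‖z‖ ≤ 1} :=
  closure_minimal (fun _ hz => iterate_lap_truncLog_support hm hz)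
    ((isClosed_le continuous_const continuous_norm).inter
      (isClosed_le continuous_norm continuous_const))

/-- The weighted mean of `h` over the annulus `t / 2 ≤ ‖y - x‖ ≤ t`. -/
noncomputable def annularMean (m : ℕ) (h : EuclideanSpace ℝ (Fin (2 * m)) → ℝ)
    (x : EuclideanSpace ℝ (Fin (2 * m))) (t : ℝ) : ℝ :=
  ∫ z, h (x + t • z) * lap^[m] truncLog z

variable {m : ℕ} {h : EuclideanSpace ℝ (Fin (2 * m)) → ℝ}
  {U : Set (EuclideanSpace ℝ (Fin (2 * m)))} {x : EuclideanSpace ℝ (Fin (2 * m))} {t : ℝ}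

lemma integrable_annularMean (hm : 1 ≤ m) (hU : IsOpen U) (hh : ContinuousOn h U)
    (hx : ∀ z : EuclideanSpace ℝ (Fin (2 * m)), 1 / 2 ≤ ‖z‖ → ‖z‖ ≤ 1 → x + t • z ∈ U) :
    Integrable fun z => h (x + t • z) * lap^[m] truncLog z := by
  have hA : Continuous fun z : EuclideanSpace ℝ (Fin (2 * m)) => x + t • z := by fun_prop
  refine integrable_mul_of_tsupport_subset (hU.preimage hA)
    (f := fun z => h (x + t • z)) (hh.comp hA.continuousOn fun z hz => hz)
    (contDiff_iterate_lap contDiff_truncLog m).continuous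
    (hasCompactSupport_iterate_lap_truncLog hm) fun z hz => ?_
  exact hx z (tsupport_iterate_lap_truncLog_subset hm hz).1
    (tsupport_iterate_lap_truncLog_subset hm hz).2

lemma contDiff_truncLog_comp_affine (x : EuclideanSpace ℝ (Fin (2 * m))) (t : ℝ) :
    ContDiff ℝ (⊤ : ℕ∞) fun y => truncLog (t⁻¹ • (y - x)) :=
  contDiff_truncLog.comp ((contDiff_id.sub contDiff_const).const_smul t⁻¹)

lemma tsupport_iterate_lap_truncLog_comp_affine_subset (hm : 1 ≤ m) (ht : 0 < t) :
    tsupport (lap^[m] fun y => truncLog (t⁻¹ • (y - x))) ⊆ {y | t / 2 ≤ ‖y - x‖ ∧ ‖y - x‖ ≤ t} := by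
  have hc : Continuous fun y => ‖y - x‖ := by fun_prop
  refine closure_minimal (fun y hy => ?_)
    ((isClosed_le continuous_const hc).inter (isClosed_le hc continuous_const))
  rw [Function.mem_support, iterate_lap_comp_affine] at hy
  have h1 := iterate_lap_truncLog_support hm (right_ne_zero_of_mul hy)
  rw [norm_inv_smul_sub ht, le_div_iff₀ ht, div_le_iff₀ ht] at h1
  exact ⟨by linarith, by linarith⟩

lemma integrable_mul_iterate_lap_truncLog_comp_affine (hm : 1 ≤ m) (hU : IsOpen U)
    (hh : ContinuousOn h U) (ht : 0 < t) (hx : ∀ y, t / 2 ≤ ‖y - x‖ → ‖y - x‖ ≤ t → y ∈ U) :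
    Integrable fun y => h y * lap^[m] (fun w => truncLog (t⁻¹ • (w - x))) y := by
  have hs := tsupport_iterate_lap_truncLog_comp_affine_subset (x := x) hm ht
  refine integrable_mul_of_tsupport_subset hU hh
    (contDiff_iterate_lap (contDiff_truncLog_comp_affine x t) m).continuous ?_
    fun y hy => hx y (hs hy).1 (hs hy).2
  refine (isCompact_closedBall x t).of_isClosed_subset (isClosed_tsupport _) fun y hy => ?_
  rw [mem_closedBall, dist_eq_norm]
  exact (hs hy).2

lemma integral_mul_iterate_lap_truncLog_comp_affine (ht : 0 < t) :
    ∫ y, h y * lap^[m] (fun w => truncLog (t⁻¹ • (w - x))) y = annularMean m h x t := by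
  rw [iterate_lap_comp_affine, integral_comp_affine h _ (inv_pos.mpr ht), inv_inv, annularMean]

lemma tendsto_annularMean_zero (hm : 1 ≤ m) (hU : IsOpen U) (hh : ContinuousOn h U) (hx : x ∈ U) :
    Tendsto (annularMean m h x) (𝓝[>] 0)
      (𝓝 (h x * ∫ z : EuclideanSpace ℝ (Fin (2 * m)), lap^[m] truncLog z)) := by
  set W := ∫ z : EuclideanSpace ℝ (Fin (2 * m)), ‖lap^[m] truncLog z‖ with hW
  have hWi : Integrable (lap^[m] (truncLog (n := 2 * m))) :=
    (contDiff_iterate_lap contDiff_truncLog m).continuous.integrable_of_hasCompactSupport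
      (hasCompactSupport_iterate_lap_truncLog hm)
  have hW0 : 0 ≤ W := integral_nonneg fun _ => norm_nonneg _
  rw [Metric.tendsto_nhds]
  intro ε hε
  have hcx := hh.continuousAt (hU.mem_nhds hx)
  obtain ⟨δ₁, hδ₁, h₁⟩ := Metric.isOpen_iff.mp hU x hx
  obtain ⟨δ₂, hδ₂, h₂⟩ := Metric.continuousAt_iff.mp hcx (ε / (W + 1)) (by positivity)
  filter_upwards [Ioo_mem_nhdsGT (lt_min hδ₁ hδ₂)] with r hr
  have hdist : ∀ z : EuclideanSpace ℝ (Fin (2 * m)), ‖z‖ ≤ 1 → dist (x + r • z) x < min δ₁ δ₂ := by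
    intro z hz
    rw [dist_eq_norm, add_sub_cancel_left, norm_smul, Real.norm_of_nonneg hr.1.le]
    exact (mul_le_of_le_one_right hr.1.le hz).trans_lt hr.2
  have hI := integrable_annularMean (t := r) hm hU hh
    fun z _ hz => h₁ ((hdist z hz).trans_le (min_le_left _ _))
  rw [annularMean, dist_eq_norm, ← integral_const_mul, ← integral_sub hI (hWi.const_mul _)]
  have hle : ‖∫ z, (h (x + r • z) * lap^[m] truncLog z - h x * lap^[m] truncLog z)‖
      ≤ ∫ z : EuclideanSpace ℝ (Fin (2 * m)), ε / (W + 1) * ‖lap^[m] truncLog z‖ := by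
    refine norm_integral_le_of_norm_le (hWi.norm.const_mul _) (ae_of_all _ fun z => ?_)
    rw [← sub_mul, norm_mul]
    by_cases hz : lap^[m] truncLog z = 0
    · simp [hz]
    · refine mul_le_mul_of_nonneg_right ?_ (norm_nonneg _)
      rw [← dist_eq_norm]
      exact (h₂ ((hdist z (iterate_lap_truncLog_support hm hz).2).trans_le
        (min_le_right _ _))).le
  refine hle.trans_lt ?_
  rw [integral_const_mul, ← hW, div_mul_eq_mul_div, div_lt_iff₀ (by positivity)]
  nlinarith

lemma exists_integral_mul_iterate_lap_eq_sum (hm : 1 ≤ m)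
    {S : Finset (EuclideanSpace ℝ (Fin (2 * m)))} {C : ℝ}
    (hsm : ContDiffOn ℝ (⊤ : ℕ∞) h (S : Set (EuclideanSpace ℝ (Fin (2 * m))))ᶜ)
    (hph : ∀ x ∉ S, lap^[m] h x = 0)
    (hgrad : ∀ x ∉ S, infDist x S * ‖fderiv ℝ h x‖ ≤ C) :
    ∃ c : EuclideanSpace ℝ (Fin (2 * m)) → ℝ, ∀ Q : EuclideanSpace ℝ (Fin (2 * m)) → ℝ,
      ContDiff ℝ (⊤ : ℕ∞) Q → HasCompactSupport Q → (∀ p ∈ S, p ∉ tsupport (lap^[m] Q)) →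
        ∫ y, h y * lap^[m] Q y = ∑ p ∈ S, Q p * c p := by
  classical
  obtain ⟨s₀, hs₀, hsep⟩ : ∃ s₀ : ℝ, 0 < s₀ ∧ ∀ p ∈ S, ∀ q ∈ S, p ≠ q → 2 * s₀ ≤ ‖p - q‖ := by
    rcases S.offDiag.eq_empty_or_nonempty with he | hne
    · refine ⟨1, one_pos, fun p hp q hq hpq => ?_⟩
      have : (p, q) ∈ S.offDiag := Finset.mem_offDiag.mpr ⟨hp, hq, hpq⟩
      rw [he] at this
      exact absurd this (Finset.notMem_empty _)
    · obtain ⟨a, ha, hmin⟩ := Finset.exists_min_image S.offDiag (fun a => ‖a.1 - a.2‖) hne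
      have ha' := Finset.mem_offDiag.mp ha
      refine ⟨‖a.1 - a.2‖ / 2, half_pos (norm_pos_iff.mpr (sub_ne_zero.mpr ha'.2.2)),
        fun p hp q hq hpq => ?_⟩
      have := hmin (p, q) (Finset.mem_offDiag.mpr ⟨hp, hq, hpq⟩)
      linarith
  have hnear : ∀ p ∈ S, ∀ y, 0 < ‖y - p‖ → ‖y - p‖ ≤ s₀ → ∀ q ∈ S, ‖y - p‖ ≤ ‖y - q‖ := by
    intro p hp y _ hys q hq
    by_cases hpq : p = q
    · rw [hpq]
    · have h1 := hsep p hp q hq hpq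
      have h2 := norm_sub_le_norm_sub_add_norm_sub p y q
      rw [norm_sub_rev p y] at h2
      linarith
  have hnot : ∀ p ∈ S, ∀ y, 0 < ‖y - p‖ → ‖y - p‖ ≤ s₀ → y ∉ S := by
    intro p hp y hy hys hyS
    have := hnear p hp y hy hys y hyS
    rw [sub_self, norm_zero] at this
    linarith
  refine ⟨fun p => ∫ y, h y * lap^[m] (cutoffAt p s₀) y, fun Q hQ hQc hQS => ?_⟩
  have hlim : Tendsto (fun s => (∑ p ∈ S,
      ∫ y, h y * lap^[m] (fun w => cutoffAt p s w * (Q w - Q p)) y)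
      + ∑ p ∈ S, Q p * ∫ y, h y * lap^[m] (cutoffAt p s₀) y) (𝓝[>] 0)
      (𝓝 ((∑ p ∈ S, 0) + ∑ p ∈ S, Q p * ∫ y, h y * lap^[m] (cutoffAt p s₀) y)) := by
    refine (tendsto_finsetSum _ fun p hp => ?_).add tendsto_const_nhds
    refine tendsto_integral_mul_iterate_lap_cutoffAt (C := C) hm hQ (hQS p hp) hs₀
      (fun y hy hys => ?_) (fun y hy hys => ?_)
    · exact (hsm.contDiffAt (S.finite_toSet.isClosed.isOpen_compl.mem_nhds
        (hnot p hp y hy hys))).differentiableAt (by simp)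
    · refine le_trans (mul_le_mul_of_nonneg_right ?_ (norm_nonneg _))
        (hgrad y (hnot p hp y hy hys))
      refine (le_infDist ⟨p, hp⟩).mpr fun q hq => ?_
      rw [dist_eq_norm]
      exact hnear p hp y hy hys q hq
  rw [Finset.sum_const_zero, zero_add] at hlim
  refine tendsto_nhds_unique (tendsto_const_nhds.congr' ?_) hlim
  filter_upwards [Ioc_mem_nhdsGT hs₀] with s hs
  exact integral_mul_iterate_lap_eq_sum hm hsm hph hQ hQc hQS hs.1 hs.2 hsep

lemma annularMean_sub_annularMean (hm : 1 ≤ m)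
    {S : Finset (EuclideanSpace ℝ (Fin (2 * m)))}
    (hh : ContinuousOn h (S : Set (EuclideanSpace ℝ (Fin (2 * m))))ᶜ)
    {c : EuclideanSpace ℝ (Fin (2 * m)) → ℝ}
    (hc : ∀ Q : EuclideanSpace ℝ (Fin (2 * m)) → ℝ,
      ContDiff ℝ (⊤ : ℕ∞) Q → HasCompactSupport Q → (∀ p ∈ S, p ∉ tsupport (lap^[m] Q)) →
        ∫ y, h y * lap^[m] Q y = ∑ p ∈ S, Q p * c p)
    {r R : ℝ} (hr : 0 < r) (hrR : r < R) (hpr : ∀ p ∈ S, r < ‖p - x‖)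
    (hpR : ∀ p ∈ S, ‖p - x‖ < R / 2) :
    annularMean m h x r - annularMean m h x R = ∑ p ∈ S, (Real.log ‖p - x‖ - Real.log R) * c p := by
  have hR : 0 < R := hr.trans hrR
  have hU : IsOpen (S : Set (EuclideanSpace ℝ (Fin (2 * m))))ᶜ :=
    S.finite_toSet.isClosed.isOpen_compl
  set L : ℝ → EuclideanSpace ℝ (Fin (2 * m)) → ℝ := fun t y => truncLog (t⁻¹ • (y - x)) with hL
  have hLs : ∀ t, ContDiff ℝ (⊤ : ℕ∞) (L t) := contDiff_truncLog_comp_affine x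
  have hLlog : ∀ t, 0 < t → ∀ y, t ≤ ‖y - x‖ → L t y = Real.log ‖y - x‖ - Real.log t := by
    intro t ht y hy
    rw [hL]
    simp only
    rw [truncLog_eq_log, norm_inv_smul_sub ht, Real.log_div (by linarith) ht.ne']
    rwa [norm_inv_smul_sub ht, le_div_iff₀ ht, one_mul]
  have hlap : lap^[m] (fun y => (L r y - L R y) - (Real.log R - Real.log r))
      = fun y => lap^[m] (L r) y - lap^[m] (L R) y := by
    rw [iterate_lap_sub_const ((hLs r).sub (hLs R)) hm, iterate_lap_sub (hLs r) (hLs R)]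
  have key := hc (fun y => (L r y - L R y) - (Real.log R - Real.log r))
    (((hLs r).sub (hLs R)).sub contDiff_const) ?_ ?_
  · rw [hlap] at key
    simp only [mul_sub] at key
    rw [integral_sub, integral_mul_iterate_lap_truncLog_comp_affine hr,
      integral_mul_iterate_lap_truncLog_comp_affine hR] at key
    · rw [key]
      refine Finset.sum_congr rfl fun p hp => ?_
      have h0 : L R p = 0 := by
        refine truncLog_eq_zero ?_
        rw [norm_inv_smul_sub hR, div_le_iff₀ hR]
        linarith [hpR p hp]
      rw [hLlog r hr p (hpr p hp).le, h0]
      ring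
    · exact integrable_mul_iterate_lap_truncLog_comp_affine hm hU hh hr
        fun y _ hy hyS => absurd (hpr y hyS) (not_lt.mpr hy)
    · exact integrable_mul_iterate_lap_truncLog_comp_affine hm hU hh hR
        fun y hy _ hyS => absurd (hpR y hyS) (not_lt.mpr hy)
  · refine HasCompactSupport.intro' (isCompact_closedBall x R) isClosed_closedBall fun y hy => ?_
    rw [mem_closedBall, not_le, dist_eq_norm] at hy
    rw [hLlog r hr y (hrR.trans hy).le, hLlog R hR y hy.le]
    ring
  · intro p hp
    rw [hlap, notMem_tsupport_iff_eventuallyEq]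
    have h1 : p ∉ tsupport (lap^[m] (L r)) := fun hp' => absurd (hpr p hp)
      (not_lt.mpr (tsupport_iterate_lap_truncLog_comp_affine_subset hm hr hp').2)
    have h2 : p ∉ tsupport (lap^[m] (L R)) := fun hp' => absurd (hpR p hp)
      (not_lt.mpr (tsupport_iterate_lap_truncLog_comp_affine_subset hm hR hp').1)
    filter_upwards [notMem_tsupport_iff_eventuallyEq.mp h1,
      notMem_tsupport_iff_eventuallyEq.mp h2] with y hy1 hy2
    rw [hy1, hy2]
    simp

lemma eventually_mul_sub_annularMean_eq (hm : 1 ≤ m)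
    {S : Finset (EuclideanSpace ℝ (Fin (2 * m)))}
    (hh : ContinuousOn h (S : Set (EuclideanSpace ℝ (Fin (2 * m))))ᶜ)
    {c : EuclideanSpace ℝ (Fin (2 * m)) → ℝ}
    (hc : ∀ Q : EuclideanSpace ℝ (Fin (2 * m)) → ℝ,
      ContDiff ℝ (⊤ : ℕ∞) Q → HasCompactSupport Q → (∀ p ∈ S, p ∉ tsupport (lap^[m] Q)) →
        ∫ y, h y * lap^[m] Q y = ∑ p ∈ S, Q p * c p) (hx : x ∉ S) :
    ∀ᶠ R in atTop, h x * (∫ z : EuclideanSpace ℝ (Fin (2 * m)), lap^[m] truncLog z)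
      - annularMean m h x R = ∑ p ∈ S, (Real.log ‖p - x‖ - Real.log R) * c p := by
  have hU : IsOpen (S : Set (EuclideanSpace ℝ (Fin (2 * m))))ᶜ :=
    S.finite_toSet.isClosed.isOpen_compl
  have hbig : ∀ᶠ R : ℝ in atTop, ∀ p ∈ S, ‖p - x‖ < R / 2 := by
    rw [Filter.eventually_all_finset]
    intro p _
    filter_upwards [eventually_gt_atTop (2 * ‖p - x‖)] with R hR
    linarith
  filter_upwards [hbig, eventually_gt_atTop 0] with R hR hR0
  have hsmall : ∀ᶠ r : ℝ in 𝓝[>] 0, ∀ p ∈ S, r < ‖p - x‖ := by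
    rw [Filter.eventually_all_finset]
    intro p hp
    have h0 : 0 < ‖p - x‖ := norm_pos_iff.mpr (sub_ne_zero.mpr fun e => hx (e ▸ hp))
    filter_upwards [Ioo_mem_nhdsGT h0] with r hr using hr.2
  refine tendsto_nhds_unique
    ((tendsto_annularMean_zero hm hU hh (show x ∈ (S : Set _)ᶜ from hx)).sub_const _)
    (tendsto_const_nhds.congr' ?_)
  filter_upwards [hsmall, Ioo_mem_nhdsGT hR0] with r hr hr'
  exact (annularMean_sub_annularMean hm hh hc hr'.1 hr'.2 hr hR).symm

lemma tendsto_annularMean_sub_annularMean (hm : 1 ≤ m)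
    {S : Finset (EuclideanSpace ℝ (Fin (2 * m)))} (hS : S.Nonempty) {C : ℝ}
    (hd : DifferentiableOn ℝ h (S : Set (EuclideanSpace ℝ (Fin (2 * m))))ᶜ)
    (hgrad : ∀ x ∉ S, infDist x S * ‖fderiv ℝ h x‖ ≤ C)
    (x x' : EuclideanSpace ℝ (Fin (2 * m))) :
    Tendsto (fun R => annularMean m h x R - annularMean m h x' R) atTop (𝓝 0) := by
  have hU : IsOpen (S : Set (EuclideanSpace ℝ (Fin (2 * m))))ᶜ :=
    S.finite_toSet.isClosed.isOpen_compl
  have hWi : Integrable (lap^[m] (truncLog (n := 2 * m))) :=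
    (contDiff_iterate_lap contDiff_truncLog m).continuous.integrable_of_hasCompactSupport
      (hasCompactSupport_iterate_lap_truncLog hm)
  obtain ⟨D, hD⟩ : ∃ D : ℝ, ∀ u ∈ segment ℝ x x', ∀ p ∈ S, ‖p - u‖ ≤ D := by
    have hb : Bornology.IsBounded
        ((S : Set (EuclideanSpace ℝ (Fin (2 * m)))) ∪ segment ℝ x x') := by
      refine S.finite_toSet.isBounded.union ?_
      rw [← convexHull_pair]
      exact isBounded_convexHull.mpr (Set.toFinite _).isBounded
    obtain ⟨D, hD⟩ := Metric.isBounded_iff.mp hb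
    refine ⟨D, fun u hu p hp => ?_⟩
    rw [← dist_eq_norm]
    exact hD (Or.inl hp) (Or.inr hu)
  have hlim : Tendsto (fun R : ℝ => C / (R / 2 - D) * ‖x - x'‖
      * ∫ z : EuclideanSpace ℝ (Fin (2 * m)), ‖lap^[m] truncLog z‖) atTop (𝓝 0) := by
    have h1 : Tendsto (fun R : ℝ => R / 2 - D) atTop atTop :=
      tendsto_atTop_add_const_right _ _ (tendsto_id.atTop_div_const two_pos)
    simpa using ((h1.const_div_atTop C).mul_const ‖x - x'‖).mul_const
      (∫ z : EuclideanSpace ℝ (Fin (2 * m)), ‖lap^[m] truncLog z‖)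
  refine squeeze_zero_norm' ?_ hlim
  filter_upwards [eventually_gt_atTop (2 * D), eventually_gt_atTop 0] with R hRD hR
  have hpos : 0 < R / 2 - D := by linarith
  have hfar : ∀ u ∈ segment ℝ x x', ∀ z : EuclideanSpace ℝ (Fin (2 * m)), 1 / 2 ≤ ‖z‖ →
      ∀ p ∈ S, R / 2 - D ≤ ‖u + R • z - p‖ := by
    intro u hu z hz p hp
    have h1 : ‖R • z‖ = R * ‖z‖ := by rw [norm_smul, Real.norm_of_nonneg hR.le]
    have h2 : R • z = (u + R • z - p) + (p - u) := by abel
    have h3 := norm_add_le (u + R • z - p) (p - u)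
    rw [← h2, h1] at h3
    nlinarith [hD u hu p hp]
  have hmem : ∀ u ∈ segment ℝ x x', ∀ z : EuclideanSpace ℝ (Fin (2 * m)), 1 / 2 ≤ ‖z‖ →
      u + R • z ∉ S := by
    intro u hu z hz hS'
    have := hfar u hu z hz _ hS'
    rw [sub_self, norm_zero] at this
    linarith
  have hdiff : ∀ z : EuclideanSpace ℝ (Fin (2 * m)), 1 / 2 ≤ ‖z‖ →
      ‖h (x + R • z) - h (x' + R • z)‖ ≤ C / (R / 2 - D) * ‖x - x'‖ := by
    intro z hz
    have hder : ∀ u ∈ segment ℝ x x', HasFDerivWithinAt (fun u => h (u + R • z))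
        (fderiv ℝ h (u + R • z)) (segment ℝ x x') u := by
      intro u hu
      have h1 := (hd.differentiableAt (hU.mem_nhds (hmem u hu z hz))).hasFDerivAt
      exact (h1.comp u ((hasFDerivAt_id u).add_const (R • z))).hasFDerivWithinAt
    have hbd : ∀ u ∈ segment ℝ x x', ‖fderiv ℝ h (u + R • z)‖ ≤ C / (R / 2 - D) := by
      intro u hu
      rw [le_div_iff₀ hpos, mul_comm]
      refine le_trans (mul_le_mul_of_nonneg_right ?_ (norm_nonneg _)) (hgrad _ (hmem u hu z hz))
      refine (le_infDist hS).mpr fun p hp => ?_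
      rw [dist_eq_norm]
      exact hfar u hu z hz p hp
    exact (convex_segment x x').norm_image_sub_le_of_norm_hasFDerivWithin_le hder hbd
      (right_mem_segment ℝ x x') (left_mem_segment ℝ x x')
  rw [annularMean, annularMean, ← integral_sub
    (integrable_annularMean hm hU hd.continuousOn
      fun z hz _ => hmem x (left_mem_segment ℝ x x') z hz)
    (integrable_annularMean hm hU hd.continuousOn
      fun z hz _ => hmem x' (right_mem_segment ℝ x x') z hz), ← integral_const_mul]
  refine norm_integral_le_of_norm_le (hWi.norm.const_mul _) (ae_of_all _ fun z => ?_)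
  rw [← sub_mul, norm_mul]
  by_cases hz : lap^[m] truncLog z = 0
  · simp [hz]
  · exact mul_le_mul_of_nonneg_right (hdiff z (iterate_lap_truncLog_support hm hz).1)
      (norm_nonneg _)

lemma exists_eq_sum_log_of_iterate_lap_eq_zero (hm : 1 ≤ m)
    {S : Finset (EuclideanSpace ℝ (Fin (2 * m)))} (hS : S.Nonempty) {C : ℝ}
    (hsm : ContDiffOn ℝ (⊤ : ℕ∞) h (S : Set (EuclideanSpace ℝ (Fin (2 * m))))ᶜ)
    (hph : ∀ x ∉ S, lap^[m] h x = 0)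
    (hgrad : ∀ x ∉ S, infDist x S * ‖fderiv ℝ h x‖ ≤ C) :
    ∃ (β : ℝ) (b : EuclideanSpace ℝ (Fin (2 * m)) → ℝ), ∀ x ∉ S,
      h x = (∑ p ∈ S, b p * Real.log ‖x - p‖) + β := by
  by_cases hne : ∃ x₀, x₀ ∉ S
  swap
  · exact ⟨0, 0, fun x hx => absurd ⟨x, hx⟩ hne⟩
  obtain ⟨x₀, hx₀⟩ := hne
  obtain ⟨c, hc⟩ := exists_integral_mul_iterate_lap_eq_sum hm hsm hph hgrad
  set W := ∫ z : EuclideanSpace ℝ (Fin (2 * m)), lap^[m] truncLog z with hW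
  have hW0 : W ≠ 0 := integral_iterate_lap_truncLog_ne_zero hm
  have hkey : ∀ x ∉ S, (h x - h x₀) * W
      = ∑ p ∈ S, (Real.log ‖x - p‖ - Real.log ‖x₀ - p‖) * c p := by
    intro x hx
    have hlim := tendsto_annularMean_sub_annularMean hm hS (hsm.differentiableOn (by simp))
      hgrad x x₀
    have h2 : Tendsto (fun R => annularMean m h x R - annularMean m h x₀ R) atTop
        (𝓝 ((h x - h x₀) * W - ∑ p ∈ S, (Real.log ‖x - p‖ - Real.log ‖x₀ - p‖) * c p)) := by
      refine tendsto_const_nhds.congr' ?_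
      filter_upwards [eventually_mul_sub_annularMean_eq hm hsm.continuousOn hc hx,
        eventually_mul_sub_annularMean_eq hm hsm.continuousOn hc hx₀] with R h1 h2
      have h3 : ∑ p ∈ S, (Real.log ‖x - p‖ - Real.log ‖x₀ - p‖) * c p
          = ∑ p ∈ S, (Real.log ‖p - x‖ - Real.log R) * c p
            - ∑ p ∈ S, (Real.log ‖p - x₀‖ - Real.log R) * c p := by
        rw [← Finset.sum_sub_distrib]
        refine Finset.sum_congr rfl fun p _ => ?_
        rw [norm_sub_rev x p, norm_sub_rev x₀ p]
        ring
      rw [h3, ← h1, ← h2]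
      ring
    exact sub_eq_zero.mp (tendsto_nhds_unique h2 hlim)
  refine ⟨h x₀ - ∑ p ∈ S, c p / W * Real.log ‖x₀ - p‖, fun p => c p / W, fun x hx => ?_⟩
  have h1 : ∑ p ∈ S, c p / W * Real.log ‖x - p‖ - ∑ p ∈ S, c p / W * Real.log ‖x₀ - p‖
      = (∑ p ∈ S, (Real.log ‖x - p‖ - Real.log ‖x₀ - p‖) * c p) / W := by
    rw [← Finset.sum_sub_distrib, Finset.sum_div]
    exact Finset.sum_congr rfl fun p _ => by ring
  rw [← hkey x hx, mul_div_cancel_right₀ _ hW0] at h1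
  linarith

end Classification

lemma Finset.sum_image_eq_sum_div_card {ι α : Type*} [Fintype ι] [DecidableEq α] (f : ι → α)
    (g : α → ℝ) :
    ∑ a ∈ Finset.univ.image f, g a = ∑ i, g (f i) / (Finset.univ.filter (f · = f i)).card := by
  rw [← Finset.sum_fiberwise_of_maps_to (g := f) (t := Finset.univ.image f)
    (fun i hi => Finset.mem_image_of_mem f hi)]
  refine Finset.sum_congr rfl fun a ha => ?_
  obtain ⟨i, -, rfl⟩ := Finset.mem_image.mp ha
  have hcard : ((Finset.univ.filter (f · = f i)).card : ℝ) ≠ 0 := by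
    exact_mod_cast (Finset.card_pos.mpr ⟨i, by simp⟩).ne'
  rw [Finset.sum_congr rfl (g := fun _ => g (f i) / (Finset.univ.filter (f · = f i)).card)
    fun j hj => by rw [(Finset.mem_filter.mp hj).2], Finset.sum_const, nsmul_eq_mul]
  field_simp

theorem stmt_11 (m I : ℕ) (hm : 1 ≤ m) (hI : 1 ≤ I)
    (pts : Fin I → EuclideanSpace ℝ (Fin (2*m)))
    (h : EuclideanSpace ℝ (Fin (2*m)) → ℝ)
    (hsm : ContDiffOn ℝ (⊤ : ℕ∞) h (Set.range pts)ᶜ)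
    (hph : ∀ x ∉ Set.range pts, lap^[m] h x = 0)
    (C : ℝ)
    (hgrad : ∀ x ∉ Set.range pts, infDist x (Set.range pts) * ‖fderiv ℝ h x‖ ≤ C) :
    ∃ (β : ℝ) (lam : Fin I → ℝ), ∀ x ∉ Set.range pts,
      h x = (∑ i, lam i * Real.log (1 / ‖x - pts i‖)) + β := by
  classical
  have hS : Set.range pts = ((Finset.univ.image pts : Finset _) : Set _) := by simp
  simp only [hS, Finset.mem_coe] at hsm hph hgrad ⊢
  obtain ⟨β, b, hb⟩ := exists_eq_sum_log_of_iterate_lap_eq_zero hm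
    (Finset.image_nonempty.mpr ⟨⟨0, hI⟩, Finset.mem_univ _⟩) hsm hph hgrad
  refine ⟨β, fun i => -(b (pts i) / (Finset.univ.filter (pts · = pts i)).card), fun x hx => ?_⟩
  rw [hb x hx, Finset.sum_image_eq_sum_div_card]
  congr 1
  refine Finset.sum_congr rfl fun i _ => ?_
  rw [one_div, Real.log_inv]
  ring
end
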